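/- arXiv:2408.01314 — 3 statements merged into one kernel-verified Lean document; each statement's English description precedes it below -/
import Mathlib

section
/- For every irrational number α, every real number β, every real number c satisfying 1 < c < 12/11 and every positive real number θ satisfying θ < (12/c − 11)/26, there exist infinitely many prime numbers p such that p = ⌊n^c⌋ for some positive integer n and ‖αp + β‖ < p^{−θ}. -/
open Finset

noncomputable def e (z : ℝ) : ℂ := Complex.exp (2 * Real.pi * Complex.I * z)

noncomputable def nint (x : ℝ) : ℝ := |x - round x|

noncomputable def dyN (Y : ℝ) : Finset ℕ :=
  (Finset.range (⌈Y⌉₊ + 1)).filter fun m => Y/2 ≤ (m:ℝ) ∧ (m:ℝ) < Y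

noncomputable def dyZ (Y : ℝ) : Finset ℤ :=
  (Finset.Icc (-(⌈Y⌉₊:ℤ)) (⌈Y⌉₊:ℤ)).filter fun l => l ≠ 0 ∧ Y/2 ≤ |(l:ℝ)| ∧ |(l:ℝ)| < Y

theorem e_eq_cos_add_sin (x : ℝ) :
    e x = (Real.cos (2 * Real.pi * x) : ℂ) + (Real.sin (2 * Real.pi * x) : ℂ) * Complex.I := by
  rw [e, Complex.ofReal_cos, Complex.ofReal_sin, ← Complex.exp_mul_I]
  congr 1; push_cast; ring

theorem norm_e (x : ℝ) : ‖e x‖ = 1 := by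
  rw [e, show 2 * (Real.pi : ℂ) * Complex.I * x = ((2 * Real.pi * x : ℝ) : ℂ) * Complex.I by
    push_cast; ring]
  exact Complex.norm_exp_ofReal_mul_I _

theorem e_add (x y : ℝ) : e (x + y) = e x * e y := by
  rw [e, e, e, ← Complex.exp_add]; congr 1; push_cast; ring

theorem e_zero : e 0 = 1 := by simp [e]

theorem e_neg (x : ℝ) : e (-x) = (starRingEnd ℂ) (e x) := by
  rw [e, e, ← Complex.exp_conj]; congr 1
  simp only [map_mul, Complex.conj_ofReal, Complex.conj_I, map_ofNat]
  push_cast; ring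

theorem e_sub (x y : ℝ) : e (x - y) = e x * (starRingEnd ℂ) (e y) := by
  rw [sub_eq_add_neg, e_add, e_neg]

theorem e_intCast (k : ℤ) : e k = 1 := by
  rw [e, Complex.exp_eq_one_iff]; exact ⟨k, by push_cast; ring⟩

theorem norm_sum_e_neg {ι : Type*} (s : Finset ι) (x : ι → ℝ) :
    ‖∑ n ∈ s, e (-x n)‖ = ‖∑ n ∈ s, e (x n)‖ := by
  simp_rw [e_neg]
  rw [← map_sum, Complex.norm_conj]

theorem norm_sum_e_le_card {ι : Type*} (s : Finset ι) (x : ι → ℝ) :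
    ‖∑ n ∈ s, e (x n)‖ ≤ #s := by
  refine (norm_sum_le _ _).trans ?_
  simp [norm_e]

theorem one_sub_e_mul {u : ℝ} (hu : Real.sin (Real.pi * u) ≠ 0) :
    (1 - e u) * (1 / 2 + ((Real.cos (Real.pi * u) / Real.sin (Real.pi * u) / 2 : ℝ) : ℂ)
      * Complex.I) = 1 := by
  rw [e_eq_cos_add_sin]
  have h1 : 2 * Real.pi * u = 2 * (Real.pi * u) := by ring
  rw [h1, Real.cos_two_mul, Real.sin_two_mul]
  set s := Real.sin (Real.pi * u)
  set c := Real.cos (Real.pi * u)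
  have hsc : s ^ 2 + c ^ 2 = 1 := Real.sin_sq_add_cos_sq _
  apply Complex.ext
  · simp only [Complex.mul_re, Complex.sub_re, Complex.add_re, Complex.sub_im, Complex.add_im,
      Complex.ofReal_re, Complex.ofReal_im, Complex.I_re, Complex.I_im, Complex.mul_im,
      Complex.one_re, Complex.one_im]
    norm_num
    field_simp
    nlinarith
  · simp only [Complex.mul_re, Complex.sub_re, Complex.add_re, Complex.sub_im, Complex.add_im,
      Complex.ofReal_re, Complex.ofReal_im, Complex.I_re, Complex.I_im, Complex.mul_im,
      Complex.one_re, Complex.one_im]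
    norm_num
    field_simp
    have : s ^ 2 = 1 - c ^ 2 := by linarith
    rw [this]
    ring

theorem sin_pi_mul_ge {ρ u : ℝ} (hρ : 0 < ρ) (h1 : ρ ≤ u) (h2 : u ≤ 1 - ρ) :
    2 * ρ ≤ Real.sin (Real.pi * u) := by
  have hpi := Real.pi_pos
  rcases le_total u (1 / 2) with h | h
  · have := Real.mul_le_sin (x := Real.pi * u) (by nlinarith) (by nlinarith)
    calc 2 * ρ ≤ 2 * u := by linarith
      _ = 2 / Real.pi * (Real.pi * u) := by field_simp
      _ ≤ _ := this
  · have := Real.mul_le_sin (x := Real.pi * (1 - u)) (by nlinarith) (by nlinarith)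
    have h3 : Real.sin (Real.pi * u) = Real.sin (Real.pi * (1 - u)) := by
      rw [show Real.pi * (1 - u) = Real.pi - Real.pi * u by ring, Real.sin_pi_sub]
    rw [h3]
    calc 2 * ρ ≤ 2 * (1 - u) := by linarith
      _ = 2 / Real.pi * (Real.pi * (1 - u)) := by field_simp
      _ ≤ _ := this

theorem cot_pi_mul_anti {u v : ℝ} (hu : 0 < u) (huv : u ≤ v) (hv : v < 1) :
    Real.cos (Real.pi * v) / Real.sin (Real.pi * v) ≤
      Real.cos (Real.pi * u) / Real.sin (Real.pi * u) := by
  have hpi := Real.pi_pos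
  have su : 0 < Real.sin (Real.pi * u) :=
    Real.sin_pos_of_pos_of_lt_pi (by positivity) (by nlinarith)
  have sv : 0 < Real.sin (Real.pi * v) :=
    Real.sin_pos_of_pos_of_lt_pi (by nlinarith) (by nlinarith)
  rw [div_le_div_iff₀ sv su]
  have : 0 ≤ Real.sin (Real.pi * v - Real.pi * u) :=
    Real.sin_nonneg_of_nonneg_of_le_pi (by nlinarith) (by nlinarith)
  rw [Real.sin_sub] at this
  linarith

/-- The Kusmin–Landau inequality for a sequence whose differences are monotone and lie in
`[ρ, 1 - ρ]`. -/
theorem norm_sum_range_e_le_aux (x : ℕ → ℝ) (K : ℕ) {ρ : ℝ} (hρ : 0 < ρ)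
    (h1 : ∀ n < K, ρ ≤ x (n + 1) - x n) (h2 : ∀ n < K, x (n + 1) - x n ≤ 1 - ρ)
    (hm : ∀ n, n + 1 < K → x (n + 1) - x n ≤ x (n + 2) - x (n + 1)) :
    ‖∑ n ∈ range K, e (x n)‖ ≤ 1 / ρ := by
  set t : ℕ → ℝ := fun n =>
    Real.cos (Real.pi * (x (n + 1) - x n)) / Real.sin (Real.pi * (x (n + 1) - x n)) with ht
  set c : ℕ → ℂ := fun n => 1 / 2 + ((t n / 2 : ℝ) : ℂ) * Complex.I with hc
  have hs : ∀ n < K, 2 * ρ ≤ Real.sin (Real.pi * (x (n + 1) - x n)) := fun n hn =>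
    sin_pi_mul_ge hρ (h1 n hn) (h2 n hn)
  have hE : ∀ n < K, e (x n) = c n * e (x n) - c n * e (x (n + 1)) := by
    intro n hn
    have h3 := one_sub_e_mul (u := x (n + 1) - x n) (by have := hs n hn; linarith)
    have h4 : e (x (n + 1)) = e (x n) * e (x (n + 1) - x n) := by rw [← e_add]; congr 1; ring
    rw [h4]
    calc e (x n) = e (x n) * ((1 - e (x (n + 1) - x n)) * c n) := by rw [hc, ht, h3, mul_one]
      _ = _ := by ring
  have htb : ∀ n < K, |t n| ≤ 1 / (2 * ρ) := by
    intro n hn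
    have h5 := hs n hn
    rw [ht, abs_div, abs_of_pos (a := Real.sin _) (by linarith)]
    calc _ ≤ 1 / Real.sin (Real.pi * (x (n + 1) - x n)) := by
          gcongr
          · linarith
          · exact Real.abs_cos_le_one _
      _ ≤ _ := by gcongr
  have hcb : ∀ n < K, ‖c n‖ ≤ 1 / (4 * ρ) := by
    intro n hn
    have h5 := hs n hn
    have h6 := one_sub_e_mul (u := x (n + 1) - x n) (by linarith)
    have h7 : ‖1 - e (x (n + 1) - x n)‖ * ‖c n‖ = 1 := by
      rw [← norm_mul]; rw [hc, ht, h6, norm_one]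
    have h8 : 4 * ρ ≤ ‖1 - e (x (n + 1) - x n)‖ := by
      have h9 : ‖1 - e (x (n + 1) - x n)‖ ^ 2 =
          (2 * Real.sin (Real.pi * (x (n + 1) - x n))) ^ 2 := by
        rw [← Complex.normSq_eq_norm_sq, Complex.normSq_apply, e_eq_cos_add_sin,
          show 2 * Real.pi * (x (n + 1) - x n) = 2 * (Real.pi * (x (n + 1) - x n)) by ring,
          Real.cos_two_mul, Real.sin_two_mul]
        simp only [Complex.sub_re, Complex.add_re, Complex.sub_im, Complex.add_im,
          Complex.ofReal_re, Complex.ofReal_im, Complex.I_re, Complex.I_im, Complex.mul_im,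
          Complex.mul_re, Complex.one_re, Complex.one_im]
        have := Real.sin_sq_add_cos_sq (Real.pi * (x (n + 1) - x n))
        have h10 := Real.cos_sq' (Real.pi * (x (n + 1) - x n))
        ring_nf
        ring_nf at h10
        rw [show ∀ a : ℝ, a ^ 4 = (a ^ 2) ^ 2 from fun a => by ring, h10]
        ring
      nlinarith [norm_nonneg (1 - e (x (n + 1) - x n))]
    have h11 : 4 * ρ * ‖c n‖ ≤ 1 := by
      rw [← h7]; gcongr
    rw [le_div_iff₀ (by positivity)]; linarith
  rcases Nat.eq_zero_or_pos K with rfl | hK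
  · simp [hρ.le]
  have key : ∀ k < K, ‖∑ n ∈ range (k + 1), e (x n) + c k * e (x (k + 1))‖ ≤
      ‖c 0‖ + (t 0 - t k) / 2 := by
    intro k
    induction k with
    | zero =>
      intro _
      rw [sum_range_one, hE 0 hK, sub_add_cancel, norm_mul, norm_e]; simp
    | succ k ih =>
      intro hk
      have h12 : ∑ n ∈ range (k + 1 + 1), e (x n) + c (k + 1) * e (x (k + 1 + 1)) =
          (∑ n ∈ range (k + 1), e (x n) + c k * e (x (k + 1))) +
            (c (k + 1) - c k) * e (x (k + 1)) := by
        rw [sum_range_succ _ (k + 1)]; linear_combination hE (k + 1) hk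
      have h13 : ‖c (k + 1) - c k‖ = (t k - t (k + 1)) / 2 := by
        have h14 : t (k + 1) ≤ t k := by
          apply cot_pi_mul_anti
          · linarith [h1 k (by omega)]
          · exact hm k hk
          · linarith [h2 (k + 1) hk]
        have : c (k + 1) - c k = ((-((t k - t (k + 1)) / 2) : ℝ) : ℂ) * Complex.I := by
          rw [hc]; push_cast; ring
        rw [this, norm_mul, Complex.norm_I, mul_one, Complex.norm_real, Real.norm_eq_abs, abs_neg,
          abs_of_nonneg (by linarith)]
      rw [h12]
      refine (norm_add_le _ _).trans ?_
      rw [norm_mul, norm_e, mul_one, h13]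
      linarith [ih (by omega)]
  obtain ⟨k, rfl⟩ : ∃ k, K = k + 1 := ⟨K - 1, by omega⟩
  have h15 := key k (by omega)
  have h16 : ‖∑ n ∈ range (k + 1), e (x n)‖ ≤
      ‖∑ n ∈ range (k + 1), e (x n) + c k * e (x (k + 1))‖ + ‖c k‖ := by
    have := norm_sub_le (∑ n ∈ range (k + 1), e (x n) + c k * e (x (k + 1)))
      (c k * e (x (k + 1)))
    rwa [add_sub_cancel_right, norm_mul, norm_e, mul_one] at this
  have a1 := htb 0 hK
  have a2 := htb k (by omega)
  have a3 := hcb 0 hK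
  have a4 := hcb k (by omega)
  have a5 := (abs_le.1 a1).2
  have a6 := (abs_le.1 a2).1
  have : 1 / ρ = 1 / (4 * ρ) + 1 / (4 * ρ) + (1 / (2 * ρ) + 1 / (2 * ρ)) / 2 := by
    field_simp; norm_num
  rw [this]
  linarith

theorem norm_sum_Ico_e_le (x : ℕ → ℝ) (a b : ℕ) {ρ : ℝ} (hρ : 0 < ρ) (ν : ℤ)
    (h1 : ∀ n ∈ Ico a b, ν + ρ ≤ x (n + 1) - x n)
    (h2 : ∀ n ∈ Ico a b, x (n + 1) - x n ≤ ν + 1 - ρ)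
    (hm : ∀ n, a ≤ n → n + 1 < b → x (n + 1) - x n ≤ x (n + 2) - x (n + 1)) :
    ‖∑ n ∈ Ico a b, e (x n)‖ ≤ 1 / ρ := by
  rw [sum_Ico_eq_sum_range]
  have h3 := norm_sum_range_e_le_aux (fun n => x (a + n) - ν * ((a + n : ℕ) : ℝ)) (b - a) hρ
    (fun n hn => by
      have := h1 (a + n) (by simp; omega)
      push_cast
      rw [show a + (n + 1) = a + n + 1 by ring]
      linarith)
    (fun n hn => by
      have := h2 (a + n) (by simp; omega)
      push_cast
      rw [show a + (n + 1) = a + n + 1 by ring]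
      linarith)
    (fun n hn => by
      have := hm (a + n) (by omega) (by omega)
      push_cast
      rw [show a + (n + 1) = a + n + 1 by ring, show a + (n + 2) = a + n + 2 by ring]
      linarith)
  refine le_trans (le_of_eq ?_) h3
  congr 1
  refine sum_congr rfl fun n _ => ?_
  have : x (a + n) - ν * ((a + n : ℕ) : ℝ) = x (a + n) - ((ν * (a + n : ℕ) : ℤ) : ℝ) := by
    push_cast; ring
  rw [this, e_sub, e_intCast]; simp

theorem sub_mul_le_of_forall_succ {d : ℕ → ℝ} {K : ℕ} {l u : ℝ}
    (h1 : ∀ n, n + 1 < K → l ≤ d (n + 1) - d n) (h2 : ∀ n, n + 1 < K → d (n + 1) - d n ≤ u)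
    (m k : ℕ) (hk : m + k < K) : k * l ≤ d (m + k) - d m ∧ d (m + k) - d m ≤ k * u := by
  induction k with
  | zero => simp
  | succ k ih =>
    obtain ⟨i1, i2⟩ := ih (by omega)
    have := h1 (m + k) (by omega)
    have := h2 (m + k) (by omega)
    rw [show m + (k + 1) = m + k + 1 by ring]
    push_cast
    constructor <;> linarith

/-- The van der Corput second derivative test in terms of second differences. -/
theorem norm_sum_range_e_le (x : ℕ → ℝ) (K : ℕ) {l A : ℝ} (hl : 0 < l) (hA : 1 ≤ A)
    (h1 : ∀ n, n + 1 < K → l ≤ (x (n + 2) - x (n + 1)) - (x (n + 1) - x n))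
    (h2 : ∀ n, n + 1 < K → (x (n + 2) - x (n + 1)) - (x (n + 1) - x n) ≤ A * l) :
    ‖∑ n ∈ range K, e (x n)‖ ≤ 5 * A * √l * K + 10 / √l := by
  have hsl : 0 < √l := Real.sqrt_pos.2 hl
  have hsq : √l * √l = l := Real.mul_self_sqrt hl.le
  rcases lt_or_ge (1 / 4) l with h4 | h4
  · have h5 : 1 / 2 ≤ √l := Real.le_sqrt_of_sq_le (by norm_num; linarith)
    refine (norm_sum_e_le_card _ _).trans ?_
    rw [card_range]
    have : (K : ℝ) ≤ 5 * A * √l * K := le_mul_of_one_le_left (by positivity) (by nlinarith)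
    have : 0 ≤ 10 / √l := by positivity
    linarith
  have h5 : √l ≤ 1 / 2 := by rw [Real.sqrt_le_left (by norm_num)]; norm_num; linarith
  rcases Nat.eq_zero_or_pos K with rfl | hK
  · simp; positivity
  set d : ℕ → ℝ := fun n => x (n + 1) - x n with hd
  have hsp : ∀ m n, m ≤ n → n < K → (n - m) * l ≤ d n - d m ∧ d n - d m ≤ (n - m) * (A * l) := by
    intro m n hmn hn
    have := sub_mul_le_of_forall_succ (d := d) h1 h2 m (n - m) (by omega)
    rwa [Nat.add_sub_cancel' hmn, Nat.cast_sub hmn] at this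
  have hmono : ∀ m n, m ≤ n → n < K → d m ≤ d n := by
    intro m n hmn hn
    have := (hsp m n hmn hn).1
    have : (0 : ℝ) ≤ (n - m) * l := by
      have : (m : ℝ) ≤ n := by exact_mod_cast hmn
      apply mul_nonneg <;> linarith
    linarith
  have hcard : ∀ (S : Finset ℕ) (u : ℝ), (∀ n ∈ S, n < K ∧ u ≤ d n ∧ d n ≤ u + √l) →
      (#S : ℝ) ≤ 1 / √l + 1 := by
    intro S u hS
    rcases S.eq_empty_or_nonempty with rfl | hne
    · simp; positivity
    have hmin := hS _ (S.min'_mem hne)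
    have hmax := hS _ (S.max'_mem hne)
    have hle : S.min' hne ≤ S.max' hne := S.min'_le _ (S.max'_mem hne)
    have h6 : #S ≤ S.max' hne + 1 - S.min' hne := by
      rw [← Nat.card_Icc]
      exact card_le_card fun n hn => mem_Icc.2 ⟨S.min'_le _ hn, S.le_max' _ hn⟩
    have h7 : (#S : ℝ) ≤ (S.max' hne : ℝ) - S.min' hne + 1 := by
      have : #S + S.min' hne ≤ S.max' hne + 1 := by omega
      have : (#S : ℝ) + S.min' hne ≤ S.max' hne + 1 := by exact_mod_cast this
      linarith
    have h8 := (hsp _ _ hle hmax.1).1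
    have h9 : ((S.max' hne : ℝ) - S.min' hne) ≤ 1 / √l := by
      rw [le_div_iff₀ hsl]
      have : ((S.max' hne : ℝ) - S.min' hne) * √l * √l ≤ 1 * √l := by
        rw [mul_assoc, hsq]; linarith [hmin.2.1, hmax.2.2]
      exact le_of_mul_le_mul_right this hsl
    linarith
  have hmid : ∀ ν : ℤ, ‖∑ n ∈ (range K).filter (fun n => (ν : ℝ) + √l ≤ d n ∧ d n ≤ ν + 1 - √l),
      e (x n)‖ ≤ 1 / √l := by
    intro ν
    set S := (range K).filter (fun n => (ν : ℝ) + √l ≤ d n ∧ d n ≤ ν + 1 - √l) with hS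
    rcases S.eq_empty_or_nonempty with he | hne
    · rw [he]; simp
    have hSe : S = Ico (S.min' hne) (S.max' hne + 1) := by
      ext n
      constructor
      · intro hn
        have := S.min'_le _ hn
        have := S.le_max' _ hn
        simp; omega
      · intro hn
        rw [mem_Ico] at hn
        have hSm : ∀ n, n ∈ S ↔ n < K ∧ (ν : ℝ) + √l ≤ d n ∧ d n ≤ ν + 1 - √l := by
          intro n; rw [hS, mem_filter, mem_range]
        have h6 := (hSm _).1 (S.min'_mem hne)
        have h7 := (hSm _).1 (S.max'_mem hne)
        rw [hSm]
        have h8 := hmono _ n hn.1 (by omega)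
        have h9 := hmono n _ (show n ≤ S.max' hne by omega) h7.1
        exact ⟨by omega, by linarith, by linarith⟩
    have hmem : ∀ n ∈ Ico (S.min' hne) (S.max' hne + 1), n < K ∧ (ν : ℝ) + √l ≤ d n ∧
        d n ≤ ν + 1 - √l := by
      intro n hn
      rw [← hSe, hS, mem_filter, mem_range] at hn
      exact hn
    rw [hSe]
    refine norm_sum_Ico_e_le x _ _ hsl ν (fun n hn => (hmem n hn).2.1)
      (fun n hn => (hmem n hn).2.2) fun n hn1 hn2 => ?_
    have := (hmem (n + 1) (by simp; omega)).1
    exact hmono n (n + 1) (by omega) this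
  have hfib : ∀ ν : ℤ, ‖∑ n ∈ (range K).filter (fun n => ⌊d n⌋ = ν), e (x n)‖ ≤ 4 / √l + 1 := by
    intro ν
    set G := (range K).filter (fun n => ⌊d n⌋ = ν) with hG
    have hsplit : ∑ n ∈ G, e (x n) = ∑ n ∈ G.filter (fun n => d n < ν + √l), e (x n) +
        (∑ n ∈ (G.filter (fun n => ¬ d n < ν + √l)).filter (fun n => ν + 1 - √l < d n), e (x n) +
        ∑ n ∈ (G.filter (fun n => ¬ d n < ν + √l)).filter (fun n => ¬ ν + 1 - √l < d n),
          e (x n)) := by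
      rw [sum_filter_add_sum_filter_not, sum_filter_add_sum_filter_not]
    have hGm : ∀ n ∈ G, n < K ∧ (ν : ℝ) ≤ d n ∧ d n < ν + 1 := by
      intro n hn
      rw [hG, mem_filter, mem_range, Int.floor_eq_iff] at hn
      exact hn
    have e3 : (G.filter (fun n => ¬ d n < ν + √l)).filter (fun n => ¬ ν + 1 - √l < d n) =
        (range K).filter (fun n => (ν : ℝ) + √l ≤ d n ∧ d n ≤ ν + 1 - √l) := by
      ext n
      simp only [hG, mem_filter, mem_range, not_lt, Int.floor_eq_iff]
      constructor
      · rintro ⟨⟨⟨a, b⟩, c⟩, f⟩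
        exact ⟨a, c, f⟩
      · rintro ⟨a, c, f⟩
        exact ⟨⟨⟨a, by linarith, by linarith⟩, c⟩, f⟩
    rw [hsplit, e3]
    refine (norm_add_le _ _).trans ?_
    have b1 : ‖∑ n ∈ G.filter (fun n => d n < ν + √l), e (x n)‖ ≤ 1 / √l + 1 := by
      refine (norm_sum_e_le_card _ _).trans (hcard _ ν fun n hn => ?_)
      rw [mem_filter] at hn
      have := hGm n hn.1
      exact ⟨this.1, this.2.1, hn.2.le⟩
    have b2 : ‖∑ n ∈ (G.filter (fun n => ¬ d n < ν + √l)).filter (fun n => ν + 1 - √l < d n),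
        e (x n)‖ ≤ 1 / √l + 1 := by
      refine (norm_sum_e_le_card _ _).trans (hcard _ (ν + 1 - √l) fun n hn => ?_)
      rw [mem_filter, mem_filter] at hn
      have := hGm n hn.1.1
      exact ⟨this.1, hn.2.le, by linarith⟩
    have b3 := hmid ν
    have b4 := norm_add_le (∑ n ∈ (G.filter (fun n => ¬ d n < ν + √l)).filter
      (fun n => ν + 1 - √l < d n), e (x n)) (∑ n ∈ (range K).filter
      (fun n => (ν : ℝ) + √l ≤ d n ∧ d n ≤ ν + 1 - √l), e (x n))
    have b5 : 4 / √l = 1 / √l + 1 / √l + 1 / √l + 1 / √l := by ring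
    have b6 : 1 ≤ 1 / √l := by rw [le_div_iff₀ hsl]; linarith
    linarith
  have hfl : ∀ n ∈ range K, ⌊d n⌋ ∈ Icc ⌊d 0⌋ ⌊d (K - 1)⌋ := by
    intro n hn
    rw [mem_range] at hn
    exact mem_Icc.2 ⟨Int.floor_mono (hmono 0 n (by omega) hn),
      Int.floor_mono (hmono n _ (by omega) (by omega))⟩
  rw [← sum_fiberwise_of_maps_to hfl]
  refine (norm_sum_le _ _).trans ?_
  refine (sum_le_sum fun ν _ => hfib ν).trans ?_
  rw [sum_const, nsmul_eq_mul]
  have hT : (#(Icc ⌊d 0⌋ ⌊d (K - 1)⌋) : ℝ) ≤ A * l * K + 2 := by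
    rw [Int.card_Icc]
    have h6 : (0 : ℤ) ≤ ⌊d (K - 1)⌋ + 1 - ⌊d 0⌋ := by
      have := Int.floor_mono (hmono 0 (K - 1) (by omega) (by omega)); omega
    have h7 : (((⌊d (K - 1)⌋ + 1 - ⌊d 0⌋).toNat : ℕ) : ℝ) = (⌊d (K - 1)⌋ : ℝ) + 1 - ⌊d 0⌋ := by
      have : (((⌊d (K - 1)⌋ + 1 - ⌊d 0⌋).toNat : ℕ) : ℤ) = ⌊d (K - 1)⌋ + 1 - ⌊d 0⌋ :=
        Int.toNat_of_nonneg h6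
      exact_mod_cast congrArg (fun z : ℤ => (z : ℝ)) this
    rw [h7]
    have h8 := (hsp 0 (K - 1) (by omega) (by omega)).2
    have h9 := Int.floor_le (d (K - 1))
    have h10 := Int.lt_floor_add_one (d 0)
    rw [Nat.cast_sub (by omega)] at h8
    push_cast at h8
    have : 0 ≤ A * l := by positivity
    nlinarith
  have h6 : 4 / √l + 1 ≤ 4 / √l + 1 / √l := by
    have b6 : 1 ≤ 1 / √l := by rw [le_div_iff₀ hsl]; linarith
    linarith
  have h7 : 4 / √l + 1 / √l = 5 / √l := by ring
  calc _ ≤ (A * l * K + 2) * (5 / √l) := by gcongr; linarith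
    _ = 5 * A * (l / √l) * K + 10 / √l := by ring
    _ = _ := by rw [Real.div_sqrt]

theorem second_difference_rpow {γ u : ℝ} (hγ0 : 0 < γ) (hγ1 : γ < 1) (hu : 0 < u) :
    γ * (1 - γ) * (u + 2) ^ (γ - 2) ≤ ((u + 1) ^ γ - u ^ γ) - ((u + 2) ^ γ - (u + 1) ^ γ) ∧
    ((u + 1) ^ γ - u ^ γ) - ((u + 2) ^ γ - (u + 1) ^ γ) ≤ γ * (1 - γ) * u ^ (γ - 2) := by
  have hd : ∀ (s y : ℝ), 0 < y → HasDerivAt (fun y : ℝ => y ^ s) (s * y ^ (s - 1)) y :=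
    fun s y hy => Real.hasDerivAt_rpow_const (Or.inl hy.ne')
  have hG : ∀ y, 0 < y → HasDerivAt (fun y : ℝ => (y + 1) ^ γ - y ^ γ)
      (γ * (y + 1) ^ (γ - 1) - γ * y ^ (γ - 1)) y := fun y hy =>
    ((hd γ (y + 1) (by linarith)).comp_add_const y 1).sub (hd γ y hy)
  obtain ⟨ξ, ⟨hξ1, hξ2⟩, hξ⟩ := exists_hasDerivAt_eq_slope (fun y : ℝ => (y + 1) ^ γ - y ^ γ)
    (fun y => γ * (y + 1) ^ (γ - 1) - γ * y ^ (γ - 1)) (show u < u + 1 by linarith)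
    (fun y hy => (hG y (by linarith [hy.1])).continuousAt.continuousWithinAt)
    (fun y hy => hG y (by linarith [hy.1]))
  obtain ⟨η, ⟨hη1, hη2⟩, hη⟩ := exists_hasDerivAt_eq_slope (fun y : ℝ => y ^ (γ - 1))
    (fun y => (γ - 1) * y ^ (γ - 1 - 1)) (show ξ < ξ + 1 by linarith)
    (fun y hy => (hd _ y (by linarith [hy.1])).continuousAt.continuousWithinAt)
    (fun y hy => hd _ y (by linarith [hy.1]))
  simp only [add_sub_cancel_left, div_one] at hξ hη
  have key : ((u + 1) ^ γ - u ^ γ) - ((u + 2) ^ γ - (u + 1) ^ γ) =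
      γ * (1 - γ) * η ^ (γ - 2) := by
    have e1 : γ - 1 - 1 = γ - 2 := by ring
    have e2 : u + 1 + 1 = u + 2 := by ring
    rw [e1] at hη
    rw [e2] at hξ
    linear_combination hξ + γ * hη
  rw [key]
  have hc : 0 ≤ γ * (1 - γ) := mul_nonneg hγ0.le (by linarith)
  constructor
  · exact mul_le_mul_of_nonneg_left
      (Real.rpow_le_rpow_of_nonpos (by linarith) (by linarith) (by linarith)) hc
  · exact mul_le_mul_of_nonneg_left
      (Real.rpow_le_rpow_of_nonpos (by linarith) (by linarith) (by linarith)) hc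

theorem norm_sum_e_sub_rpow_le {γ R : ℝ} (hγ0 : 0 < γ) (hγ1 : γ < 1) (hR : 1 ≤ R)
    (τ κ M : ℝ) (hκ : 0 < κ) (hM : 0 < M) (a b : ℕ)
    (hab : ∀ m ∈ Ioc a b, M ≤ m ∧ (m : ℝ) ≤ R * M) :
    ‖∑ m ∈ Ioc a b, e (τ * m - κ * (m : ℝ) ^ γ)‖ ≤
      (5 * (2 * R) ^ (2 - γ) * √(γ * (1 - γ) * (2 * R) ^ (γ - 2)) * R +
        10 / √(γ * (1 - γ) * (2 * R) ^ (γ - 2))) *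
        (√(κ * M ^ γ) + M / √(κ * M ^ γ)) := by
  set c := γ * (1 - γ) * (2 * R) ^ (γ - 2) with hc
  have hc0 : 0 < c := by
    have : 0 < 1 - γ := by linarith
    positivity
  set P := κ * M ^ γ with hP
  have hP0 : 0 < P := by positivity
  have hscP : 0 < √c := Real.sqrt_pos.2 hc0
  have hsP : 0 < √P := Real.sqrt_pos.2 hP0
  rcases Nat.lt_or_ge a b with hlt | hge
  swap
  · rw [Ioc_eq_empty_of_le hge]; simp; positivity
  have hbm := hab b (by simp; omega)
  have hRM : 1 ≤ R * M := by
    have : (1 : ℝ) ≤ b := by exact_mod_cast (show 1 ≤ b by omega)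
    linarith
  set l := κ * (γ * (1 - γ)) * (2 * R * M) ^ (γ - 2) with hl
  have hl0 : 0 < l := by
    have : 0 < 1 - γ := by linarith
    positivity
  have hlc : l = c * P / M ^ 2 := by
    rw [hl, hc, hP, Real.mul_rpow (by positivity) hM.le, Real.rpow_sub hM γ 2]
    norm_num; ring
  have hAl : (2 * R) ^ (2 - γ) * l = κ * (γ * (1 - γ)) * M ^ (γ - 2) := by
    rw [hl, Real.mul_rpow (by positivity) hM.le]
    have : (2 * R) ^ (2 - γ) * (2 * R) ^ (γ - 2) = 1 := by
      rw [← Real.rpow_add (by positivity)]; simp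
    linear_combination κ * (γ * (1 - γ)) * M ^ (γ - 2) * this
  have hsum : ∑ m ∈ Ioc a b, e (τ * m - κ * (m : ℝ) ^ γ) =
      ∑ n ∈ range (b - a), e (τ * ((a + 1 + n : ℕ) : ℝ) - κ * ((a + 1 + n : ℕ) : ℝ) ^ γ) := by
    rw [show Ioc a b = Ico (a + 1) (b + 1) by ext; simp only [mem_Ioc, mem_Ico]; omega,
      sum_Ico_eq_sum_range]
    rw [show b + 1 - (a + 1) = b - a by omega]
  have hdiff : ∀ n, n + 1 < b - a →
      l ≤ κ * (((((a + 1 + n : ℕ) : ℝ) + 1) ^ γ - ((a + 1 + n : ℕ) : ℝ) ^ γ) -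
        ((((a + 1 + n : ℕ) : ℝ) + 2) ^ γ - (((a + 1 + n : ℕ) : ℝ) + 1) ^ γ)) ∧
      κ * (((((a + 1 + n : ℕ) : ℝ) + 1) ^ γ - ((a + 1 + n : ℕ) : ℝ) ^ γ) -
        ((((a + 1 + n : ℕ) : ℝ) + 2) ^ γ - (((a + 1 + n : ℕ) : ℝ) + 1) ^ γ)) ≤
        (2 * R) ^ (2 - γ) * l := by
    intro n hn
    have h1 := hab (a + 1 + n) (by simp; omega)
    have h2 := (hab (a + 1 + n + 1) (by simp; omega)).2
    have h3 := second_difference_rpow hγ0 hγ1 (u := ((a + 1 + n : ℕ) : ℝ)) (by linarith)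
    rw [Nat.cast_succ] at h2
    have h5 : 0 ≤ γ * (1 - γ) := mul_nonneg hγ0.le (by linarith)
    constructor
    · rw [hl, mul_assoc]
      refine mul_le_mul_of_nonneg_left (le_trans ?_ h3.1) hκ.le
      refine mul_le_mul_of_nonneg_left ?_ h5
      exact Real.rpow_le_rpow_of_nonpos (by linarith) (by linarith) (by linarith)
    · rw [hAl, mul_assoc]
      refine mul_le_mul_of_nonneg_left (h3.2.trans ?_) hκ.le
      refine mul_le_mul_of_nonneg_left ?_ h5
      exact Real.rpow_le_rpow_of_nonpos (by linarith) (by linarith) (by linarith)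
  have hmain := norm_sum_range_e_le
    (fun n => τ * ((a + 1 + n : ℕ) : ℝ) - κ * ((a + 1 + n : ℕ) : ℝ) ^ γ) (b - a) hl0
    (A := (2 * R) ^ (2 - γ)) (Real.one_le_rpow (by linarith) (by linarith))
    (fun n hn => by
      have := (hdiff n hn).1
      push_cast at this ⊢
      rw [← add_assoc ((a : ℝ) + 1) n 1, ← add_assoc ((a : ℝ) + 1) n 2]
      linarith)
    (fun n hn => by
      have := (hdiff n hn).2
      push_cast at this ⊢
      rw [← add_assoc ((a : ℝ) + 1) n 1, ← add_assoc ((a : ℝ) + 1) n 2]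
      linarith)
  rw [hsum]
  refine hmain.trans ?_
  have hsl : √l = √c * √P / M := by
    rw [hlc, Real.sqrt_div (by positivity), Real.sqrt_mul hc0.le, Real.sqrt_sq hM.le]
  rw [hsl]
  have hK : ((b - a : ℕ) : ℝ) ≤ R * M := by
    refine le_trans ?_ hbm.2
    exact_mod_cast Nat.sub_le b a
  calc _ ≤ 5 * (2 * R) ^ (2 - γ) * (√c * √P / M) * (R * M) + 10 / (√c * √P / M) := by gcongr
    _ = 5 * (2 * R) ^ (2 - γ) * √c * R * √P + 10 / √c * (M / √P) := by field_simp
    _ ≤ (5 * (2 * R) ^ (2 - γ) * √c * R + 10 / √c) * √P +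
        (5 * (2 * R) ^ (2 - γ) * √c * R + 10 / √c) * (M / √P) := by
      gcongr
      · exact le_add_of_nonneg_right (by positivity)
      · exact le_add_of_nonneg_left (by positivity)
    _ = _ := by ring

theorem exists_norm_sum_e_add_rpow_le {γ R : ℝ} (hγ0 : 0 < γ) (hγ1 : γ < 1) (hR : 1 ≤ R) :
    ∃ C : ℝ, 0 < C ∧ ∀ (τ κ M : ℝ), κ ≠ 0 → 0 < M → ∀ a b : ℕ,
      (∀ m ∈ Ioc a b, M ≤ m ∧ (m : ℝ) ≤ R * M) →
      ‖∑ m ∈ Ioc a b, e (τ * m + κ * (m : ℝ) ^ γ)‖ ≤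
        C * (√(|κ| * M ^ γ) + M / √(|κ| * M ^ γ)) := by
  refine ⟨5 * (2 * R) ^ (2 - γ) * √(γ * (1 - γ) * (2 * R) ^ (γ - 2)) * R +
        10 / √(γ * (1 - γ) * (2 * R) ^ (γ - 2)), ?_, fun τ κ M hκ hM a b hab => ?_⟩
  · have : 0 < 1 - γ := by linarith
    positivity
  rcases lt_or_gt_of_ne hκ with h | h
  · have := norm_sum_e_sub_rpow_le hγ0 hγ1 hR τ (-κ) M (by linarith) hM a b hab
    simp only [neg_mul, sub_neg_eq_add] at this
    rw [abs_of_neg h, neg_mul]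
    exact this
  · have := norm_sum_e_sub_rpow_le hγ0 hγ1 hR (-τ) κ M h hM a b hab
    rw [abs_of_pos h, ← norm_sum_e_neg]
    refine le_trans (le_of_eq ?_) this
    congr 2
    ext m
    congr 1; ring

theorem succ_le_mul_rpow {ε : ℝ} (hε : 0 < ε) {p : ℕ} (hp : 2 ≤ p) (v : ℕ) :
    ((v : ℝ) + 1) ≤ (1 + 1 / (ε * Real.log 2)) * ((p : ℝ) ^ v) ^ ε := by
  have hlog : 0 < Real.log 2 := Real.log_pos (by norm_num)
  have h1 : (1 : ℝ) + v * (ε * Real.log 2) ≤ ((p : ℝ) ^ v) ^ ε := by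
    calc (1 : ℝ) + v * (ε * Real.log 2) ≤ Real.exp (v * (ε * Real.log 2)) := by
          linarith [Real.add_one_le_exp (v * (ε * Real.log 2))]
      _ = ((2 : ℝ) ^ v) ^ ε := by
          rw [Real.rpow_def_of_pos (by positivity), Real.log_pow]; ring_nf
      _ ≤ _ := by gcongr; exact_mod_cast hp
  calc ((v : ℝ) + 1) ≤ (1 + 1 / (ε * Real.log 2)) * (1 + v * (ε * Real.log 2)) := by
        have h2 : (1 + 1 / (ε * Real.log 2)) * (1 + v * (ε * Real.log 2)) =
          1 + v * (ε * Real.log 2) + 1 / (ε * Real.log 2) + v := by field_simp; ring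
        rw [h2]
        have : 0 ≤ v * (ε * Real.log 2) := by positivity
        have : 0 ≤ 1 / (ε * Real.log 2) := by positivity
        linarith
    _ ≤ _ := by gcongr

theorem succ_le_rpow_of_two_le {ε : ℝ} {p : ℕ} (hp : 2 ≤ (p : ℝ) ^ ε) (v : ℕ) :
    ((v : ℝ) + 1) ≤ ((p : ℝ) ^ v) ^ ε := by
  have h1 : ((p : ℝ) ^ v) ^ ε = ((p : ℝ) ^ ε) ^ v := by
    rw [← Real.rpow_natCast, ← Real.rpow_mul (by positivity), mul_comm,
      Real.rpow_mul (by positivity),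
      Real.rpow_natCast]
  rw [h1]
  calc ((v : ℝ) + 1) ≤ 2 ^ v := by
        exact_mod_cast Nat.lt_two_pow_self
    _ ≤ _ := by gcongr

theorem exists_card_divisors_le_rpow {ε : ℝ} (hε : 0 < ε) :
    ∃ C : ℝ, 1 ≤ C ∧ ∀ n : ℕ, n ≠ 0 → (#n.divisors : ℝ) ≤ C * (n : ℝ) ^ ε := by
  set c := 1 + 1 / (ε * Real.log 2) with hc
  have hlog : 0 < Real.log 2 := Real.log_pos (by norm_num)
  have hc1 : 1 ≤ c := by
    have : 0 ≤ 1 / (ε * Real.log 2) := by positivity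
    linarith
  set B := ⌈(2 : ℝ) ^ (1 / ε)⌉₊ with hB
  refine ⟨c ^ B, one_le_pow₀ hc1, fun n hn => ?_⟩
  rw [Nat.card_divisors hn]
  have hn' : (n : ℝ) ^ ε = ∏ p ∈ n.primeFactors, ((p : ℝ) ^ (n.factorization p)) ^ ε := by
    conv_lhs => rw [← Nat.prod_factorization_pow_eq_self hn]
    rw [Finsupp.prod, Nat.support_factorization]
    push_cast
    rw [Real.finsetProd_rpow _ _ (fun i _ => by positivity)]
  rw [hn']
  push_cast
  have h1 : ∀ p ∈ n.primeFactors, ((n.factorization p : ℝ) + 1) ≤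
      (if p < B then c else 1) * ((p : ℝ) ^ (n.factorization p)) ^ ε := by
    intro p hp
    have hp2 := (Nat.prime_of_mem_primeFactors hp).two_le
    split_ifs with h
    · exact succ_le_mul_rpow hε hp2 _
    · rw [one_mul]
      apply succ_le_rpow_of_two_le
      have : (2 : ℝ) ^ (1 / ε) ≤ p := (Nat.le_ceil _).trans (by exact_mod_cast not_lt.1 h)
      calc (2 : ℝ) = ((2 : ℝ) ^ (1 / ε)) ^ ε := by
            rw [← Real.rpow_mul (by norm_num)]; field_simp; simp
        _ ≤ _ := by gcongr
  refine (prod_le_prod (fun p _ => by positivity) h1).trans ?_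
  rw [prod_mul_distrib]
  gcongr
  rw [prod_ite, prod_const, prod_const_one, mul_one]
  refine pow_le_pow_right₀ hc1 ?_
  calc _ ≤ #(range B) := card_le_card fun p hp => by simp at hp ⊢; exact hp.2
    _ = B := card_range _

/-- The restriction of `g` to the window `X / R < n ≤ X`. -/
noncomputable def window (X R : ℕ) (g : ℕ → ℂ) (n : ℕ) : ℂ :=
  if X < R * n ∧ n ≤ X then g n else 0

theorem window_eq_zero {X R n : ℕ} {g : ℕ → ℂ} (h : X < n) : window X R g n = 0 :=
  if_neg fun h' => by omega

theorem norm_window_le {X R : ℕ} {g : ℕ → ℂ} (hg : ∀ n, ‖g n‖ ≤ 1) (n : ℕ) :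
    ‖window X R g n‖ ≤ 1 := by
  unfold window
  split_ifs
  · exact hg n
  · simp

theorem filter_window_eq_Ioc {X R d i J : ℕ} (hR : 0 < R) (hd : 0 < d) :
    (Ioc i J).filter (fun m => X < R * (d * m) ∧ d * m ≤ X) =
      Ioc (max i (X / (R * d))) (min J (X / d)) := by
  ext m
  simp only [mem_filter, mem_Ioc, max_lt_iff, le_min_iff, ← mul_assoc]
  rw [Nat.div_lt_iff_lt_mul (by positivity), Nat.le_div_iff_mul_le hd, mul_comm m (R * d),
    mul_comm m d]
  tauto

theorem norm_sum_window_mul_le {X R d i J : ℕ} {g : ℕ → ℂ} {T : ℝ} (hR : 0 < R) (hd : 0 < d)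
    (h : ∀ a b, (∀ m ∈ Ioc a b, X < R * (d * m) ∧ d * m ≤ X) → ‖∑ m ∈ Ioc a b, g (d * m)‖ ≤ T) :
    ‖∑ m ∈ Ioc i J, window X R g (d * m)‖ ≤ T := by
  unfold window
  rw [← sum_filter, filter_window_eq_Ioc hR hd]
  refine h _ _ fun m hm => ?_
  rw [← filter_window_eq_Ioc hR hd, mem_filter] at hm
  exact hm.2

theorem norm_sum_window_mul_conj_le {X R d d' i J : ℕ} {g : ℕ → ℂ} {T : ℝ} (hR : 0 < R)
    (hd : 0 < d) (hd' : 0 < d')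
    (h : ∀ a b, (∀ m ∈ Ioc a b, (X < R * (d * m) ∧ d * m ≤ X) ∧ (X < R * (d' * m) ∧ d' * m ≤ X)) →
      ‖∑ m ∈ Ioc a b, g (d * m) * (starRingEnd ℂ) (g (d' * m))‖ ≤ T) :
    ‖∑ m ∈ Ioc i J, window X R g (d * m) * (starRingEnd ℂ) (window X R g (d' * m))‖ ≤ T := by
  have h1 : ∀ m, window X R g (d * m) * (starRingEnd ℂ) (window X R g (d' * m)) =
      if X < R * (d * m) ∧ d * m ≤ X then (if X < R * (d' * m) ∧ d' * m ≤ X then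
        g (d * m) * (starRingEnd ℂ) (g (d' * m)) else 0) else 0 := by
    intro m
    unfold window
    split_ifs <;> simp
  simp_rw [h1]
  rw [← sum_filter, filter_window_eq_Ioc hR hd, ← sum_filter, filter_window_eq_Ioc hR hd']
  refine h _ _ fun m hm => ?_
  rw [← filter_window_eq_Ioc hR hd', mem_filter, ← filter_window_eq_Ioc hR hd, mem_filter] at hm
  exact ⟨hm.1.2, hm.2⟩

theorem log_eq_sum_Ioc (m : ℕ) :
    Real.log m = ∑ i ∈ Ioc 0 m, (Real.log i - Real.log ((i - 1 : ℕ) : ℝ)) := by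
  induction m with
  | zero => simp
  | succ m ih => rw [sum_Ioc_succ_top (by omega), ← ih]; simp

theorem log_sub_log_pred_nonneg (i : ℕ) : 0 ≤ Real.log i - Real.log ((i - 1 : ℕ) : ℝ) := by
  rcases Nat.lt_or_ge i 2 with h | h
  · interval_cases i <;> simp
  · rw [sub_nonneg]
    apply Real.log_le_log
    · exact_mod_cast (by omega : 0 < i - 1)
    · exact_mod_cast Nat.sub_le _ _

theorem norm_sum_log_mul_le {X : ℕ} {F : ℕ → ℂ} {T : ℝ}
    (h : ∀ i, ‖∑ m ∈ Ioc i X, F m‖ ≤ T) :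
    ‖∑ m ∈ Ioc 0 X, (Real.log m : ℂ) * F m‖ ≤ Real.log X * T := by
  set w : ℕ → ℝ := fun i => Real.log i - Real.log ((i - 1 : ℕ) : ℝ) with hw
  have h1 : ∑ m ∈ Ioc 0 X, (Real.log m : ℂ) * F m =
      ∑ i ∈ Ioc 0 X, (w i : ℂ) * ∑ m ∈ Ioc (i - 1) X, F m := by
    have h2 : ∀ m ∈ Ioc 0 X, (Real.log m : ℂ) * F m =
        ∑ i ∈ Ioc 0 X, if i ≤ m then (w i : ℂ) * F m else 0 := by
      intro m hm
      rw [mem_Ioc] at hm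
      rw [log_eq_sum_Ioc, ← sum_filter]
      push_cast
      rw [sum_mul]
      refine sum_congr ?_ fun i _ => by simp [hw]
      ext i; simp only [mem_Ioc, mem_filter]; omega
    rw [sum_congr rfl h2, sum_comm]
    refine sum_congr rfl fun i hi => ?_
    rw [mem_Ioc] at hi
    rw [← sum_filter, mul_sum]
    refine sum_congr ?_ fun i _ => rfl
    ext m; simp only [mem_Ioc, mem_filter]; omega
  rw [h1, log_eq_sum_Ioc X, sum_mul]
  refine (norm_sum_le _ _).trans (sum_le_sum fun i _ => ?_)
  rw [norm_mul, Complex.norm_real, Real.norm_of_nonneg (log_sub_log_pred_nonneg i)]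
  exact mul_le_mul_of_nonneg_left (h _) (log_sub_log_pred_nonneg i)

theorem sum_Ioc_conv_mul (f h : ArithmeticFunction ℝ) {X : ℕ} {F : ℕ → ℂ}
    (hF : ∀ n, X < n → F n = 0) :
    ∑ n ∈ Ioc 0 X, (((f * h) n : ℝ) : ℂ) * F n =
      ∑ k ∈ Ioc 0 X, ∑ l ∈ Ioc 0 X, (f k : ℂ) * (h l : ℂ) * F (k * l) := by
  rw [← sum_product']
  have h1 : ∀ n ∈ Ioc 0 X, (((f * h) n : ℝ) : ℂ) * F n =
      ∑ x ∈ Ioc 0 X ×ˢ Ioc 0 X with x.1 * x.2 = n, (f x.1 : ℂ) * (h x.2 : ℂ) * F (x.1 * x.2) := by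
    intro n hn
    rw [mem_Ioc] at hn
    rw [ArithmeticFunction.mul_apply,
      Nat.divisorsAntidiagonal_eq_prod_filter_of_le hn.1.ne' hn.2]
    push_cast
    rw [sum_mul]
    refine sum_congr rfl fun x hx => ?_
    rw [(mem_filter.1 hx).2]
  rw [sum_congr rfl h1]
  simp_rw [sum_filter]
  rw [sum_comm]
  refine sum_congr rfl fun x hx => ?_
  rw [mem_product, mem_Ioc, mem_Ioc] at hx
  rw [sum_ite_eq]
  split_ifs with h2
  · rfl
  · rw [hF, mul_zero]
    rw [mem_Ioc] at h2
    have := Nat.mul_pos hx.1.1 hx.2.1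
    omega

theorem norm_sq_sum_mul_sum_le {ι : Type*} [DecidableEq ι] (s : Finset ι) (t : Finset ℕ)
    (a : ι → ℂ) (b : ℕ → ℂ) (G : ι → ℕ → ℂ) {A B U V : ℝ} (hA : 0 ≤ A) (hV : 0 ≤ V)
    (ha : ∀ n ∈ s, ‖a n‖ ≤ A) (hb : ∀ m ∈ t, ‖b m‖ ≤ B)
    (hU' : ∀ n ∈ s, ‖∑ m ∈ t, G n m * (starRingEnd ℂ) (G n m)‖ ≤ U)
    (hV' : ∀ n ∈ s, ∀ n' ∈ s, n ≠ n' → ‖∑ m ∈ t, G n m * (starRingEnd ℂ) (G n' m)‖ ≤ V) :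
    ‖∑ m ∈ t, b m * ∑ n ∈ s, a n * G n m‖ ^ 2 ≤
      (#t * B ^ 2) * (A ^ 2 * (#s * U + #s ^ 2 * V)) := by
  have h1 : ‖∑ m ∈ t, b m * ∑ n ∈ s, a n * G n m‖ ≤
      ∑ m ∈ t, ‖b m‖ * ‖∑ n ∈ s, a n * G n m‖ := by
    refine (norm_sum_le _ _).trans (le_of_eq ?_)
    simp_rw [norm_mul]
  have h2 : ‖∑ m ∈ t, b m * ∑ n ∈ s, a n * G n m‖ ^ 2 ≤
      (∑ m ∈ t, ‖b m‖ ^ 2) * ∑ m ∈ t, ‖∑ n ∈ s, a n * G n m‖ ^ 2 :=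
    (pow_le_pow_left₀ (norm_nonneg _) h1 2).trans (sum_mul_sq_le_sq_mul_sq _ _ _)
  refine h2.trans ?_
  have h3 : ∑ m ∈ t, ‖b m‖ ^ 2 ≤ #t * B ^ 2 := by
    rw [← nsmul_eq_mul]
    exact sum_le_card_nsmul _ _ _ fun m hm => pow_le_pow_left₀ (norm_nonneg _) (hb m hm) 2
  have h4 : ∑ m ∈ t, ‖∑ n ∈ s, a n * G n m‖ ^ 2 ≤ A ^ 2 * (#s * U + #s ^ 2 * V) := by
    have h5 : ((∑ m ∈ t, ‖∑ n ∈ s, a n * G n m‖ ^ 2 : ℝ) : ℂ) =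
        ∑ n ∈ s, ∑ n' ∈ s, a n * (starRingEnd ℂ) (a n') *
          ∑ m ∈ t, G n m * (starRingEnd ℂ) (G n' m) := by
      push_cast
      simp_rw [← Complex.mul_conj', map_sum, sum_mul_sum, mul_sum]
      rw [sum_comm]
      refine sum_congr rfl fun n _ => ?_
      rw [sum_comm]
      refine sum_congr rfl fun n' _ => sum_congr rfl fun m _ => ?_
      rw [map_mul]; ring
    have h6 : ∑ m ∈ t, ‖∑ n ∈ s, a n * G n m‖ ^ 2 =
        ‖((∑ m ∈ t, ‖∑ n ∈ s, a n * G n m‖ ^ 2 : ℝ) : ℂ)‖ := by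
      rw [Complex.norm_real, Real.norm_of_nonneg (sum_nonneg fun _ _ => by positivity)]
    rw [h6, h5]
    refine (norm_sum_le _ _).trans ?_
    have h7 : ∀ n ∈ s, ‖∑ n' ∈ s, a n * (starRingEnd ℂ) (a n') *
          ∑ m ∈ t, G n m * (starRingEnd ℂ) (G n' m)‖ ≤ A ^ 2 * (U + #s * V) := by
      intro n hn
      refine (norm_sum_le _ _).trans ?_
      have h8 : ∀ n' ∈ s, ‖a n * (starRingEnd ℂ) (a n') *
          ∑ m ∈ t, G n m * (starRingEnd ℂ) (G n' m)‖ ≤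
          (if n = n' then A ^ 2 * U else 0) + A ^ 2 * V := by
        intro n' hn'
        rw [norm_mul, norm_mul, Complex.norm_conj]
        have h9 : ‖a n‖ * ‖a n'‖ ≤ A ^ 2 := by
          rw [sq]; exact mul_le_mul (ha n hn) (ha n' hn') (norm_nonneg _) hA
        split_ifs with h
        · subst h
          have := mul_le_mul h9 (hU' n hn) (norm_nonneg _) (by positivity)
          have : 0 ≤ A ^ 2 * V := by positivity
          linarith
        · have := mul_le_mul h9 (hV' n hn n' hn' h) (norm_nonneg _) (by positivity)
          linarith
      refine (sum_le_sum h8).trans ?_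
      rw [sum_add_distrib, sum_ite_eq, if_pos hn, sum_const, nsmul_eq_mul]
      linarith
    refine (sum_le_sum h7).trans ?_
    rw [sum_const, nsmul_eq_mul]
    apply le_of_eq; ring
  exact mul_le_mul h3 h4 (sum_nonneg fun _ _ => by positivity) (by positivity)

theorem card_filter_div_eq_le {X Q j : ℕ} (hQ : 0 < Q) :
    #((Ioc 0 X).filter (fun n => n / Q = j)) ≤ Q := by
  calc _ ≤ #(Ico (j * Q) (j * Q + Q)) := card_le_card fun n hn => by
        rw [mem_filter] at hn
        rw [mem_Ico]
        have := (Nat.div_eq_iff hQ).1 hn.2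
        omega
    _ = Q := by simp

theorem norm_sum_block_le {X R Q N j : ℕ} {g a b : ℕ → ℂ} {A B T W : ℝ} (hR : 0 < R) (hQ : 0 < Q)
    (hj : 0 < j) (hg : ∀ n, ‖g n‖ ≤ 1) (hA : 0 ≤ A) (hB : 0 ≤ B) (hT : 0 ≤ T) (hW : 0 ≤ W)
    (hTW : (X : ℝ) ^ 2 / Q + X * Q * T ≤ W ^ 2)
    (hII : ∀ n n', n ≠ n' → n / Q = j → n' / Q = j → n ≤ N → n' ≤ N → ∀ a b,
      (∀ m ∈ Ioc a b, (X < R * (n * m) ∧ n * m ≤ X) ∧ (X < R * (n' * m) ∧ n' * m ≤ X)) →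
      ‖∑ m ∈ Ioc a b, g (n * m) * (starRingEnd ℂ) (g (n' * m))‖ ≤ T / j)
    (ha : ∀ n ∈ Ioc 0 X, ‖a n‖ ≤ A) (hb : ∀ m ∈ Ioc 0 X, ‖b m‖ ≤ B)
    (haN : ∀ n, N < n → a n = 0) :
    ‖∑ n ∈ (Ioc 0 X).filter (fun n => n / Q = j), ∑ m ∈ Ioc 0 X,
      a n * b m * window X R g (n * m)‖ ≤ A * B * W / j := by
  set s := ((Ioc 0 X).filter (fun n => n / Q = j)).filter (fun n => n ≤ N) with hs
  set t := Ioc 0 (X / (j * Q)) with ht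
  have hjQ : 0 < j * Q := Nat.mul_pos hj hQ
  have hsm : ∀ n ∈ s, n ∈ Ioc 0 X ∧ n / Q = j ∧ n ≤ N := by
    intro n hn
    rw [hs, mem_filter, mem_filter] at hn
    exact ⟨hn.1.1, hn.1.2, hn.2⟩
  have hrew : ∑ n ∈ (Ioc 0 X).filter (fun n => n / Q = j), ∑ m ∈ Ioc 0 X,
      a n * b m * window X R g (n * m) =
      ∑ m ∈ t, b m * ∑ n ∈ s, a n * window X R g (n * m) := by
    rw [← sum_filter_add_sum_filter_not _ (fun n => n ≤ N)]
    rw [sum_eq_zero (s := filter (fun n => ¬ n ≤ N) _), add_zero]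
    swap
    · intro n hn
      rw [mem_filter, not_le] at hn
      simp [haN n hn.2]
    rw [sum_comm]
    have : t ⊆ Ioc 0 X := Ioc_subset_Ioc_right (Nat.div_le_self _ _)
    rw [← sum_subset this]
    · refine sum_congr rfl fun m _ => ?_
      rw [mul_sum]
      exact sum_congr rfl fun n _ => by ring
    · intro m hm hmt
      refine sum_eq_zero fun n hn => ?_
      have h1 := (hsm n hn).2.1
      rw [window_eq_zero, mul_zero]
      rw [ht, mem_Ioc, not_and, not_le] at hmt
      have h2 := hmt (mem_Ioc.1 hm).1
      rw [Nat.div_lt_iff_lt_mul hjQ] at h2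
      have h3 : j * Q ≤ n := by rw [← h1]; exact Nat.div_mul_le_self n Q
      calc X < m * (j * Q) := h2
        _ ≤ m * n := Nat.mul_le_mul_left _ h3
        _ = n * m := mul_comm _ _
  rw [hrew]
  have hcs : (#s : ℝ) ≤ Q := by
    exact_mod_cast (card_filter_le _ _).trans (card_filter_div_eq_le (X := X) hQ)
  have hct : (#t : ℝ) ≤ X / (j * Q) := by
    rw [ht, Nat.card_Ioc, Nat.sub_zero]
    exact_mod_cast (Nat.cast_div_le (α := ℝ) (m := X) (n := j * Q))
  have hj' : (0 : ℝ) < j := by exact_mod_cast hj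
  have hQ' : (0 : ℝ) < Q := by exact_mod_cast hQ
  have hmain := norm_sq_sum_mul_sum_le s t a b (fun n m => window X R g (n * m)) (A := A) (B := B)
    (U := X / (j * Q)) (V := T / j) hA (by positivity)
    (fun n hn => ha n (hsm n hn).1)
    (fun m hm => hb m (Ioc_subset_Ioc_right (Nat.div_le_self _ _) hm))
    (fun n hn => by
      refine ((norm_sum_le _ _).trans (sum_le_card_nsmul _ _ 1 fun m _ => ?_)).trans ?_
      · rw [norm_mul, Complex.norm_conj]
        exact mul_le_one₀ (norm_window_le hg _) (norm_nonneg _) (norm_window_le hg _)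
      · rw [nsmul_eq_mul, mul_one]; exact hct)
    (fun n hn n' hn' hne => by
      have h1 := hsm n hn
      have h2 := hsm n' hn'
      exact norm_sum_window_mul_conj_le hR (mem_Ioc.1 h1.1).1 (mem_Ioc.1 h2.1).1
        (hII n n' hne h1.2.1 h2.2.1 h1.2.2 h2.2.2))
  refine abs_le_of_sq_le_sq' (hmain.trans ?_) (by positivity) |>.2
  calc _ ≤ (X / (j * Q) * B ^ 2) * (A ^ 2 * (Q * (X / (j * Q)) + Q ^ 2 * (T / j))) := by gcongr
    _ = (A * B / j) ^ 2 * ((X : ℝ) ^ 2 / Q + X * Q * T) := by field_simp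
    _ ≤ (A * B / j) ^ 2 * W ^ 2 := by gcongr
    _ = _ := by ring

theorem norm_bilinear_sum_le {X R Q N : ℕ} {g a b : ℕ → ℂ} {A B T W : ℝ} (hR : 0 < R) (hQ : 0 < Q)
    (hg : ∀ n, ‖g n‖ ≤ 1) (hA : 0 ≤ A) (hB : 0 ≤ B) (hT : 0 ≤ T) (hW : 0 ≤ W)
    (hTW : (X : ℝ) ^ 2 / Q + X * Q * T ≤ W ^ 2)
    (hII : ∀ j, 0 < j → ∀ n n', n ≠ n' → n / Q = j → n' / Q = j → n ≤ N → n' ≤ N → ∀ a b,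
      (∀ m ∈ Ioc a b, (X < R * (n * m) ∧ n * m ≤ X) ∧ (X < R * (n' * m) ∧ n' * m ≤ X)) →
      ‖∑ m ∈ Ioc a b, g (n * m) * (starRingEnd ℂ) (g (n' * m))‖ ≤ T / j)
    (ha : ∀ n ∈ Ioc 0 X, ‖a n‖ ≤ A) (hb : ∀ m ∈ Ioc 0 X, ‖b m‖ ≤ B)
    (haN : ∀ n, N < n → a n = 0) (haQ : ∀ n, n < Q → a n = 0) :
    ‖∑ n ∈ Ioc 0 X, ∑ m ∈ Ioc 0 X, a n * b m * window X R g (n * m)‖ ≤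
      A * B * W * (1 + Real.log X) := by
  have hmaps : ∀ n ∈ Ioc 0 X, n / Q ∈ range (X + 1) := by
    intro n hn
    rw [mem_Ioc] at hn
    rw [mem_range]
    have := Nat.div_le_self n Q
    omega
  rw [← sum_fiberwise_of_maps_to hmaps, sum_range_succ']
  have h0 : ∑ n ∈ (Ioc 0 X).filter (fun n => n / Q = 0), ∑ m ∈ Ioc 0 X,
      a n * b m * window X R g (n * m) = 0 := by
    refine sum_eq_zero fun n hn => ?_
    rw [mem_filter, Nat.div_eq_zero_iff] at hn
    rw [haQ n (by omega)]
    simp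
  rw [h0, add_zero]
  refine (norm_sum_le _ _).trans ?_
  have h1 : ∀ j ∈ range X, ‖∑ n ∈ (Ioc 0 X).filter (fun n => n / Q = j + 1), ∑ m ∈ Ioc 0 X,
      a n * b m * window X R g (n * m)‖ ≤ A * B * W * (((j + 1 : ℕ) : ℝ))⁻¹ := by
    intro j _
    have := norm_sum_block_le (j := j + 1) hR hQ (by omega) hg hA hB hT hW hTW
      (hII (j + 1) (by omega)) ha hb haN
    rwa [div_eq_mul_inv] at this
  refine (sum_le_sum h1).trans ?_
  rw [← mul_sum]
  have h2 := harmonic_le_one_add_log X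
  rw [harmonic] at h2
  push_cast at h2 ⊢
  gcongr

open ArithmeticFunction in
/-- The restriction of an arithmetic function to arguments at most `Q`. -/
noncomputable def lowPart (f : ArithmeticFunction ℝ) (Q : ℕ) : ArithmeticFunction ℝ :=
  ⟨fun n => if n ≤ Q then f n else 0, by simp⟩

theorem lowPart_apply (f : ArithmeticFunction ℝ) (Q n : ℕ) :
    lowPart f Q n = if n ≤ Q then f n else 0 := rfl

/-- The restriction of an arithmetic function to arguments exceeding `Q`. -/
noncomputable def highPart (f : ArithmeticFunction ℝ) (Q : ℕ) : ArithmeticFunction ℝ :=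
  ⟨fun n => if n ≤ Q then 0 else f n, by simp⟩

theorem highPart_apply (f : ArithmeticFunction ℝ) (Q n : ℕ) :
    highPart f Q n = if n ≤ Q then 0 else f n := rfl

theorem lowPart_add_highPart (f : ArithmeticFunction ℝ) (Q : ℕ) :
    lowPart f Q + highPart f Q = f := by
  ext n
  rw [ArithmeticFunction.add_apply, lowPart_apply, highPart_apply]
  split_ifs <;> simp

open ArithmeticFunction ArithmeticFunction.zeta ArithmeticFunction.Moebius in
theorem vonMangoldt_eq_vaughan (Q : ℕ) :
    vonMangoldt = lowPart vonMangoldt Q + lowPart (μ : ArithmeticFunction ℝ) Q * log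
      - (lowPart (μ : ArithmeticFunction ℝ) Q * lowPart vonMangoldt Q) * (ζ : ArithmeticFunction ℝ)
      + highPart vonMangoldt Q *
        ((ζ : ArithmeticFunction ℝ) * highPart (μ : ArithmeticFunction ℝ) Q) := by
  have h1 := lowPart_add_highPart vonMangoldt Q
  have h2 := lowPart_add_highPart (μ : ArithmeticFunction ℝ) Q
  have h3 : (μ : ArithmeticFunction ℝ) * (ζ : ArithmeticFunction ℝ) = 1 :=
    coe_moebius_mul_coe_zeta
  have h4 : vonMangoldt * (ζ : ArithmeticFunction ℝ) = log := vonMangoldt_mul_zeta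
  have h5 : highPart (μ : ArithmeticFunction ℝ) Q
    = (μ : ArithmeticFunction ℝ) - lowPart (μ : ArithmeticFunction ℝ) Q := by
    rw [eq_sub_iff_add_eq, add_comm, h2]
  have h6 : highPart vonMangoldt Q = vonMangoldt - lowPart vonMangoldt Q := by
    rw [eq_sub_iff_add_eq, add_comm, h1]
  rw [h5, h6, ← h4]
  linear_combination (-vonMangoldt + lowPart vonMangoldt Q) * h3

open ArithmeticFunction ArithmeticFunction.Moebius in
theorem abs_lowPart_moebius_le (Q n : ℕ) : |lowPart (μ : ArithmeticFunction ℝ) Q n| ≤ 1 := by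
  rw [lowPart_apply]
  split_ifs
  · rw [intCoe_apply]
    exact_mod_cast abs_moebius_le_one
  · simp

open ArithmeticFunction ArithmeticFunction.Moebius in
theorem abs_lowPart_moebius_mul_le (Q n : ℕ) :
    |(lowPart (μ : ArithmeticFunction ℝ) Q * lowPart vonMangoldt Q) n| ≤ Real.log n := by
  rw [mul_apply, ← vonMangoldt_sum, Nat.sum_divisorsAntidiagonal' (f := fun x y =>
    lowPart (μ : ArithmeticFunction ℝ) Q x * lowPart vonMangoldt Q y)]
  refine (abs_sum_le_sum_abs _ _).trans (sum_le_sum fun d _ => ?_)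
  rw [abs_mul]
  refine (mul_le_of_le_one_left (abs_nonneg _) (abs_lowPart_moebius_le _ _)).trans ?_
  rw [lowPart_apply]
  split_ifs
  · rw [abs_of_nonneg vonMangoldt_nonneg]
  · simp

open ArithmeticFunction ArithmeticFunction.Moebius in
theorem lowPart_moebius_mul_eq_zero {Q n : ℕ} (h : Q ^ 2 < n) :
    (lowPart (μ : ArithmeticFunction ℝ) Q * lowPart vonMangoldt Q) n = 0 := by
  rw [mul_apply]
  refine sum_eq_zero fun x hx => ?_
  rw [Nat.mem_divisorsAntidiagonal] at hx
  rw [lowPart_apply, lowPart_apply]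
  split_ifs with h1 h2
  · have := Nat.mul_le_mul h1 h2
    rw [hx.1] at this
    nlinarith
  all_goals simp

open ArithmeticFunction ArithmeticFunction.zeta ArithmeticFunction.Moebius in
theorem abs_zeta_mul_highPart_moebius_le (Q n : ℕ) :
    |((ζ : ArithmeticFunction ℝ) * highPart (μ : ArithmeticFunction ℝ) Q) n| ≤ #n.divisors := by
  rw [coe_zeta_mul_apply]
  refine (abs_sum_le_sum_abs _ _).trans
    ((sum_le_card_nsmul _ _ 1 fun d _ => ?_).trans (by simp))
  rw [highPart_apply]
  split_ifs
  · simp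
  · rw [intCoe_apply]
    exact_mod_cast abs_moebius_le_one

open ArithmeticFunction ArithmeticFunction.zeta ArithmeticFunction.Moebius in
theorem zeta_mul_highPart_moebius_eq_zero {Q n : ℕ} (h : n ≤ Q) :
    ((ζ : ArithmeticFunction ℝ) * highPart (μ : ArithmeticFunction ℝ) Q) n = 0 := by
  rw [coe_zeta_mul_apply]
  refine sum_eq_zero fun d hd => ?_
  rw [highPart_apply, if_pos ((Nat.divisor_le hd).trans h)]

theorem norm_typeI_sum_le {f h : ArithmeticFunction ℝ} {X D : ℕ} {F : ℕ → ℂ} {A T : ℝ}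
    (hA : 0 ≤ A) (hT : 0 ≤ T) (hF : ∀ n, X < n → F n = 0) (hfD : ∀ k, D < k → f k = 0)
    (hf : ∀ k ∈ Ioc 0 X, |f k| ≤ A)
    (hh : ∀ k, 0 < k → k ≤ D → ‖∑ l ∈ Ioc 0 X, (h l : ℂ) * F (k * l)‖ ≤ T) :
    ‖∑ n ∈ Ioc 0 X, (((f * h) n : ℝ) : ℂ) * F n‖ ≤ D * (A * T) := by
  rw [sum_Ioc_conv_mul f h hF]
  have h1 : ∑ k ∈ Ioc 0 X, ∑ l ∈ Ioc 0 X, (f k : ℂ) * (h l : ℂ) * F (k * l) =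
      ∑ k ∈ (Ioc 0 X).filter (fun k => k ≤ D), ∑ l ∈ Ioc 0 X,
        (f k : ℂ) * (h l : ℂ) * F (k * l) := by
    rw [sum_filter]
    refine sum_congr rfl fun k _ => ?_
    split_ifs with hk
    · rfl
    · rw [hfD k (by omega)]; simp
  rw [h1]
  refine (norm_sum_le _ _).trans ((sum_le_card_nsmul _ _ (A * T) fun k hk => ?_).trans ?_)
  · rw [mem_filter] at hk
    simp_rw [mul_assoc]
    rw [← mul_sum, norm_mul, Complex.norm_real, Real.norm_eq_abs]
    exact mul_le_mul (hf k hk.1) (hh k (mem_Ioc.1 hk.1).1 hk.2) (norm_nonneg _) hA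
  · rw [nsmul_eq_mul]
    gcongr
    calc _ ≤ #(Ioc 0 D) := by
          apply card_le_card
          intro k
          simp only [mem_filter, mem_Ioc]
          omega
      _ = D := by simp

open ArithmeticFunction ArithmeticFunction.zeta ArithmeticFunction.Moebius in
theorem norm_sum_highPart_le {X R Q N : ℕ} {g : ℕ → ℂ} {T W D : ℝ} (hR : 0 < R) (hQ : 0 < Q)
    (hN : N * N = X) (hg : ∀ n, ‖g n‖ ≤ 1) (hT : 0 ≤ T) (hW : 0 ≤ W)
    (hD : ∀ n ∈ Ioc 0 X, (#n.divisors : ℝ) ≤ D) (hD0 : 0 ≤ D)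
    (hTW : (X : ℝ) ^ 2 / Q + X * Q * T ≤ W ^ 2)
    (hII : ∀ j, 0 < j → ∀ n n', n ≠ n' → n / Q = j → n' / Q = j → n ≤ N → n' ≤ N → ∀ a b,
      (∀ m ∈ Ioc a b, (X < R * (n * m) ∧ n * m ≤ X) ∧ (X < R * (n' * m) ∧ n' * m ≤ X)) →
      ‖∑ m ∈ Ioc a b, g (n * m) * (starRingEnd ℂ) (g (n' * m))‖ ≤ T / j) :
    ‖∑ n ∈ Ioc 0 X, (((highPart vonMangoldt Q *
        ((ζ : ArithmeticFunction ℝ) * highPart (μ : ArithmeticFunction ℝ) Q)) n : ℝ) : ℂ) *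
        window X R g n‖ ≤ 2 * (D * Real.log X * W * (1 + Real.log X)) := by
  set f := (ζ : ArithmeticFunction ℝ) * highPart (μ : ArithmeticFunction ℝ) Q with hf
  have hlogX : 0 ≤ Real.log X := Real.log_natCast_nonneg _
  have hfD : ∀ n ∈ Ioc 0 X, |f n| ≤ D := fun n hn =>
    (abs_zeta_mul_highPart_moebius_le _ _).trans (hD n hn)
  have hL : ∀ n ∈ Ioc 0 X, |highPart vonMangoldt Q n| ≤ Real.log X := by
    intro n hn
    rw [mem_Ioc] at hn
    rw [highPart_apply]
    split_ifs
    · simpa using hlogX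
    · rw [abs_of_nonneg vonMangoldt_nonneg]
      exact vonMangoldt_le_log.trans
        (Real.log_le_log (by exact_mod_cast hn.1) (by exact_mod_cast hn.2))
  rw [sum_Ioc_conv_mul _ _ fun n hn => window_eq_zero hn]
  have hsplit : ∑ k ∈ Ioc 0 X, ∑ l ∈ Ioc 0 X,
        (highPart vonMangoldt Q k : ℂ) * (f l : ℂ) * window X R g (k * l) =
      ∑ l ∈ Ioc 0 X, ∑ k ∈ Ioc 0 X, (if N < l then 0 else (f l : ℂ)) *
        (highPart vonMangoldt Q k : ℂ) * window X R g (l * k) +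
      ∑ k ∈ Ioc 0 X, ∑ l ∈ Ioc 0 X, (if N < k then 0 else (highPart vonMangoldt Q k : ℂ)) *
        (if N < l then (f l : ℂ) else 0) * window X R g (k * l) := by
    rw [sum_comm (s := Ioc 0 X) (t := Ioc 0 X) (f := fun l k => (if N < l then 0 else (f l : ℂ)) *
        (highPart vonMangoldt Q k : ℂ) * window X R g (l * k)), ← sum_add_distrib]
    refine sum_congr rfl fun k _ => ?_
    rw [← sum_add_distrib]
    refine sum_congr rfl fun l _ => ?_
    split_ifs with h1 h2
    · rw [window_eq_zero (by nlinarith)]; simp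
    · simp
    · simp only [mul_zero, zero_mul, add_zero]; rw [mul_comm k l]; ring
    · simp only [mul_zero, zero_mul, add_zero]; rw [mul_comm k l]; ring
  rw [hsplit, two_mul]
  refine (norm_add_le _ _).trans (add_le_add ?_ ?_)
  · refine norm_bilinear_sum_le hR hQ hg hD0 hlogX hT hW hTW hII ?_ ?_ ?_ ?_
    · intro n hn
      split_ifs
      · simpa using hD0
      · simpa using hfD n hn
    · intro m hm
      simpa using hL m hm
    · intro n hn
      rw [if_pos hn]
    · intro n hn
      rw [hf, zeta_mul_highPart_moebius_eq_zero hn.le]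
      simp
  · rw [mul_comm D]
    refine norm_bilinear_sum_le hR hQ hg hlogX hD0 hT hW hTW hII ?_ ?_ ?_ ?_
    · intro n hn
      split_ifs
      · simpa using hlogX
      · simpa using hL n hn
    · intro n hn
      split_ifs
      · simpa using hfD n hn
      · simpa using hD0
    · intro n hn
      rw [if_pos hn]
    · intro n hn
      rw [highPart_apply, if_pos hn.le]
      simp

open ArithmeticFunction in
theorem norm_sum_vonMangoldt_window_le {X R Q N : ℕ} {g : ℕ → ℂ} {T₁ T W D : ℝ} (hR : 0 < R)
    (hQ : 0 < Q) (hRQ : R * Q ≤ X) (hN : N * N = X) (hg : ∀ n, ‖g n‖ ≤ 1) (hT₁ : 0 ≤ T₁)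
    (hT : 0 ≤ T) (hW : 0 ≤ W) (hD : ∀ n ∈ Ioc 0 X, (#n.divisors : ℝ) ≤ D) (hD0 : 0 ≤ D)
    (hTW : (X : ℝ) ^ 2 / Q + X * Q * T ≤ W ^ 2)
    (hI : ∀ d, 0 < d → d ≤ Q ^ 2 → ∀ a b, (∀ m ∈ Ioc a b, X < R * (d * m) ∧ d * m ≤ X) →
      ‖∑ m ∈ Ioc a b, g (d * m)‖ ≤ T₁)
    (hII : ∀ j, 0 < j → ∀ n n', n ≠ n' → n / Q = j → n' / Q = j → n ≤ N → n' ≤ N → ∀ a b,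
      (∀ m ∈ Ioc a b, (X < R * (n * m) ∧ n * m ≤ X) ∧ (X < R * (n' * m) ∧ n' * m ≤ X)) →
      ‖∑ m ∈ Ioc a b, g (n * m) * (starRingEnd ℂ) (g (n' * m))‖ ≤ T / j) :
    ‖∑ n ∈ Ioc 0 X, (vonMangoldt n : ℂ) * window X R g n‖ ≤
      2 * Q ^ 2 * Real.log X * T₁ + 2 * (D * Real.log X * W * (1 + Real.log X)) := by
  have hlogX : 0 ≤ Real.log X := Real.log_natCast_nonneg _
  have hF : ∀ n, X < n → window X R g n = 0 := fun n hn => window_eq_zero hn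
  have hwin : ∀ d, 0 < d → d ≤ Q ^ 2 → ∀ i, ‖∑ m ∈ Ioc i X, window X R g (d * m)‖ ≤ T₁ :=
    fun d h0 h1 i => norm_sum_window_mul_le hR h0 (hI d h0 h1)
  have h1 : ∑ n ∈ Ioc 0 X, (lowPart vonMangoldt Q n : ℂ) * window X R g n = 0 := by
    refine sum_eq_zero fun n _ => ?_
    rw [lowPart_apply]
    split_ifs with h
    · rw [window, if_neg, mul_zero]
      have := Nat.mul_le_mul_left R h
      omega
    · simp
  have h2 := norm_typeI_sum_le (f := lowPart (moebius : ArithmeticFunction ℝ) Q) (h := log)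
    (X := X) (D := Q) (A := 1) zero_le_one (by positivity : 0 ≤ Real.log X * T₁) hF
    (fun k hk => by rw [lowPart_apply, if_neg (by omega)])
    (fun k _ => abs_lowPart_moebius_le Q k)
    (fun k hk hk' => by
      simp only [log_apply]
      exact norm_sum_log_mul_le (F := fun l => window X R g (k * l))
        (hwin k hk (hk'.trans (Nat.le_self_pow two_ne_zero _))))
  have h3 := norm_typeI_sum_le (f := lowPart (moebius : ArithmeticFunction ℝ) Q *
      lowPart vonMangoldt Q) (h := (zeta : ArithmeticFunction ℝ)) (X := X) (D := Q ^ 2) hlogX hT₁ hF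
    (fun k hk => lowPart_moebius_mul_eq_zero hk)
    (fun k hk => (abs_lowPart_moebius_mul_le Q k).trans
      (Real.log_le_log (by exact_mod_cast (mem_Ioc.1 hk).1) (by exact_mod_cast (mem_Ioc.1 hk).2)))
    (fun k hk hk' => by
      refine le_trans (le_of_eq ?_) (hwin k hk hk' 0)
      congr 1
      refine sum_congr rfl fun l hl => ?_
      rw [mem_Ioc] at hl
      rw [natCoe_apply, zeta_apply_ne hl.1.ne']
      simp)
  have h4 := norm_sum_highPart_le hR hQ hN hg hT hW hD hD0 hTW hII
  have hsum : ∑ n ∈ Ioc 0 X, (vonMangoldt n : ℂ) * window X R g n =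
      ∑ n ∈ Ioc 0 X, (((lowPart (moebius : ArithmeticFunction ℝ) Q * log) n : ℝ) : ℂ) *
        window X R g n -
      ∑ n ∈ Ioc 0 X, (((lowPart (moebius : ArithmeticFunction ℝ) Q * lowPart vonMangoldt Q *
        (zeta : ArithmeticFunction ℝ)) n : ℝ) : ℂ) * window X R g n +
      ∑ n ∈ Ioc 0 X, (((highPart vonMangoldt Q * ((zeta : ArithmeticFunction ℝ) *
        highPart (moebius : ArithmeticFunction ℝ) Q)) n : ℝ) : ℂ) * window X R g n := by
    rw [← zero_add (∑ n ∈ Ioc 0 X, _ - _), ← h1, ← add_sub_assoc, ← sum_add_distrib,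
      ← sum_sub_distrib, ← sum_add_distrib]
    refine sum_congr rfl fun n _ => ?_
    have := congrArg (fun f : ArithmeticFunction ℝ => f n) (vonMangoldt_eq_vaughan Q)
    simp only [sub_eq_add_neg, ArithmeticFunction.add_apply, ArithmeticFunction.neg_apply] at this
    rw [this]
    push_cast
    ring
  rw [hsum]
  have hQ2 : (Q : ℝ) ≤ Q ^ 2 := by exact_mod_cast Nat.le_self_pow two_ne_zero Q
  push_cast at h3
  calc _ ≤ Q * (1 * (Real.log X * T₁)) + Q ^ 2 * (Real.log X * T₁) +
        2 * (D * Real.log X * W * (1 + Real.log X)) :=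
        (norm_add_le _ _).trans (add_le_add ((norm_sub_le _ _).trans (add_le_add h2 h3)) h4)
    _ ≤ Q ^ 2 * (1 * (Real.log X * T₁)) + Q ^ 2 * (Real.log X * T₁) +
        2 * (D * Real.log X * W * (1 + Real.log X)) := by gcongr
    _ = _ := by ring

open ArithmeticFunction in
theorem exists_norm_sum_vonMangoldt_window_le {ε : ℝ} (hε : 0 < ε) : ∃ C > 0, ∀ (Y R : ℕ)
    (g : ℕ → ℂ) (T₁ T V : ℝ), 0 < R → R ≤ Y → (∀ n, ‖g n‖ ≤ 1) → 0 ≤ T₁ → 0 ≤ T → 0 ≤ V →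
    (Y : ℝ) ^ 20 * T₁ ≤ V → (Y : ℝ) ^ 110 + (Y : ℝ) ^ 70 * T ≤ V ^ 2 →
    (∀ d, 0 < d → d ≤ Y ^ 20 → ∀ a b,
      (∀ m ∈ Ioc a b, Y ^ 60 < R * (d * m) ∧ d * m ≤ Y ^ 60) →
      ‖∑ m ∈ Ioc a b, g (d * m)‖ ≤ T₁) →
    (∀ j, 0 < j → ∀ n n', n ≠ n' → n / Y ^ 10 = j → n' / Y ^ 10 = j → n ≤ Y ^ 30 → n' ≤ Y ^ 30 →
      ∀ a b, (∀ m ∈ Ioc a b, (Y ^ 60 < R * (n * m) ∧ n * m ≤ Y ^ 60) ∧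
        (Y ^ 60 < R * (n' * m) ∧ n' * m ≤ Y ^ 60)) →
      ‖∑ m ∈ Ioc a b, g (n * m) * (starRingEnd ℂ) (g (n' * m))‖ ≤ T / j) →
    ‖∑ n ∈ Ioc 0 (Y ^ 60), (vonMangoldt n : ℂ) * window (Y ^ 60) R g n‖ ≤ C * (Y : ℝ) ^ ε * V := by
  have hδ : 0 < ε / 180 := by positivity
  obtain ⟨C₀, hC₀, hdiv⟩ := exists_card_divisors_le_rpow hδ
  set C₁ := max C₀ (1 / (ε / 180)) with hC₁
  have hC₁1 : 1 ≤ C₁ := hC₀.trans (le_max_left _ _)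
  refine ⟨6 * C₁ ^ 3, by positivity, ?_⟩
  intro Y R g T₁ T V hR hRY hg hT₁ hT hV h1 h2 hI hII
  have hY : 0 < Y := by omega
  have hY' : (1 : ℝ) ≤ Y := by exact_mod_cast hY
  set Z : ℝ := (Y : ℝ) ^ (ε / 3) with hZ
  have hZ1 : 1 ≤ Z := Real.one_le_rpow hY' (by positivity)
  have hXZ : (((Y ^ 60 : ℕ) : ℝ)) ^ (ε / 180) = Z := by
    push_cast
    rw [← Real.rpow_natCast, ← Real.rpow_mul (by positivity), hZ]
    congr 1
    push_cast
    ring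
  have hlog : Real.log ((Y ^ 60 : ℕ) : ℝ) ≤ C₁ * Z := by
    refine (Real.log_le_rpow_div (by positivity) hδ).trans ?_
    rw [hXZ, div_eq_mul_one_div, mul_comm]
    gcongr
    exact le_max_right _ _
  have hD : ∀ n ∈ Ioc 0 (Y ^ 60), (#n.divisors : ℝ) ≤ C₁ * Z := by
    intro n hn
    rw [mem_Ioc] at hn
    refine (hdiv n hn.1.ne').trans ?_
    rw [← hXZ]
    gcongr
    · exact le_max_left _ _
    · exact hn.2
  have hlog0 : 0 ≤ Real.log ((Y ^ 60 : ℕ) : ℝ) := Real.log_natCast_nonneg _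
  have hmain := norm_sum_vonMangoldt_window_le (X := Y ^ 60) (R := R) (Q := Y ^ 10) (N := Y ^ 30)
    (g := g) (T₁ := T₁) (T := T) (W := V) (D := C₁ * Z) hR (by positivity)
    (by
      calc R * Y ^ 10 ≤ Y ^ 50 * Y ^ 10 := by
            gcongr; exact hRY.trans (Nat.le_self_pow (by norm_num) _)
        _ = Y ^ 60 := by ring)
    (by ring) hg hT₁ hT hV hD (by positivity)
    (by
      have hY0 : (Y : ℝ) ≠ 0 := by positivity
      refine le_trans (le_of_eq ?_) h2
      push_cast
      field_simp)
    (by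
      intro d hd hd'
      exact hI d hd (by rwa [← pow_mul] at hd'))
    hII
  refine hmain.trans ?_
  have hZε : (Y : ℝ) ^ ε = Z ^ 3 := by
    rw [hZ, ← Real.rpow_natCast, ← Real.rpow_mul (by positivity)]
    congr 1
    push_cast
    ring
  rw [hZε]
  push_cast at hlog hlog0 ⊢
  have hCZ : 1 ≤ C₁ * Z := one_le_mul_of_one_le_of_one_le hC₁1 hZ1
  set L := C₁ * Z with hL
  calc 2 * ((Y : ℝ) ^ 10) ^ 2 * Real.log ((Y : ℝ) ^ 60) * T₁ +
        2 * (L * Real.log ((Y : ℝ) ^ 60) * V * (1 + Real.log ((Y : ℝ) ^ 60)))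
      ≤ 2 * ((Y : ℝ) ^ 10) ^ 2 * L * T₁ + 2 * (L * L * V * (L + L)) := by gcongr
    _ = 2 * L * ((Y : ℝ) ^ 20 * T₁) + 4 * L ^ 3 * V := by ring
    _ ≤ 2 * L ^ 3 * V + 4 * L ^ 3 * V := by
        gcongr
        exact le_self_pow₀ hCZ (by norm_num)
    _ = 6 * C₁ ^ 3 * Z ^ 3 * V := by rw [hL]; ring

theorem rpow_le_rpow_add_mul_sub {γ x y : ℝ} (hγ0 : 0 ≤ γ) (hγ1 : γ ≤ 1) (hx : 0 < x)
    (hy : 0 ≤ y) : y ^ γ ≤ x ^ γ + γ * x ^ (γ - 1) * (y - x) := by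
  have h := rpow_one_add_le_one_add_mul_self (s := (y - x) / x) (p := γ)
    (by rw [le_div_iff₀ hx]; linarith) hγ0 hγ1
  have h1 : 1 + (y - x) / x = y / x := by field_simp; ring
  rw [h1, Real.div_rpow hy hx.le, div_le_iff₀ (by positivity)] at h
  rw [Real.rpow_sub_one hx.ne']
  refine h.trans (le_of_eq ?_)
  field_simp

theorem abs_rpow_sub_rpow_bounds {γ L D u v : ℝ} (hγ0 : 1 / 2 ≤ γ) (hγ1 : γ ≤ 1) (hL : 0 < L)
    (hu : L ≤ u) (hu' : u ≤ 2 * L) (hv : L ≤ v) (hv' : v ≤ 2 * L) (h1 : 1 ≤ |u - v|)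
    (hD : |u - v| ≤ D) :
    1 / 4 * L ^ (γ - 1) ≤ |u ^ γ - v ^ γ| ∧ |u ^ γ - v ^ γ| ≤ L ^ (γ - 1) * D := by
  wlog huv : v ≤ u generalizing u v
  · rw [abs_sub_comm u v] at h1 hD
    rw [abs_sub_comm (u ^ γ)]
    exact this hv hv' hu hu' h1 hD (le_of_not_ge huv)
  have hv0 : 0 < v := hL.trans_le hv
  have hu0 : 0 < u := hL.trans_le hu
  rw [abs_of_nonneg (by linarith)] at h1 hD
  rw [abs_of_nonneg (sub_nonneg.2 (Real.rpow_le_rpow hv0.le huv (by linarith)))]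
  constructor
  · have h2 := rpow_le_rpow_add_mul_sub (by linarith : 0 ≤ γ) hγ1 hu0 hv0.le
    have h3 : (2 * L) ^ (γ - 1) ≤ u ^ (γ - 1) :=
      Real.rpow_le_rpow_of_nonpos hu0 hu' (by linarith)
    have h4 : (2 : ℝ)⁻¹ ≤ 2 ^ (γ - 1) := by
      rw [← Real.rpow_neg_one]
      exact Real.rpow_le_rpow_of_exponent_le one_le_two (by linarith)
    rw [Real.mul_rpow zero_le_two hL.le] at h3
    calc 1 / 4 * L ^ (γ - 1) = 1 / 2 * (2⁻¹ * L ^ (γ - 1)) * 1 := by ring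
      _ ≤ γ * u ^ (γ - 1) * (u - v) := by
          gcongr
          exact (mul_le_mul_of_nonneg_right h4 (by positivity)).trans h3
      _ ≤ _ := by linarith
  · have h2 := rpow_le_rpow_add_mul_sub (by linarith : 0 ≤ γ) hγ1 hv0 hu0.le
    have h3 : v ^ (γ - 1) ≤ L ^ (γ - 1) :=
      Real.rpow_le_rpow_of_nonpos hL hv (by linarith)
    calc u ^ γ - v ^ γ ≤ γ * v ^ (γ - 1) * (u - v) := by linarith
      _ ≤ 1 * L ^ (γ - 1) * D := by gcongr
      _ = _ := by ring

theorem sqrt_add_div_sqrt_le {A B M P : ℝ} (hA : 0 ≤ A) (hB : 0 < B) (hM : 0 ≤ M)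
    (h1 : B ^ 2 ≤ P) (h2 : P ≤ A ^ 2) : √P + M / √P ≤ A + M / B := by
  have h3 : √P ≤ A := Real.sqrt_le_iff.2 ⟨hA, h2⟩
  have h4 : B ≤ √P := Real.le_sqrt_of_sq_le h1
  gcongr

theorem exists_norm_sum_e_typeI_le {γ C₀ : ℝ} (hγ : 11 / 12 < γ) (hγ1 : γ < 1) (hC₀ : 0 ≤ C₀)
    {R : ℕ} (hR : 0 < R) : ∃ C > 0, ∀ (Y : ℕ) (t : ℝ) (h : ℤ), 0 < Y → h ≠ 0 →
    |(h : ℝ)| * ((Y : ℝ) ^ 60) ^ γ ≤ C₀ * (Y : ℝ) ^ 60 →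
    ∀ d, 0 < d → ∀ a b : ℕ, (∀ m ∈ Ioc a b, Y ^ 60 < R * (d * m) ∧ d * m ≤ Y ^ 60) →
      ‖∑ m ∈ Ioc a b, e (t * ((d * m : ℕ) : ℝ) + h * ((d * m : ℕ) : ℝ) ^ γ)‖ ≤
        C * (Y : ℝ) ^ 33 := by
  have hR' : (1 : ℝ) ≤ R := by exact_mod_cast hR
  obtain ⟨C₁, hC₁, hsum⟩ := exists_norm_sum_e_add_rpow_le (by linarith : 0 < γ) hγ1 hR'
  refine ⟨C₁ * (C₀ + 1 + R), by positivity, ?_⟩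
  intro Y t h hY hh hbd d hd a b hm
  have hY' : (1 : ℝ) ≤ Y := by exact_mod_cast hY
  have hd' : (1 : ℝ) ≤ d := by exact_mod_cast hd
  have hh' : (1 : ℝ) ≤ |(h : ℝ)| := by exact_mod_cast Int.one_le_abs hh
  set X : ℝ := (Y : ℝ) ^ 60 with hX
  have hX0 : 0 < X := by positivity
  have hXγ : (Y : ℝ) ^ 54 ≤ X ^ γ := by
    rw [hX, ← Real.rpow_natCast, ← Real.rpow_natCast, ← Real.rpow_mul (by positivity)]
    apply Real.rpow_le_rpow_of_exponent_le hY'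
    push_cast
    linarith
  have hm' : ∀ m ∈ Ioc a b, X / (R * d) ≤ m ∧ (m : ℝ) ≤ R * (X / (R * d)) := by
    intro m hmem
    obtain ⟨h1, h2⟩ := hm m hmem
    have h1' : X < R * (d * m) := by rw [hX]; exact_mod_cast h1
    have h2' : d * m ≤ X := by rw [hX]; exact_mod_cast h2
    constructor
    · rw [div_le_iff₀ (by positivity)]; linarith
    · rw [← mul_div_assoc, mul_div_mul_left _ _ (by positivity), le_div_iff₀ (by positivity)]
      linarith
  have hκ : (h : ℝ) * (d : ℝ) ^ γ ≠ 0 := by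
    have : (h : ℝ) ≠ 0 := by exact_mod_cast hh
    positivity
  have hmain := hsum (t * d) (h * (d : ℝ) ^ γ) (X / (R * d)) hκ (by positivity) a b hm'
  have hP : |(h : ℝ) * (d : ℝ) ^ γ| * (X / (R * d)) ^ γ = |(h : ℝ)| * X ^ γ / (R : ℝ) ^ γ := by
    rw [abs_mul, abs_of_nonneg (by positivity : 0 ≤ (d : ℝ) ^ γ),
      Real.div_rpow hX0.le (by positivity), Real.mul_rpow (by positivity) (by positivity)]
    field_simp
  rw [hP] at hmain
  have hRγ1 : (1 : ℝ) ≤ (R : ℝ) ^ γ := Real.one_le_rpow hR' (by linarith)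
  have hRγ2 : (R : ℝ) ^ γ ≤ (R : ℝ) ^ 2 := by
    rw [← Real.rpow_natCast]
    apply Real.rpow_le_rpow_of_exponent_le hR'
    push_cast
    linarith
  have hfin := sqrt_add_div_sqrt_le (A := (C₀ + 1) * (Y : ℝ) ^ 30) (B := (Y : ℝ) ^ 27 / R)
    (M := X / (R * d)) (P := |(h : ℝ)| * X ^ γ / (R : ℝ) ^ γ) (by positivity) (by positivity)
    (by positivity)
    (by
      calc ((Y : ℝ) ^ 27 / R) ^ 2 = 1 * (Y : ℝ) ^ 54 / (R : ℝ) ^ 2 := by ring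
        _ ≤ _ := by gcongr)
    (by
      calc |(h : ℝ)| * X ^ γ / (R : ℝ) ^ γ ≤ |(h : ℝ)| * X ^ γ / 1 := by gcongr
        _ ≤ C₀ * (Y : ℝ) ^ 60 := by rw [div_one]; exact hbd
        _ ≤ (C₀ + 1) ^ 2 * (Y : ℝ) ^ 60 := by gcongr; nlinarith
        _ = _ := by ring)
  calc _ = ‖∑ m ∈ Ioc a b, e (t * d * m + h * (d : ℝ) ^ γ * (m : ℝ) ^ γ)‖ := by
        congr 1
        refine sum_congr rfl fun m _ => ?_
        push_cast
        rw [Real.mul_rpow (by positivity) (by positivity)]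
        congr 1
        ring
    _ ≤ C₁ * ((C₀ + 1) * (Y : ℝ) ^ 30 + X / (R * d) / ((Y : ℝ) ^ 27 / R)) :=
        hmain.trans (by gcongr)
    _ ≤ C₁ * ((C₀ + 1) * (Y : ℝ) ^ 33 + R * (Y : ℝ) ^ 33) := by
        gcongr
        · norm_num
        · calc X / (R * d) / ((Y : ℝ) ^ 27 / R) ≤ X / (1 * 1) / ((Y : ℝ) ^ 27 / R) := by gcongr
            _ = R * (Y : ℝ) ^ 33 := by rw [hX]; field_simp
    _ = _ := by ring

theorem exists_norm_sum_e_typeII_le {γ C₀ : ℝ} (hγ : 11 / 12 < γ) (hγ1 : γ < 1) (hC₀ : 0 ≤ C₀)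
    {R : ℕ} (hR : 0 < R) : ∃ C > 0, ∀ (Y : ℕ) (t : ℝ) (h : ℤ), 0 < Y → h ≠ 0 →
    |(h : ℝ)| * ((Y : ℝ) ^ 60) ^ γ ≤ C₀ * (Y : ℝ) ^ 60 →
    ∀ j, 0 < j → ∀ n n', n ≠ n' → n / Y ^ 10 = j → n' / Y ^ 10 = j → n ≤ Y ^ 30 → n' ≤ Y ^ 30 →
      ∀ a b : ℕ, (∀ m ∈ Ioc a b, (Y ^ 60 < R * (n * m) ∧ n * m ≤ Y ^ 60) ∧
        (Y ^ 60 < R * (n' * m) ∧ n' * m ≤ Y ^ 60)) →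
      ‖∑ m ∈ Ioc a b, e (t * ((n * m : ℕ) : ℝ) + h * ((n * m : ℕ) : ℝ) ^ γ) *
        (starRingEnd ℂ) (e (t * ((n' * m : ℕ) : ℝ) + h * ((n' * m : ℕ) : ℝ) ^ γ))‖ ≤
        C * (Y : ℝ) ^ 40 / j := by
  have hR' : (1 : ℝ) ≤ R := by exact_mod_cast hR
  obtain ⟨C₁, hC₁, hsum⟩ := exists_norm_sum_e_add_rpow_le (by linarith : 0 < γ) hγ1
    (by linarith : (1 : ℝ) ≤ 2 * R)
  refine ⟨C₁ * (C₀ + 1 + 4), by positivity, ?_⟩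
  intro Y t h hY hh hbd j hj n n' hne hn hn' hnN hn'N a b hm
  have hY' : (1 : ℝ) ≤ Y := by exact_mod_cast hY
  have hj' : (1 : ℝ) ≤ j := by exact_mod_cast hj
  have hh' : (1 : ℝ) ≤ |(h : ℝ)| := by exact_mod_cast Int.one_le_abs hh
  set X : ℝ := (Y : ℝ) ^ 60 with hX
  have hX0 : 0 < X := by positivity
  have hXγ : (Y : ℝ) ^ 55 ≤ X ^ γ := by
    rw [hX, ← Real.rpow_natCast, ← Real.rpow_natCast, ← Real.rpow_mul (by positivity)]
    apply Real.rpow_le_rpow_of_exponent_le hY'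
    push_cast
    linarith
  set L : ℝ := j * (Y : ℝ) ^ 10 with hL
  have hL0 : 0 < L := by positivity
  have hblock : ∀ k, k / Y ^ 10 = j → L ≤ k ∧ (k : ℝ) < L + (Y : ℝ) ^ 10 := by
    intro k hk
    rw [Nat.div_eq_iff (by positivity)] at hk
    have h1 : j * Y ^ 10 ≤ k := by linarith [hk.1]
    have h2 : k < j * Y ^ 10 + Y ^ 10 := by
      have := hk.2
      have : 0 < Y ^ 10 := by positivity
      omega
    exact ⟨by rw [hL]; exact_mod_cast h1, by rw [hL]; exact_mod_cast h2⟩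
  obtain ⟨hn1, hn2⟩ := hblock n hn
  obtain ⟨hn1', hn2'⟩ := hblock n' hn'
  have hQL : (Y : ℝ) ^ 10 ≤ L := le_mul_of_one_le_left (by positivity) hj'
  have hdiff1 : (1 : ℝ) ≤ |(n : ℝ) - n'| := by
    have : (1 : ℤ) ≤ |(n : ℤ) - n'| := Int.one_le_abs (sub_ne_zero.2 (by exact_mod_cast hne))
    exact_mod_cast this
  have hdiff2 : |(n : ℝ) - n'| ≤ (Y : ℝ) ^ 10 := by rw [abs_le]; constructor <;> linarith
  obtain ⟨hlow, hupp⟩ := abs_rpow_sub_rpow_bounds (by linarith) hγ1.le hL0 hn1 (by linarith)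
    hn1' (by linarith) hdiff1 hdiff2
  have hjN : (j : ℝ) ≤ (Y : ℝ) ^ 20 := by
    have h1 : j ≤ Y ^ 30 / Y ^ 10 := hn ▸ Nat.div_le_div_right hnN
    rw [Nat.pow_div (by norm_num) hY] at h1
    exact_mod_cast h1
  have hm' : ∀ m ∈ Ioc a b, X / (2 * R * L) ≤ m ∧ (m : ℝ) ≤ 2 * R * (X / (2 * R * L)) := by
    intro m hmem
    obtain ⟨⟨h1, h2⟩, -⟩ := hm m hmem
    have h1' : X < R * (n * m) := by rw [hX]; exact_mod_cast h1
    have h2' : n * m ≤ X := by rw [hX]; exact_mod_cast h2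
    constructor
    · rw [div_le_iff₀ (by positivity)]
      refine h1'.le.trans ?_
      calc (R : ℝ) * (n * m) ≤ R * ((2 * L) * m) := by gcongr; linarith
        _ = _ := by ring
    · rw [← mul_div_assoc, mul_div_mul_left _ _ (by positivity), le_div_iff₀ (by positivity)]
      refine le_trans ?_ h2'
      rw [mul_comm]
      gcongr
  have hL' : 0 < L ^ (γ - 1) := by positivity
  have hκ : (h : ℝ) * ((n : ℝ) ^ γ - (n' : ℝ) ^ γ) ≠ 0 := by
    have h1 : (h : ℝ) ≠ 0 := by exact_mod_cast hh
    have h2 : (n : ℝ) ^ γ - (n' : ℝ) ^ γ ≠ 0 := by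
      rw [← abs_pos]; linarith
    exact mul_ne_zero h1 h2
  have hmain := hsum (t * (n - n')) (h * ((n : ℝ) ^ γ - (n' : ℝ) ^ γ)) (X / (2 * R * L)) hκ
    (by positivity) a b hm'
  have hP : ∀ z, |(h : ℝ)| * (L ^ (γ - 1) * z) * (X / (2 * R * L)) ^ γ =
      |(h : ℝ)| * X ^ γ * z / ((2 * (R : ℝ)) ^ γ * L) := by
    intro z
    rw [Real.div_rpow hX0.le (by positivity), Real.mul_rpow (by positivity) hL0.le,
      Real.rpow_sub_one hL0.ne']
    field_simp
  have hRγ1 : (1 : ℝ) ≤ (2 * (R : ℝ)) ^ γ := Real.one_le_rpow (by linarith) (by linarith)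
  have hRγ2 : (2 * (R : ℝ)) ^ γ ≤ (2 * (R : ℝ)) ^ (1 : ℕ) := by
    rw [← Real.rpow_natCast]
    apply Real.rpow_le_rpow_of_exponent_le (by linarith)
    push_cast
    linarith
  have hfin := sqrt_add_div_sqrt_le (A := (C₀ + 1) * (Y : ℝ) ^ 40 / j)
    (B := (Y : ℝ) ^ 12 / (8 * R))
    (M := X / (2 * R * L)) (P := |(h : ℝ) * ((n : ℝ) ^ γ - (n' : ℝ) ^ γ)| * (X / (2 * R * L)) ^ γ)
    (by positivity) (by positivity) (by positivity)
    (by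
      rw [abs_mul]
      calc ((Y : ℝ) ^ 12 / (8 * R)) ^ 2 = (Y : ℝ) ^ 24 / (8 * R * (8 * R)) := by ring
        _ ≤ (Y : ℝ) ^ 25 / (8 * R * 1) := by
            gcongr
            · norm_num
            · linarith
        _ = 1 * (Y : ℝ) ^ 55 * (1 / 4) /
            ((2 * (R : ℝ)) ^ (1 : ℕ) * ((Y : ℝ) ^ 20 * (Y : ℝ) ^ 10)) := by
            field_simp; norm_num
        _ ≤ |(h : ℝ)| * X ^ γ * (1 / 4) / ((2 * (R : ℝ)) ^ γ * L) := by
            rw [hL]; gcongr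
        _ = |(h : ℝ)| * (L ^ (γ - 1) * (1 / 4)) * (X / (2 * R * L)) ^ γ := (hP _).symm
        _ ≤ _ := by gcongr; linarith)
    (by
      rw [abs_mul]
      calc |(h : ℝ)| * |(n : ℝ) ^ γ - (n' : ℝ) ^ γ| * (X / (2 * R * L)) ^ γ
          ≤ |(h : ℝ)| * (L ^ (γ - 1) * (Y : ℝ) ^ 10) * (X / (2 * R * L)) ^ γ := by gcongr
        _ = |(h : ℝ)| * X ^ γ * (Y : ℝ) ^ 10 / ((2 * (R : ℝ)) ^ γ * L) := hP _
        _ ≤ C₀ * (Y : ℝ) ^ 60 * (Y : ℝ) ^ 10 / (1 * L) := by gcongr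
        _ = C₀ * (Y : ℝ) ^ 60 * 1 / j := by rw [hL]; field_simp
        _ ≤ (C₀ + 1) ^ 2 * (Y : ℝ) ^ 60 * ((Y : ℝ) ^ 20 / j) / j := by
            gcongr
            · nlinarith
            · rwa [le_div_iff₀ (by positivity), one_mul]
        _ = _ := by ring)
  calc _ = ‖∑ m ∈ Ioc a b, e (t * (n - n') * m +
          h * ((n : ℝ) ^ γ - (n' : ℝ) ^ γ) * (m : ℝ) ^ γ)‖ := by
        congr 1
        refine sum_congr rfl fun m _ => ?_
        rw [← e_sub]
        push_cast
        rw [Real.mul_rpow (by positivity) (by positivity),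
          Real.mul_rpow (by positivity) (by positivity)]
        congr 1
        ring
    _ ≤ C₁ * ((C₀ + 1) * (Y : ℝ) ^ 40 / j + X / (2 * R * L) / ((Y : ℝ) ^ 12 / (8 * R))) :=
        hmain.trans (by gcongr)
    _ = C₁ * ((C₀ + 1) * (Y : ℝ) ^ 40 / j + 4 * (Y : ℝ) ^ 38 / j) := by
        rw [hX, hL]; field_simp; ring
    _ ≤ C₁ * ((C₀ + 1) * (Y : ℝ) ^ 40 / j + 4 * (Y : ℝ) ^ 40 / j) := by
        gcongr
        norm_num
    _ = _ := by ring

open ArithmeticFunction in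
theorem exists_norm_sum_vonMangoldt_e_rpow_le {γ C₀ ε : ℝ} (hγ : 11 / 12 < γ) (hγ1 : γ < 1)
    (hC₀ : 0 ≤ C₀) {R : ℕ} (hR : 0 < R) (hε : 0 < ε) : ∃ C > 0, ∀ (Y : ℕ) (t : ℝ) (h : ℤ),
    R ≤ Y → h ≠ 0 → |(h : ℝ)| * ((Y : ℝ) ^ 60) ^ γ ≤ C₀ * (Y : ℝ) ^ 60 →
    ‖∑ n ∈ Ioc 0 (Y ^ 60), (vonMangoldt n : ℂ) *
      window (Y ^ 60) R (fun n => e (t * n + h * (n : ℝ) ^ γ)) n‖ ≤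
      C * (Y : ℝ) ^ ε * (Y : ℝ) ^ 55 := by
  obtain ⟨C, hC, hmain⟩ := exists_norm_sum_vonMangoldt_window_le hε
  obtain ⟨C₁, hC₁, hI⟩ := exists_norm_sum_e_typeI_le hγ hγ1 hC₀ hR
  obtain ⟨C₂, hC₂, hII⟩ := exists_norm_sum_e_typeII_le hγ hγ1 hC₀ hR
  refine ⟨C * (1 + C₁ + C₂), by positivity, ?_⟩
  intro Y t h hRY hh hbd
  have hY : 0 < Y := by omega
  have hY' : (1 : ℝ) ≤ Y := by exact_mod_cast hY
  refine (hmain Y R (fun n => e (t * n + h * (n : ℝ) ^ γ)) (C₁ * (Y : ℝ) ^ 33) (C₂ * (Y : ℝ) ^ 40)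
    ((1 + C₁ + C₂) * (Y : ℝ) ^ 55) hR hRY (fun n => (norm_e _).le) (by positivity) (by positivity)
    (by positivity) ?_ ?_ (fun d hd _ => hI Y t h hY hh hbd d hd) (hII Y t h hY hh hbd)).trans
    (le_of_eq (by ring))
  · calc (Y : ℝ) ^ 20 * (C₁ * (Y : ℝ) ^ 33) = C₁ * (Y : ℝ) ^ 53 := by ring
      _ ≤ (1 + C₁ + C₂) * (Y : ℝ) ^ 55 := by
        gcongr
        · linarith
        · norm_num
  · calc (Y : ℝ) ^ 110 + (Y : ℝ) ^ 70 * (C₂ * (Y : ℝ) ^ 40) = (1 + C₂) * (Y : ℝ) ^ 110 := by ring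
      _ ≤ (1 + C₁ + C₂) ^ 2 * (Y : ℝ) ^ 110 := by gcongr; nlinarith
      _ = _ := by ring

theorem norm_sum_Ioc_e_linear_le {x ρ : ℝ} (hρ : 0 < ρ) {ν : ℤ} (h1 : ν + ρ ≤ x)
    (h2 : x ≤ ν + 1 - ρ) (a b : ℕ) : ‖∑ m ∈ Ioc a b, e (x * m)‖ ≤ 1 / ρ := by
  have hsub : ∀ n : ℕ, x * ((n + 1 : ℕ) : ℝ) - x * n = x := fun n => by push_cast; ring
  have h := norm_sum_Ico_e_le (fun n => x * n) (a + 1) (b + 1) hρ ν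
    (fun n _ => by simpa only [hsub] using h1) (fun n _ => by simpa only [hsub] using h2)
    (fun n _ _ => by rw [hsub n, hsub (n + 1)])
  have hIoc : Ioc a b = Ico (a + 1) (b + 1) := by ext; simp only [mem_Ioc, mem_Ico]; omega
  rwa [hIoc]

open ArithmeticFunction in
theorem exists_norm_sum_vonMangoldt_e_linear_le {C₀ ε : ℝ} (hC₀ : 0 ≤ C₀) {R : ℕ} (hR : 0 < R)
    (hε : 0 < ε) : ∃ C > 0, ∀ (Y : ℕ) (x ρ : ℝ), R ≤ Y → 0 < ρ → 1 / ρ ≤ C₀ * (Y : ℝ) ^ 24 →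
    (∀ d : ℕ, 0 < d → d ≤ Y ^ 20 → ∃ ν : ℤ, ν + ρ ≤ x * d ∧ x * d ≤ ν + 1 - ρ) →
    ‖∑ n ∈ Ioc 0 (Y ^ 60), (vonMangoldt n : ℂ) * window (Y ^ 60) R (fun n => e (x * n)) n‖ ≤
      C * (Y : ℝ) ^ ε * (Y : ℝ) ^ 57 := by
  obtain ⟨C, hC, hmain⟩ := exists_norm_sum_vonMangoldt_window_le hε
  refine ⟨C * (1 + C₀), by positivity, ?_⟩
  intro Y x ρ hRY hρ hρY hsep
  have hY : 0 < Y := by omega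
  have hY' : (1 : ℝ) ≤ Y := by exact_mod_cast hY
  refine (hmain Y R (fun n => e (x * n)) (C₀ * (Y : ℝ) ^ 24) (C₀ * (Y : ℝ) ^ 44)
    ((1 + C₀) * (Y : ℝ) ^ 57) hR hRY (fun n => (norm_e _).le) (by positivity) (by positivity)
    (by positivity) ?_ ?_ ?_ ?_).trans (le_of_eq (by ring))
  · calc (Y : ℝ) ^ 20 * (C₀ * (Y : ℝ) ^ 24) = C₀ * (Y : ℝ) ^ 44 := by ring
      _ ≤ (1 + C₀) * (Y : ℝ) ^ 57 := by
        gcongr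
        · linarith
        · norm_num
  · calc (Y : ℝ) ^ 110 + (Y : ℝ) ^ 70 * (C₀ * (Y : ℝ) ^ 44) ≤
          (Y : ℝ) ^ 114 + (Y : ℝ) ^ 70 * (C₀ * (Y : ℝ) ^ 44) := by gcongr; norm_num
      _ = (1 + C₀) * (Y : ℝ) ^ 114 := by ring
      _ ≤ (1 + C₀) ^ 2 * (Y : ℝ) ^ 114 := by gcongr; nlinarith
      _ = _ := by ring
  · intro d hd hdY a b _
    obtain ⟨ν, h1, h2⟩ := hsep d hd hdY
    refine le_trans (le_of_eq ?_) ((norm_sum_Ioc_e_linear_le hρ h1 h2 a b).trans hρY)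
    congr 1
    refine sum_congr rfl fun m _ => ?_
    push_cast
    rw [mul_assoc]
  · intro j hj n n' hne hn hn' hnN hn'N a b _
    have hY10 : 0 < Y ^ 10 := by positivity
    have hj' : (0 : ℝ) < j := by exact_mod_cast hj
    have hjN : (j : ℝ) ≤ (Y : ℝ) ^ 20 := by
      have h1 : j ≤ Y ^ 30 / Y ^ 10 := hn ▸ Nat.div_le_div_right hnN
      rw [Nat.pow_div (by norm_num) hY] at h1
      exact_mod_cast h1
    have hT : 1 / ρ ≤ C₀ * (Y : ℝ) ^ 44 / j := by
      rw [le_div_iff₀ hj']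
      calc 1 / ρ * j ≤ C₀ * (Y : ℝ) ^ 24 * (Y : ℝ) ^ 20 := by gcongr
        _ = _ := by ring
    rw [Nat.div_eq_iff hY10] at hn hn'
    have hpow : Y ^ 10 ≤ Y ^ 20 := Nat.pow_le_pow_right hY (by norm_num)
    have hterm : ∑ m ∈ Ioc a b, e (x * ((n * m : ℕ) : ℝ)) *
        (starRingEnd ℂ) (e (x * ((n' * m : ℕ) : ℝ))) = ∑ m ∈ Ioc a b, e (x * (n - n') * m) := by
      refine sum_congr rfl fun m _ => ?_
      rw [← e_sub]
      push_cast
      congr 1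
      ring
    rw [hterm]
    rcases Nat.lt_or_ge n' n with hlt | hge
    · obtain ⟨ν, h1, h2⟩ := hsep (n - n') (by omega) (by omega)
      rw [Nat.cast_sub hlt.le] at h1 h2
      exact (norm_sum_Ioc_e_linear_le hρ h1 h2 a b).trans hT
    · obtain ⟨ν, h1, h2⟩ := hsep (n' - n) (by omega) (by omega)
      rw [Nat.cast_sub hge] at h1 h2
      refine (norm_sum_Ioc_e_linear_le (ν := -ν - 1) hρ ?_ ?_ a b).trans hT <;>
        push_cast <;> linarith

theorem exists_int_add_le_mul_of_abs_sub_lt {α : ℝ} {q : ℚ}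
    (h : |α - q| < 1 / (q.den : ℝ) ^ 2) {r : ℤ} (hr : r ≠ 0) (hrq : 2 * |r| ≤ q.den) :
    ∃ ν : ℤ, ν + 1 / (2 * (q.den : ℝ)) ≤ r * α ∧ r * α ≤ ν + 1 - 1 / (2 * (q.den : ℝ)) := by
  have hq : (0 : ℝ) < q.den := by exact_mod_cast q.den_pos
  have hqz : (0 : ℤ) < q.den := by exact_mod_cast q.den_pos
  set ν := r * q.num / q.den with hν
  set s := r * q.num % q.den with hs
  have hdiv : (q.den : ℤ) * ν + s = r * q.num := Int.mul_ediv_add_emod _ _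
  have hs0 : 0 ≤ s := Int.emod_nonneg _ hqz.ne'
  have hs1 : s < q.den := Int.emod_lt_of_pos _ hqz
  have hs2 : s ≠ 0 := by
    intro h0
    have h1 : (q.den : ℤ) ∣ r * q.num := Int.dvd_of_emod_eq_zero h0
    have h2 : IsCoprime (q.den : ℤ) q.num := by
      rw [Int.isCoprime_iff_gcd_eq_one, Int.gcd_comm]
      exact q.reduced
    have h3 := Int.le_of_dvd (abs_pos.2 hr) ((dvd_abs _ _).2 (h2.dvd_of_dvd_mul_right h1))
    have := abs_pos.2 hr
    omega
  have hqe : (q : ℝ) = q.num / q.den := by exact_mod_cast (Rat.num_div_den q).symm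
  have hrq' : |(r : ℝ)| ≤ q.den / 2 := by
    have : (2 : ℝ) * |(r : ℝ)| ≤ q.den := by exact_mod_cast hrq
    linarith
  have herr : |r * (α - q)| ≤ 1 / (2 * (q.den : ℝ)) := by
    rw [abs_mul]
    calc |(r : ℝ)| * |α - q| ≤ q.den / 2 * (1 / (q.den : ℝ) ^ 2) := by gcongr
      _ = _ := by field_simp
  have hmain : (r : ℝ) * q = ν + s / q.den := by
    rw [hqe]
    have : (q.den : ℝ) * ν + s = r * q.num := by exact_mod_cast hdiv
    field_simp
    linarith
  have hs3 : 1 / (q.den : ℝ) ≤ s / q.den := by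
    gcongr
    have : 1 ≤ s := by omega
    exact_mod_cast this
  have hs4 : (s : ℝ) / q.den ≤ 1 - 1 / q.den := by
    rw [le_sub_iff_add_le, ← add_div, div_le_one hq]
    have : s + 1 ≤ q.den := by omega
    exact_mod_cast this
  have h2 : 1 / (q.den : ℝ) = 1 / (2 * (q.den : ℝ)) + 1 / (2 * (q.den : ℝ)) := by
    field_simp
    norm_num
  rw [abs_le] at herr
  have h3 : (r : ℝ) * α = r * q + r * (α - q) := by ring
  refine ⟨ν, ?_, ?_⟩ <;> rw [h3, hmain] <;> linarith [herr.1, herr.2]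

/-- `f` is a trigonometric polynomial of degree at most `N`, with constant term `a` and with
coefficients whose absolute values add up to at most `B`. -/
def IsTrigPoly (f : ℝ → ℂ) (N : ℕ) (a : ℂ) (B : ℝ) : Prop :=
  ∃ c : ℤ → ℂ, c 0 = a ∧ ∑ h ∈ Icc (-(N : ℤ)) N, ‖c h‖ ≤ B ∧
    ∀ x, f x = ∑ h ∈ Icc (-(N : ℤ)) N, c h * e (h * x)

theorem isTrigPoly_sum_e {ι : Type*} (s : Finset ι) (φ : ι → ℤ) {N : ℕ} (hφ : ∀ i ∈ s, |φ i| ≤ N) :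
    IsTrigPoly (fun x => ∑ i ∈ s, e (φ i * x)) N #{i ∈ s | φ i = 0} #s := by
  have hmaps : ∀ i ∈ s, φ i ∈ Icc (-(N : ℤ)) N := fun i hi => mem_Icc.2 (abs_le.1 (hφ i hi))
  refine ⟨fun h => #{i ∈ s | φ i = h}, rfl, ?_, fun x => ?_⟩
  · simp only [Complex.norm_natCast]
    exact_mod_cast (card_eq_sum_card_fiberwise hmaps).ge
  · simp only []
    rw [← sum_fiberwise_of_maps_to hmaps]
    refine sum_congr rfl fun h _ => ?_
    rw [sum_congr rfl fun i hi => by rw [(mem_filter.1 hi).2], sum_const, nsmul_eq_mul]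

theorem IsTrigPoly.const_mul {f : ℝ → ℂ} {N : ℕ} {a : ℂ} {B : ℝ} (hf : IsTrigPoly f N a B) (z : ℂ) :
    IsTrigPoly (fun x => z * f x) N (z * a) (‖z‖ * B) := by
  obtain ⟨c, h0, hB, hc⟩ := hf
  refine ⟨fun h => z * c h, by simp only [h0], ?_, fun x => ?_⟩
  · simp only [norm_mul, ← mul_sum]
    gcongr
  · simp only [hc, mul_sum, mul_assoc]

theorem IsTrigPoly.add {f f' : ℝ → ℂ} {N : ℕ} {a a' : ℂ} {B B' : ℝ} (hf : IsTrigPoly f N a B)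
    (hf' : IsTrigPoly f' N a' B') : IsTrigPoly (fun x => f x + f' x) N (a + a') (B + B') := by
  obtain ⟨c, h0, hB, hc⟩ := hf
  obtain ⟨c', h0', hB', hc'⟩ := hf'
  refine ⟨fun h => c h + c' h, by simp only [h0, h0'], ?_, fun x => ?_⟩
  · refine (sum_le_sum fun h _ => norm_add_le _ _).trans ?_
    rw [sum_add_distrib]
    gcongr
  · simp only [hc, hc', add_mul, sum_add_distrib]

theorem IsTrigPoly.mono {f : ℝ → ℂ} {N : ℕ} {a : ℂ} {B B' : ℝ} (hf : IsTrigPoly f N a B)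
    (h : B ≤ B') : IsTrigPoly f N a B' := by
  obtain ⟨c, h0, hB, hc⟩ := hf
  exact ⟨c, h0, hB.trans h, hc⟩

theorem IsTrigPoly.norm_le {f : ℝ → ℂ} {N : ℕ} {a : ℂ} {B : ℝ} (hf : IsTrigPoly f N a B) (x : ℝ) :
    ‖f x‖ ≤ B := by
  obtain ⟨c, -, hB, hc⟩ := hf
  rw [hc]
  refine (norm_sum_le _ _).trans (le_trans (le_of_eq ?_) hB)
  simp only [norm_mul, norm_e, mul_one]

theorem norm_sq_one_sub_e (x : ℝ) : ‖1 - e x‖ ^ 2 = 4 * Real.sin (Real.pi * x) ^ 2 := by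
  have h1 : 2 * Real.pi * x = 2 * (Real.pi * x) := by ring
  rw [← Complex.normSq_eq_norm_sq, Complex.normSq_apply, e_eq_cos_add_sin]
  simp only [Complex.sub_re, Complex.one_re, Complex.add_re, Complex.ofReal_re, Complex.mul_re,
    Complex.ofReal_im, Complex.I_re, Complex.I_im, Complex.sub_im, Complex.one_im, Complex.add_im,
    Complex.mul_im]
  rw [h1, Real.cos_two_mul, Real.sin_two_mul, Real.cos_sq']
  have := Real.sin_sq_add_cos_sq (Real.pi * x)
  linear_combination 4 * Real.sin (Real.pi * x) ^ 2 * this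

theorem four_mul_nint_le_norm_one_sub_e (x : ℝ) : 4 * nint x ≤ ‖1 - e x‖ := by
  have hr : e x = e (x - round x) := by rw [e_sub, e_intCast]; simp
  have hx := abs_sub_round x
  refine abs_le_of_sq_le_sq' ?_ (norm_nonneg _) |>.2
  rw [hr, norm_sq_one_sub_e]
  have h1 : Real.sin (Real.pi * (x - round x)) ^ 2 = Real.sin (Real.pi * nint x) ^ 2 := by
    unfold nint
    rcases abs_choice (x - round x) with h | h
    · rw [h]
    · rw [h, mul_neg, Real.sin_neg, neg_sq]
  have h0 : 0 ≤ nint x := abs_nonneg _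
  have h2 : 2 / Real.pi * (Real.pi * nint x) ≤ Real.sin (Real.pi * nint x) :=
    Real.mul_le_sin (by positivity) (by nlinarith [Real.pi_pos, show nint x ≤ 1 / 2 from hx])
  have h3 : 2 / Real.pi * (Real.pi * nint x) = 2 * nint x := by field_simp
  rw [h3] at h2
  rw [h1]
  nlinarith

theorem pow_three_le_two_mul_addEnergy (H : ℕ) :
    (H : ℝ) ^ 3 ≤ 2 * (Finset.addEnergy (range H) (range H) : ℝ) := by
  have h1 := card_sq_le_card_mul_addEnergy (range H) (range H) (range (2 * H))
  rw [filter_true_of_mem (fun x hx => by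
    rw [mem_product, mem_range, mem_range] at hx
    rw [mem_range]
    omega), card_product, card_range, card_range] at h1
  rcases Nat.eq_zero_or_pos H with rfl | hH
  · simp
  have h2 : H * H ^ 3 ≤ H * (2 * addEnergy (range H) (range H)) := by
    calc H * H ^ 3 = (H * H) ^ 2 := by ring
      _ ≤ _ := h1
      _ = _ := by ring
  exact_mod_cast Nat.le_of_mul_le_mul_left h2 hH

theorem norm_sq_sum_range_e (H : ℕ) (x : ℝ) : ((‖∑ j ∈ range H, e (j * x)‖ ^ 2 : ℝ) : ℂ) =
    ∑ p ∈ range H ×ˢ range H, e ((((p.1 : ℤ) - p.2 : ℤ) : ℝ) * x) := by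
  push_cast
  rw [← Complex.mul_conj', map_sum, sum_mul_sum, sum_product]
  refine sum_congr rfl fun i _ => sum_congr rfl fun j _ => ?_
  rw [← e_sub]
  push_cast
  congr 1
  ring

theorem isTrigPoly_norm_sum_range_e_pow_four (H : ℕ) :
    IsTrigPoly (fun x => ((‖∑ j ∈ range H, e (j * x)‖ ^ 4 : ℝ) : ℂ)) (2 * H)
      (addEnergy (range H) (range H)) ((H : ℝ) ^ 4) := by
  have h := isTrigPoly_sum_e ((range H ×ˢ range H) ×ˢ (range H ×ˢ range H))
    (fun x => (x.1.1 : ℤ) - x.1.2 + (x.2.1 - x.2.2)) (N := 2 * H) (by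
      intro x hx
      simp only [mem_product, mem_range] at hx
      rw [abs_le]
      push_cast
      omega)
  have h1 : #{x ∈ (range H ×ˢ range H) ×ˢ (range H ×ˢ range H) |
      (x.1.1 : ℤ) - x.1.2 + (x.2.1 - x.2.2) = 0} = addEnergy (range H) (range H) := by
    rw [addEnergy]
    congr 1
    refine filter_congr fun x _ => ?_
    omega
  rw [h1] at h
  have h2 : (#((range H ×ˢ range H) ×ˢ (range H ×ˢ range H)) : ℝ) = (H : ℝ) ^ 4 := by
    simp only [card_product, card_range]
    push_cast
    ring
  rw [h2] at h
  convert h using 2 with x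
  have h3 : ‖∑ j ∈ range H, e (j * x)‖ ^ 4 =
    ‖∑ j ∈ range H, e (j * x)‖ ^ 2 * ‖∑ j ∈ range H, e (j * x)‖ ^ 2 := by rw [← pow_add]
  rw [h3, Complex.ofReal_mul, norm_sq_sum_range_e, sum_mul_sum, ← sum_product']
  refine sum_congr rfl fun p _ => ?_
  rw [← e_add]
  push_cast
  congr 1
  ring

theorem norm_sq_one_sub_e' (x : ℝ) : ((‖1 - e x‖ ^ 2 : ℝ) : ℂ) = 2 - e x - e (-x) := by
  push_cast
  rw [← Complex.mul_conj', map_sub, map_one, ← e_neg, sub_mul, mul_sub, mul_sub, ← e_add]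
  simp only [add_neg_cancel, e_zero]
  ring

theorem isTrigPoly_norm_sq_mul_norm_one_sub_sq (H : ℕ) :
    IsTrigPoly (fun x => ((‖∑ j ∈ range H, e (j * x)‖ ^ 2 * ‖1 - e (H * x)‖ ^ 2 : ℝ) : ℂ)) (2 * H)
      (2 * H) (4 * (H : ℝ) ^ 2) := by
  have hφ : ∀ k : ℤ, |k| ≤ H → ∀ p ∈ range H ×ˢ range H,
      |(p.1 : ℤ) - p.2 + k| ≤ ((2 * H : ℕ) : ℤ) := by
    intro k hk p hp
    simp only [mem_product, mem_range] at hp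
    rw [abs_le] at hk ⊢
    push_cast
    omega
  have h0 := isTrigPoly_sum_e (range H ×ˢ range H) _ (hφ 0 (by simp))
  have h1 := isTrigPoly_sum_e (range H ×ˢ range H) _ (hφ H (by simp))
  have h2 := isTrigPoly_sum_e (range H ×ˢ range H) _ (hφ (-H) (by simp))
  have c0 : #{p ∈ range H ×ˢ range H | (p.1 : ℤ) - p.2 + 0 = 0} = H := by
    have : {p ∈ range H ×ˢ range H | (p.1 : ℤ) - p.2 + 0 = 0} = (range H).diag := by
      ext p
      simp only [mem_filter, mem_product, mem_diag, mem_range]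
      omega
    rw [this, diag_card, card_range]
  have c1 : #{p ∈ range H ×ˢ range H | (p.1 : ℤ) - p.2 + H = 0} = 0 := by
    rw [card_eq_zero, filter_eq_empty_iff]
    intro p hp
    simp only [mem_product, mem_range] at hp
    omega
  have c2 : #{p ∈ range H ×ˢ range H | (p.1 : ℤ) - p.2 + -H = 0} = 0 := by
    rw [card_eq_zero, filter_eq_empty_iff]
    intro p hp
    simp only [mem_product, mem_range] at hp
    omega
  rw [c0] at h0
  rw [c1] at h1
  rw [c2] at h2
  have h := ((h0.const_mul 2).add (h1.const_mul (-1))).add (h2.const_mul (-1))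
  convert h using 1
  · funext x
    rw [Complex.ofReal_mul, norm_sq_sum_range_e, norm_sq_one_sub_e', sum_mul, mul_sum, mul_sum,
      mul_sum, ← sum_add_distrib, ← sum_add_distrib]
    refine sum_congr rfl fun p _ => ?_
    push_cast
    rw [add_zero, add_mul, add_mul, neg_mul (H : ℝ) x, e_add, e_add]
    ring
  · push_cast; ring
  · simp only [card_product, card_range, norm_neg, norm_one, Complex.norm_ofNat]
    push_cast
    ring

theorem exists_isTrigPoly_majorized (H : ℕ) (hH : 0 < H) : ∃ (f g : ℝ → ℝ) (a : ℝ),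
    (∀ x, 0 ≤ f x) ∧ (∀ x, 0 ≤ g x) ∧ (∀ x, 1 / H ≤ nint x → f x ≤ g x) ∧ 0 ≤ a ∧ a ≤ 1 / 4 ∧
    IsTrigPoly (fun x => (f x : ℂ)) (2 * H) 1 (2 * H) ∧
    IsTrigPoly (fun x => (g x : ℂ)) (2 * H) a (2 * H) := by
  have hH' : (0 : ℝ) < H := by exact_mod_cast hH
  have hZ := pow_three_le_two_mul_addEnergy H
  set Z : ℝ := (addEnergy (range H) (range H) : ℝ) with hZdef
  have hZ0 : 0 < Z := by
    have : 0 < (H : ℝ) ^ 3 := by positivity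
    linarith
  have hf := (isTrigPoly_norm_sum_range_e_pow_four H).const_mul ((1 / Z : ℝ) : ℂ)
  have hg := (isTrigPoly_norm_sq_mul_norm_one_sub_sq H).const_mul (((H : ℝ) ^ 2 / 16 / Z : ℝ) : ℂ)
  refine ⟨fun x => 1 / Z * ‖∑ j ∈ range H, e (j * x)‖ ^ 4,
    fun x => (H : ℝ) ^ 2 / 16 / Z * (‖∑ j ∈ range H, e (j * x)‖ ^ 2 * ‖1 - e (H * x)‖ ^ 2),
    (H : ℝ) ^ 2 / 16 / Z * (2 * H), fun x => by positivity, fun x => by positivity, ?_,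
    by positivity, ?_, ?_, ?_⟩
  · intro x hx
    have hgeom : ‖1 - e (H * x)‖ ^ 2 = ‖∑ j ∈ range H, e (j * x)‖ ^ 2 * ‖1 - e x‖ ^ 2 := by
      rw [← mul_pow, ← norm_mul]
      congr 2
      have hpow : ∀ j : ℕ, e (j * x) = e x ^ j := by
        intro j
        rw [e, e, ← Complex.exp_nat_mul]
        congr 1
        push_cast
        ring
      simp_rw [hpow]
      rw [geom_sum_mul_neg]
    have h4 : 4 / (H : ℝ) ≤ ‖1 - e x‖ := by
      refine le_trans ?_ (four_mul_nint_le_norm_one_sub_e x)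
      calc 4 / (H : ℝ) = 4 * (1 / H) := by ring
        _ ≤ _ := by gcongr
    simp only [hgeom]
    calc 1 / Z * ‖∑ j ∈ range H, e (j * x)‖ ^ 4 =
          (H : ℝ) ^ 2 / 16 / Z * (‖∑ j ∈ range H, e (j * x)‖ ^ 2 *
            (‖∑ j ∈ range H, e (j * x)‖ ^ 2 * (4 / (H : ℝ)) ^ 2)) := by
          generalize ‖∑ j ∈ range H, e (j * x)‖ = v
          field_simp
          norm_num
      _ ≤ _ := by gcongr
  · rw [div_div, div_mul_eq_mul_div, div_le_iff₀ (by positivity)]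
    linarith [show (H : ℝ) ^ 2 * (2 * H) = 2 * (H : ℝ) ^ 3 by ring]
  · convert IsTrigPoly.mono hf ?_ using 1
    · funext x
      push_cast
      rfl
    · rw [hZdef, ← Complex.ofReal_natCast, ← Complex.ofReal_mul]
      rw [← hZdef, one_div_mul_cancel hZ0.ne', Complex.ofReal_one]
    · rw [Complex.norm_real, Real.norm_of_nonneg (by positivity), one_div_mul_eq_div,
        div_le_iff₀ hZ0]
      calc (H : ℝ) ^ 4 = H * (H : ℝ) ^ 3 := by ring
        _ ≤ H * (2 * Z) := by gcongr
        _ = _ := by ring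
  · convert IsTrigPoly.mono hg ?_ using 1
    · funext x
      push_cast
      rfl
    · push_cast
      rfl
    · rw [Complex.norm_real, Real.norm_of_nonneg (by positivity), div_div, div_mul_eq_mul_div,
        div_le_iff₀ (by positivity)]
      calc (H : ℝ) ^ 2 * (4 * (H : ℝ) ^ 2) = 4 * H * (H : ℝ) ^ 3 := by ring
        _ ≤ 4 * H * (2 * Z) := by gcongr
        _ ≤ 2 * H * (16 * Z) := by nlinarith [mul_pos hH' hZ0]

theorem norm_sum_trigPoly_mul_sub_le {ι : Type*} {s : Finset ι} {w : ι → ℂ} {x y : ι → ℝ}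
    {f f' : ℝ → ℂ} {N N' : ℕ} {a a' : ℂ} {B B' E₁ E₂ : ℝ} (hf : IsTrigPoly f N a B)
    (hf' : IsTrigPoly f' N' a' B') (h₁ : 0 ≤ E₁) (h₂ : 0 ≤ E₂)
    (hE₁ : ∀ h k : ℤ, h ≠ 0 → |h| ≤ N → |k| ≤ N' → ‖∑ i ∈ s, w i * e (h * x i + k * y i)‖ ≤ E₁)
    (hE₂ : ∀ k : ℤ, k ≠ 0 → |k| ≤ N' → ‖∑ i ∈ s, w i * e (k * y i)‖ ≤ E₂) :
    ‖∑ i ∈ s, w i * (f (x i) * f' (y i)) - a * a' * ∑ i ∈ s, w i‖ ≤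
      B * (B' * E₁) + ‖a‖ * (B' * E₂) := by
  obtain ⟨c, h0, hB, hc⟩ := hf
  obtain ⟨c', h0', hB', hc'⟩ := hf'
  set I := Icc (-(N : ℤ)) N
  set I' := Icc (-(N' : ℤ)) N'
  have hB0 : 0 ≤ B := le_trans (sum_nonneg fun _ _ => norm_nonneg _) hB
  have hB0' : 0 ≤ B' := le_trans (sum_nonneg fun _ _ => norm_nonneg _) hB'
  set G : ℤ → ℂ := fun h => ∑ k ∈ I', c' k * ∑ i ∈ s, w i * e (h * x i + k * y i) with hG
  have hsum : ∑ i ∈ s, w i * (f (x i) * f' (y i)) = ∑ h ∈ I, c h * G h := by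
    simp only [hG, hc, hc', sum_mul_sum]
    simp only [mul_sum]
    rw [sum_comm]
    refine sum_congr rfl fun h _ => ?_
    rw [sum_comm]
    refine sum_congr rfl fun k _ => sum_congr rfl fun i _ => ?_
    rw [e_add]
    ring
  have hmem : (0 : ℤ) ∈ I := by simp [I]
  have hmem' : (0 : ℤ) ∈ I' := by simp [I']
  have hbound : ∀ (J : Finset ℤ) (b S : ℤ → ℂ) (D E : ℝ), 0 ≤ E → ∑ h ∈ J, ‖b h‖ ≤ D →
      (∀ h ∈ J, ‖S h‖ ≤ E) → ‖∑ h ∈ J, b h * S h‖ ≤ D * E := by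
    intro J b S D E hE hD hS
    refine (norm_sum_le _ _).trans (le_trans ?_ (mul_le_mul_of_nonneg_right hD hE))
    rw [sum_mul]
    refine sum_le_sum fun h hh => ?_
    rw [norm_mul]
    gcongr
    exact hS h hh
  have herase : ∀ (J : Finset ℤ) (b : ℤ → ℂ) (D : ℝ), ∑ h ∈ J, ‖b h‖ ≤ D →
      ∑ h ∈ J.erase 0, ‖b h‖ ≤ D := fun J b D hD =>
    (sum_le_sum_of_subset_of_nonneg (erase_subset _ _) fun _ _ _ => norm_nonneg _).trans hD
  have hne : ‖∑ h ∈ I.erase 0, c h * G h‖ ≤ B * (B' * E₁) := by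
    refine hbound _ _ _ _ _ (by positivity) (herase _ _ _ hB) fun h hh => ?_
    rw [mem_erase, mem_Icc] at hh
    refine hbound _ _ _ _ _ h₁ hB' fun k hk => hE₁ h k hh.1 (abs_le.2 hh.2) ?_
    rw [mem_Icc] at hk
    exact abs_le.2 hk
  have hzero : ‖∑ k ∈ I'.erase 0, c' k * ∑ i ∈ s, w i * e (k * y i)‖ ≤ B' * E₂ := by
    refine hbound _ _ _ _ _ h₂ (herase _ _ _ hB') fun k hk => ?_
    rw [mem_erase, mem_Icc] at hk
    exact hE₂ k hk.1 (abs_le.2 hk.2)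
  have hG0 : G 0 = a' * ∑ i ∈ s, w i + ∑ k ∈ I'.erase 0, c' k * ∑ i ∈ s, w i * e (k * y i) := by
    simp only [hG, Int.cast_zero, zero_mul, zero_add]
    rw [← add_sum_erase _ _ hmem', h0']
    simp only [Int.cast_zero, zero_mul, e_zero, mul_one]
  rw [hsum, ← add_sum_erase _ _ hmem, h0, hG0]
  calc _ = ‖∑ h ∈ I.erase 0, c h * G h +
        a * ∑ k ∈ I'.erase 0, c' k * ∑ i ∈ s, w i * e (k * y i)‖ := by congr 1; ring
    _ ≤ _ := (norm_add_le _ _).trans (add_le_add hne (by rw [norm_mul]; gcongr))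

theorem exists_rat_abs_sub_lt_den_gt {α : ℝ} (hα : Irrational α) (B : ℕ) :
    ∃ q : ℚ, |α - q| < 1 / (q.den : ℝ) ^ 2 ∧ B < q.den := by
  by_contra! hcon
  refine Real.infinite_rat_abs_sub_lt_one_div_den_sq_of_irrational hα ?_
  set D : ℤ := ⌈(|α| + 1) * B⌉
  refine ((Set.finite_Icc (-D) D).image2 (fun (a : ℤ) (b : ℕ) => (a / b : ℚ))
    (Set.finite_Iic B)).subset fun q hq => ?_
  have hden := hcon q hq
  refine ⟨q.num, ?_, q.den, hden, Rat.num_div_den q⟩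
  have hq1 : (1 : ℝ) ≤ q.den := by exact_mod_cast q.den_pos
  have h1 : |α - q| < 1 := by
    refine lt_of_lt_of_le hq ?_
    rw [div_le_one (by positivity)]
    exact one_le_pow₀ hq1
  have h2 : |(q : ℝ)| ≤ |α| + 1 := by
    have := abs_sub_abs_le_abs_sub (q : ℝ) α
    rw [abs_sub_comm] at this
    linarith
  have h3 : (q.num : ℝ) = q * q.den := by exact_mod_cast (Rat.mul_den_eq_num q).symm
  have h4 : |(q.num : ℝ)| ≤ (|α| + 1) * B := by
    rw [h3, abs_mul, Nat.abs_cast]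
    gcongr
  have h5 : |(q.num : ℝ)| ≤ D := h4.trans (Int.le_ceil _)
  rw [Set.mem_Icc, ← abs_le]
  exact_mod_cast h5

theorem exists_pow_le_lt_succ_pow {k : ℕ} (hk : k ≠ 0) (q : ℕ) :
    ∃ y, y ^ k ≤ q ∧ q < (y + 1) ^ k := by
  refine ⟨Nat.findGreatest (fun y => y ^ k ≤ q) q, ?_, ?_⟩
  · exact Nat.findGreatest_spec (P := fun y => y ^ k ≤ q) (Nat.zero_le q)
      (by simp [zero_pow hk])
  · by_contra! hcon
    have h1 := Nat.le_findGreatest (P := fun y => y ^ k ≤ q)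
      ((Nat.le_self_pow hk _).trans hcon) hcon
    omega

theorem exists_eq_floor_rpow_of_nint_lt {c : ℝ} (hc1 : 1 < c) (hc2 : c < 12 / 11) {n X H : ℕ}
    (hn : 0 < n) (hnX : n ≤ X) (hH : 8 * (X : ℝ) ^ (1 - 1 / c) ≤ H)
    (h : nint ((n : ℝ) ^ (1 / c) + 1 / H) < 1 / H) :
    ∃ m : ℕ, 0 < m ∧ (n : ℤ) = ⌊(m : ℝ) ^ c⌋ := by
  have hc0 : 0 < c := by linarith
  have hγ : 1 / 2 < 1 / c := by
    rw [div_lt_div_iff₀ (by norm_num) hc0]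
    linarith
  have hγ1 : 1 / c < 1 := by rwa [div_lt_one hc0]
  have hn' : (0 : ℝ) < n := by exact_mod_cast hn
  have hX : (1 : ℝ) ≤ X := by exact_mod_cast hn.trans_le hnX
  have hX0 : (0 : ℝ) < X := by linarith
  have hXp := Real.rpow_pos_of_pos hX0 (1 - 1 / c)
  have hHp : (0 : ℝ) < H := by linarith
  have hgap : (n : ℝ) ^ (1 / c) + 2 / H ≤ ((n : ℝ) + 1) ^ (1 / c) := by
    have h1 := rpow_le_rpow_add_mul_sub (by linarith) hγ1.le (by linarith : (0 : ℝ) < n + 1) hn'.le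
    have h2 : (2 * (X : ℝ)) ^ (1 / c - 1) ≤ ((n : ℝ) + 1) ^ (1 / c - 1) := by
      refine Real.rpow_le_rpow_of_nonpos (by linarith) ?_ (by linarith)
      have : (n : ℝ) ≤ X := by exact_mod_cast hnX
      linarith
    have h3 : (1 / 2 : ℝ) ≤ 2 ^ (1 / c - 1) := by
      have := Real.rpow_le_rpow_of_exponent_le (x := 2) (by norm_num)
        (by linarith : (-1 : ℝ) ≤ 1 / c - 1)
      rwa [Real.rpow_neg_one, ← one_div] at this
    have h4 : (X : ℝ) ^ (1 / c - 1) * (X : ℝ) ^ (1 - 1 / c) = 1 := by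
      rw [← Real.rpow_add hX0]
      simp
    have h5 := Real.rpow_pos_of_pos hX0 (1 / c - 1)
    rw [Real.mul_rpow (by norm_num) hX0.le] at h2
    have h6 : 2 / (H : ℝ) ≤ (X : ℝ) ^ (1 / c - 1) / 4 := by
      rw [div_le_div_iff₀ hHp (by norm_num)]
      calc (2 : ℝ) * 4 = (X : ℝ) ^ (1 / c - 1) * (8 * (X : ℝ) ^ (1 - 1 / c)) := by
            rw [mul_left_comm, h4]; norm_num
        _ ≤ _ := by gcongr
    have h7 : (X : ℝ) ^ (1 / c - 1) / 4 ≤ 1 / c * ((n : ℝ) + 1) ^ (1 / c - 1) := by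
      calc (X : ℝ) ^ (1 / c - 1) / 4 = 1 / 2 * (1 / 2 * (X : ℝ) ^ (1 / c - 1)) := by ring
        _ ≤ 1 / c * (2 ^ (1 / c - 1) * (X : ℝ) ^ (1 / c - 1)) := by gcongr
        _ ≤ _ := by gcongr
    linarith
  rw [nint, abs_lt] at h
  set m := round ((n : ℝ) ^ (1 / c) + 1 / H)
  have hm1 : (n : ℝ) ^ (1 / c) < m := by linarith
  have hm2 : (m : ℝ) < ((n : ℝ) + 1) ^ (1 / c) := by
    have : 2 / (H : ℝ) = 1 / H + 1 / H := by ring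
    linarith
  have hm0 : (0 : ℝ) < m := (Real.rpow_pos_of_pos hn' _).trans hm1
  have hm0' : 0 < m := by exact_mod_cast hm0
  obtain ⟨k, hk⟩ := Int.eq_ofNat_of_zero_le hm0'.le
  rw [hk, Int.cast_natCast] at hm0 hm1 hm2
  refine ⟨k, by exact_mod_cast hm0, ?_⟩
  have hinv : ∀ x : ℝ, 0 ≤ x → (x ^ (1 / c)) ^ c = x := fun x hx => by
    rw [← Real.rpow_mul hx, one_div_mul_cancel hc0.ne', Real.rpow_one]
  rw [eq_comm, Int.floor_eq_iff]
  constructor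
  · have := Real.rpow_lt_rpow (Real.rpow_nonneg hn'.le _) hm1 hc0
    rw [hinv _ hn'.le] at this
    exact_mod_cast this.le
  · have := Real.rpow_lt_rpow hm0.le hm2 hc0
    rw [hinv _ (by linarith)] at this
    exact_mod_cast this

open ArithmeticFunction in
theorem div_four_le_sum_vonMangoldt {X : ℕ} (hX : 401 ≤ X) :
    (X : ℝ) / 4 ≤ ∑ n ∈ Ioc 0 X with X < 16 * n, vonMangoldt n := by
  have hX' : (401 : ℝ) ≤ X := by exact_mod_cast hX
  have hlog : Real.log (X + 1) ≤ X / 10 := by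
    have h1 : Real.log (X + 1) = 2 * Real.log (√(X + 1)) := by
      rw [Real.log_sqrt (by linarith)]
      ring
    have h2 := Real.log_le_self (Real.sqrt_nonneg ((X : ℝ) + 1))
    have h3 : √((X : ℝ) + 1) ≤ X / 20 := Real.sqrt_le_iff.2 ⟨by linarith, by nlinarith⟩
    linarith
  have hge := Chebyshev.psi_ge X
  have hle := Chebyshev.psi_le_const_mul_self (x := X / 16) (by linarith)
  have hlog2 := Real.log_two_gt_d9
  have hlog2' := Real.log_two_lt_d9
  have hlog4 : Real.log 4 = 2 * Real.log 2 := by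
    rw [← Real.log_rpow (by norm_num)]
    norm_num
  have hsplit : Chebyshev.psi X ≤
      ∑ n ∈ Ioc 0 X with X < 16 * n, vonMangoldt n + Chebyshev.psi (X / 16) := by
    rw [Chebyshev.psi, Chebyshev.psi, Nat.floor_natCast,
      ← sum_filter_add_sum_filter_not (Ioc 0 X) (fun n => X < 16 * n)]
    gcongr
    intro n hn
    simp only [mem_filter, mem_Ioc, not_lt] at hn ⊢
    refine ⟨hn.1.1, Nat.le_floor ?_⟩
    rw [le_div_iff₀ (by norm_num), mul_comm]
    exact_mod_cast hn.2
  nlinarith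

open ArithmeticFunction in
theorem sum_vonMangoldt_mul_le {X : ℕ} (hX : 1 ≤ X) {M : ℝ} (hM : 0 ≤ M) (s : Finset ℕ)
    (hs : s ⊆ Ioc 0 X) (F : ℕ → ℝ) (hF : ∀ n, F n ≤ M) (hF' : ∀ n ∈ s, n.Prime → F n ≤ 0) :
    ∑ n ∈ s, vonMangoldt n * F n ≤ M * (2 * √X * Real.log X) := by
  have h := Chebyshev.psi_sub_theta_le (x := X) (by exact_mod_cast hX)
  rw [Chebyshev.psi_sub_theta_eq_sum_not_prime, Nat.floor_natCast] at h
  calc ∑ n ∈ s, vonMangoldt n * F n ≤ ∑ n ∈ s with ¬ n.Prime, M * vonMangoldt n := by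
        rw [sum_filter]
        refine sum_le_sum fun n hn => ?_
        split_ifs with hp
        · exact mul_nonpos_of_nonneg_of_nonpos vonMangoldt_nonneg (hF' n hn hp)
        · rw [mul_comm]
          exact mul_le_mul_of_nonneg_right (hF n) vonMangoldt_nonneg
    _ ≤ ∑ n ∈ Ioc 0 X with ¬ n.Prime, M * vonMangoldt n :=
        sum_le_sum_of_subset_of_nonneg (filter_subset_filter _ hs) fun n _ _ =>
          mul_nonneg hM vonMangoldt_nonneg
    _ ≤ _ := by
        rw [← mul_sum]
        gcongr

open ArithmeticFunction in
theorem exists_prime_of_norm_sum_le {α β c θ : ℝ} (hc1 : 1 < c) (hc2 : c < 12 / 11) (hθ : 0 ≤ θ)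
    {X H K : ℕ} (hX : 401 ≤ X) (hH : 8 * (X : ℝ) ^ (1 - 1 / c) ≤ H) (hK : (X : ℝ) ^ θ ≤ K)
    {E₁ E₂ : ℝ} (h₁ : 0 ≤ E₁) (h₂ : 0 ≤ E₂)
    (hE₁ : ∀ h k : ℤ, h ≠ 0 → |h| ≤ (2 * H : ℕ) → |k| ≤ (2 * K : ℕ) →
      ‖∑ n ∈ Ioc 0 X with X < 16 * n, (vonMangoldt n : ℂ) *
        e (h * ((n : ℝ) ^ (1 / c) + 1 / H) + k * (α * n + β))‖ ≤ E₁)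
    (hE₂ : ∀ k : ℤ, k ≠ 0 → |k| ≤ (2 * K : ℕ) →
      ‖∑ n ∈ Ioc 0 X with X < 16 * n, (vonMangoldt n : ℂ) * e (k * (α * n + β))‖ ≤ E₂)
    (hlt : 3 * (4 * H * K * E₁ + 2 * K * E₂) + 8 * H * K * √X * Real.log X < X / 8) :
    ∃ p : ℕ, X < 16 * p ∧ p.Prime ∧ (∃ n : ℕ, 0 < n ∧ (p : ℤ) = ⌊(n : ℝ) ^ c⌋) ∧
      nint (α * p + β) < (p : ℝ) ^ (-θ) := by
  by_contra! hcon
  have hX' : (1 : ℝ) ≤ X := by exact_mod_cast (by omega : 1 ≤ X)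
  have hX0 : (0 : ℝ) < X := by linarith
  have hHp : (0 : ℝ) < H := by linarith [Real.rpow_pos_of_pos hX0 (1 - 1 / c)]
  have hKp : (0 : ℝ) < K := by linarith [Real.rpow_pos_of_pos hX0 θ]
  obtain ⟨f, g, a, hf0, hg0, hfg, ha0, ha, hf, hg⟩ :=
    exists_isTrigPoly_majorized H (by exact_mod_cast hHp)
  obtain ⟨f', g', a', hf0', hg0', hfg', ha0', ha', hf', hg'⟩ :=
    exists_isTrigPoly_majorized K (by exact_mod_cast hKp)
  set s := {n ∈ Ioc 0 X | X < 16 * n} with hs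
  set x : ℕ → ℝ := fun n => (n : ℝ) ^ (1 / c) + 1 / H with hx
  set y : ℕ → ℝ := fun n => α * n + β with hy
  have hff := norm_sum_trigPoly_mul_sub_le hf hf' h₁ h₂ hE₁ hE₂
  have hgf := norm_sum_trigPoly_mul_sub_le hg hf' h₁ h₂ hE₁ hE₂
  have hfg2 := norm_sum_trigPoly_mul_sub_le hf hg' h₁ h₂ hE₁ hE₂
  have key : ∀ (u v : ℝ → ℝ) (b b' D : ℝ),
      ‖∑ n ∈ s, (vonMangoldt n : ℂ) * ((u (x n) : ℂ) * (v (y n) : ℂ)) -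
        (b : ℂ) * (b' : ℂ) * ∑ n ∈ s, (vonMangoldt n : ℂ)‖ ≤ D →
      |∑ n ∈ s, vonMangoldt n * (u (x n) * v (y n)) - b * b' * ∑ n ∈ s, vonMangoldt n| ≤ D := by
    intro u v b b' D h
    rw [← Real.norm_eq_abs, ← Complex.norm_real]
    push_cast
    exact h
  have k1 := key f f' 1 1
    (2 * H * (2 * K * E₁) + ‖(1 : ℂ)‖ * (2 * K * E₂)) (by rw [Complex.ofReal_one]; exact hff)
  have k2 := key g f' a 1
    (2 * H * (2 * K * E₁) + ‖(a : ℂ)‖ * (2 * K * E₂)) (by rw [Complex.ofReal_one]; exact hgf)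
  have k3 := key f g' 1 a'
    (2 * H * (2 * K * E₁) + ‖(1 : ℂ)‖ * (2 * K * E₂)) (by rw [Complex.ofReal_one]; exact hfg2)
  have hna : ‖(a : ℂ)‖ ≤ 1 := by
    rw [Complex.norm_real, Real.norm_eq_abs, abs_of_nonneg ha0]
    linarith
  have hEa : ‖(a : ℂ)‖ * (2 * K * E₂) ≤ 2 * K * E₂ :=
    mul_le_of_le_one_left (by positivity) hna
  have hPsi := div_four_le_sum_vonMangoldt hX
  set Ψ := ∑ n ∈ s, vonMangoldt n
  have hup := sum_vonMangoldt_mul_le (X := X) (by omega) (M := 2 * H * (2 * K)) (by positivity) s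
    (filter_subset _ _) (fun n => f (x n) * f' (y n) - g (x n) * f' (y n) - f (x n) * g' (y n))
    ?_ ?_
  · have hexp : ∑ n ∈ s, vonMangoldt n *
        (f (x n) * f' (y n) - g (x n) * f' (y n) - f (x n) * g' (y n)) =
        ∑ n ∈ s, vonMangoldt n * (f (x n) * f' (y n)) -
        ∑ n ∈ s, vonMangoldt n * (g (x n) * f' (y n)) -
        ∑ n ∈ s, vonMangoldt n * (f (x n) * g' (y n)) := by
      simp only [mul_sub, sum_sub_distrib]
    rw [hexp] at hup
    rw [abs_le] at k1 k2 k3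
    simp only [norm_one, one_mul, mul_one] at k1 k2 k3
    have h3 : a * Ψ ≤ 1 / 4 * Ψ := by gcongr
    have h4 : a' * Ψ ≤ 1 / 4 * Ψ := by gcongr
    nlinarith
  · intro n
    have b1 := hf.norm_le (x n)
    have b2 := hf'.norm_le (y n)
    rw [Complex.norm_real, Real.norm_eq_abs, abs_of_nonneg (hf0 _)] at b1
    rw [Complex.norm_real, Real.norm_eq_abs, abs_of_nonneg (hf0' _)] at b2
    have h1 := mul_nonneg (hg0 (x n)) (hf0' (y n))
    have h2 := mul_nonneg (hf0 (x n)) (hg0' (y n))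
    have h3 : f (x n) * f' (y n) ≤ 2 * H * (2 * K) := mul_le_mul b1 b2 (hf0' _) (by positivity)
    linarith
  · intro n hn hp
    simp only [hs, mem_filter, mem_Ioc] at hn
    have h1 := mul_nonneg (hg0 (x n)) (hf0' (y n))
    have h2 := mul_nonneg (hf0 (x n)) (hg0' (y n))
    by_cases hxn : 1 / H ≤ nint (x n)
    · have := mul_le_mul_of_nonneg_right (hfg _ hxn) (hf0' (y n))
      linarith
    by_cases hyn : 1 / K ≤ nint (y n)
    · have := mul_le_mul_of_nonneg_left (hfg' _ hyn) (hf0 (x n))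
      linarith
    exfalso
    push Not at hxn hyn
    have hc := hcon n hn.2 hp
      (exists_eq_floor_rpow_of_nint_lt hc1 hc2 hn.1.1 hn.1.2 hH hxn)
    have hn0 : (0 : ℝ) < n := by exact_mod_cast hn.1.1
    have hnX : (n : ℝ) ≤ X := by exact_mod_cast hn.1.2
    have h5 : (1 : ℝ) / K ≤ (n : ℝ) ^ (-θ) := by
      rw [Real.rpow_neg hn0.le, ← one_div]
      exact one_div_le_one_div_of_le (Real.rpow_pos_of_pos hn0 _)
        ((Real.rpow_le_rpow hn0.le hnX hθ).trans hK)
    exact absurd (hc.trans_lt hyn) (not_lt.2 h5)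

theorem sum_mul_window (X R : ℕ) (w g : ℕ → ℂ) :
    ∑ n ∈ Ioc 0 X, w n * window X R g n = ∑ n ∈ Ioc 0 X with X < R * n, w n * g n := by
  rw [sum_filter]
  refine sum_congr rfl fun n hn => ?_
  simp only [window, (mem_Ioc.1 hn).2, and_true, mul_ite, mul_zero]

theorem norm_sum_mul_e_le_of_eq_add {s : Finset ℕ} {w : ℕ → ℂ} {u v : ℕ → ℝ} {b E : ℝ}
    (huv : ∀ n, u n = b + v n) (h : ‖∑ n ∈ s, w n * e (v n)‖ ≤ E) :
    ‖∑ n ∈ s, w n * e (u n)‖ ≤ E := by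
  have : ∑ n ∈ s, w n * e (u n) = e b * ∑ n ∈ s, w n * e (v n) := by
    rw [mul_sum]
    refine sum_congr rfl fun n _ => ?_
    rw [huv, e_add]
    ring
  rwa [this, norm_mul, norm_e, one_mul]

theorem eventually_mul_natCast_rpow_neg_lt (C : ℝ) {δ η : ℝ} (hδ : 0 < δ) (hη : 0 < η) :
    ∀ᶠ Y : ℕ in Filter.atTop, C * (Y : ℝ) ^ (-δ) < η := by
  have h := ((tendsto_rpow_neg_atTop hδ).comp tendsto_natCast_atTop_atTop).const_mul C
  rw [mul_zero] at h
  exact h.eventually_lt_const hη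

theorem two_mul_mul_le_pow {y k d : ℝ} (hy : 16 ≤ y) (hk : k ≤ 4 * y ^ 3) (hd : 0 ≤ d)
    (hdy : d ≤ y ^ 20) : 2 * (k * d) ≤ y ^ 24 := by
  have hy0 : 0 ≤ y := by linarith
  calc 2 * (k * d) ≤ 2 * (4 * y ^ 3 * y ^ 20) := by gcongr
    _ = 8 * y ^ 23 := by ring
    _ ≤ y * y ^ 23 := by gcongr; linarith
    _ = y ^ 24 := by ring

set_option maxHeartbeats 400000 in
theorem eventually_exists_prime {α β c θ : ℝ} (hc1 : 1 < c) (hc2 : c < 12 / 11) (hθ1 : 0 < θ)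
    (hθ2 : θ < (12 / c - 11) / 26) :
    ∀ᶠ Y : ℕ in Filter.atTop, ∀ q : ℚ, |α - q| < 1 / (q.den : ℝ) ^ 2 → Y ^ 24 ≤ q.den →
      q.den < (Y + 1) ^ 24 → ∃ p : ℕ, Y ^ 60 < 16 * p ∧ p.Prime ∧
        (∃ n : ℕ, 0 < n ∧ (p : ℤ) = ⌊(n : ℝ) ^ c⌋) ∧ nint (α * p + β) < (p : ℝ) ^ (-θ) := by
  have hc0 : 0 < c := by linarith
  have hγ : 11 / 12 < 1 / c := by
    rw [div_lt_div_iff₀ (by norm_num) hc0]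
    linarith
  have hγ1 : 1 / c < 1 := by rwa [div_lt_one hc0]
  have h12 : 12 / c = 12 * (1 / c) := by ring
  rw [h12] at hθ2
  set γ := 1 / c with hγdef
  obtain ⟨σ, hσ⟩ : ∃ σ, σ = 60 * γ - 55 - 60 * θ := ⟨_, rfl⟩
  have hσ0 : 0 < σ := by linarith
  have hσ5 : σ < 5 := by linarith
  obtain ⟨C₁, hC₁, hrpow⟩ := exists_norm_sum_vonMangoldt_e_rpow_le hγ hγ1
    (by norm_num : (0 : ℝ) ≤ 18) (by norm_num : 0 < 16) (by linarith : 0 < σ / 20)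
  obtain ⟨C₂, hC₂, hlin⟩ := exists_norm_sum_vonMangoldt_e_linear_le
    (by norm_num : (0 : ℝ) ≤ 2 ^ 25) (by norm_num : 0 < 16) (by linarith : 0 < σ / 20)
  filter_upwards [Filter.eventually_ge_atTop 16,
    eventually_mul_natCast_rpow_neg_lt (216 * C₁) (by linarith : 0 < 19 * σ / 20)
      (by norm_num : (0 : ℝ) < 1 / 40),
    eventually_mul_natCast_rpow_neg_lt (12 * C₂) (by norm_num : (0 : ℝ) < 1 / 4)
      (by norm_num : (0 : ℝ) < 1 / 40)] with Y hY hY₁ hY₂ q hq hq₁ hq₂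
  have hy : (16 : ℝ) ≤ Y := by exact_mod_cast hY
  have hy0 : (0 : ℝ) < Y := by linarith
  have hy1 : (1 : ℝ) ≤ Y := by linarith
  have hXs : ∀ s : ℝ, (((Y ^ 60 : ℕ) : ℝ)) ^ s = (Y : ℝ) ^ (60 * s) := fun s => by
    rw [Nat.cast_pow, ← Real.rpow_natCast, ← Real.rpow_mul hy0.le, Nat.cast_ofNat]
  set H := ⌈8 * ((Y ^ 60 : ℕ) : ℝ) ^ (1 - γ)⌉₊ with hHdef
  set K := ⌈((Y ^ 60 : ℕ) : ℝ) ^ θ⌉₊ with hKdef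
  have hHp : 0 < H := Nat.ceil_pos.2 (by positivity)
  have hH : (H : ℝ) ≤ 9 * (Y : ℝ) ^ (60 * (1 - γ)) := by
    have h1 := (Nat.ceil_lt_add_one (by positivity :
      0 ≤ 8 * ((Y ^ 60 : ℕ) : ℝ) ^ (1 - γ))).le
    have h2 := Real.one_le_rpow hy1 (by linarith : 0 ≤ 60 * (1 - γ))
    rw [← hHdef, hXs] at h1
    linarith
  have hK : (K : ℝ) ≤ 2 * (Y : ℝ) ^ (60 * θ) := by
    have h1 := (Nat.ceil_lt_add_one (by positivity : 0 ≤ ((Y ^ 60 : ℕ) : ℝ) ^ θ)).le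
    have h2 := Real.one_le_rpow hy1 (by linarith : 0 ≤ 60 * θ)
    rw [← hKdef, hXs] at h1
    linarith
  have hHK : (H : ℝ) * K ≤ 18 * (Y : ℝ) ^ (5 - σ) := by
    calc (H : ℝ) * K ≤ 9 * (Y : ℝ) ^ (60 * (1 - γ)) * (2 * (Y : ℝ) ^ (60 * θ)) := by gcongr
      _ = 18 * ((Y : ℝ) ^ (60 * (1 - γ)) * (Y : ℝ) ^ (60 * θ)) := by ring
      _ = 18 * (Y : ℝ) ^ (5 - σ) := by
        rw [← Real.rpow_add hy0]
        congr 2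
        linarith
  refine exists_prime_of_norm_sum_le (H := H) (K := K)
    (E₁ := C₁ * (Y : ℝ) ^ (σ / 20) * (Y : ℝ) ^ 55)
    (E₂ := C₂ * (Y : ℝ) ^ (σ / 20) * (Y : ℝ) ^ 57) hc1 hc2 hθ1.le
    (le_trans (by norm_num) (Nat.pow_le_pow_left hY 60)) (Nat.le_ceil _) (Nat.le_ceil _)
    (by positivity) (by positivity) ?_ ?_ ?_
  · intro h k hh hh' _
    refine norm_sum_mul_e_le_of_eq_add (b := h / H + k * β)
      (v := fun n => k * α * n + h * (n : ℝ) ^ γ) (fun n => by ring) ?_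
    rw [← sum_mul_window (Y ^ 60) 16 _ (fun n => e (k * α * n + h * (n : ℝ) ^ γ))]
    refine hrpow Y (k * α) h hY hh ?_
    have h1 : |(h : ℝ)| ≤ 2 * H := by exact_mod_cast hh'
    have h2 := hXs γ
    rw [Nat.cast_pow] at h2
    calc |(h : ℝ)| * ((Y : ℝ) ^ 60) ^ γ ≤
        2 * (9 * (Y : ℝ) ^ (60 * (1 - γ))) * (Y : ℝ) ^ (60 * γ) := by
          rw [h2]
          gcongr
          linarith
      _ = 18 * ((Y : ℝ) ^ (60 * (1 - γ)) * (Y : ℝ) ^ (60 * γ)) := by ring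
      _ = 18 * (Y : ℝ) ^ 60 := by
        rw [← Real.rpow_add hy0, ← Real.rpow_natCast]
        congr 2
        push_cast
        ring
  · intro k hk hk'
    refine norm_sum_mul_e_le_of_eq_add (b := k * β) (v := fun n => k * α * n)
      (fun n => by ring) ?_
    rw [← sum_mul_window (Y ^ 60) 16 _ (fun n => e (k * α * n))]
    have hqp : (0 : ℝ) < q.den := by exact_mod_cast q.den_pos
    refine hlin Y (k * α) (1 / (2 * (q.den : ℝ))) hY (by positivity) ?_ fun d hd hd' => ?_
    · have h1 : (q.den : ℝ) ≤ (2 * (Y : ℝ)) ^ 24 := by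
        refine le_trans (by exact_mod_cast hq₂.le : (q.den : ℝ) ≤ ((Y : ℝ) + 1) ^ 24) ?_
        gcongr
        linarith
      rw [one_div_one_div]
      calc 2 * (q.den : ℝ) ≤ 2 * (2 * (Y : ℝ)) ^ 24 := by gcongr
        _ = _ := by ring
    · have h1 : |(k : ℝ)| ≤ 2 * K := by exact_mod_cast hk'
      have h2 : (d : ℝ) ≤ (Y : ℝ) ^ 20 := by exact_mod_cast hd'
      have h3 : (Y : ℝ) ^ (60 * θ) ≤ (Y : ℝ) ^ 3 := by
        rw [← Real.rpow_natCast]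
        refine Real.rpow_le_rpow_of_exponent_le hy1 ?_
        norm_num
        linarith
      have h4 : 2 * (|(k : ℝ)| * d) ≤ q.den := by
        refine le_trans ?_ (by exact_mod_cast hq₁ : (Y : ℝ) ^ 24 ≤ q.den)
        exact two_mul_mul_le_pow hy (h1.trans (by linarith only [hK, h3])) (Nat.cast_nonneg d) h2
      have h5 : 2 * |k * (d : ℤ)| ≤ q.den := by
        rw [abs_mul, Nat.abs_cast]
        exact_mod_cast h4
      obtain ⟨ν, hν, hν'⟩ := exists_int_add_le_mul_of_abs_sub_lt hq
        (mul_ne_zero hk (by exact_mod_cast hd.ne')) h5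
      have h6 : ((k * (d : ℤ) : ℤ) : ℝ) * α = k * α * d := by push_cast; ring
      rw [h6] at hν hν'
      exact ⟨ν, hν, hν'⟩
  · have hsqrt : √((Y ^ 60 : ℕ) : ℝ) = (Y : ℝ) ^ 30 := by
      rw [Nat.cast_pow, show (Y : ℝ) ^ 60 = ((Y : ℝ) ^ 30) ^ 2 by ring]
      exact Real.sqrt_sq (by positivity)
    have hlog : Real.log ((Y ^ 60 : ℕ) : ℝ) ≤ 60 * Y := by
      rw [Nat.cast_pow, Real.log_pow]
      have := Real.log_le_self hy0.le
      push_cast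
      linarith
    have hlog0 : 0 ≤ Real.log ((Y ^ 60 : ℕ) : ℝ) := Real.log_natCast_nonneg _
    have hpow : (Y : ℝ) ^ (5 - σ) ≤ (Y : ℝ) ^ 5 := by
      rw [← Real.rpow_natCast]
      refine Real.rpow_le_rpow_of_exponent_le hy1 ?_
      norm_num
      linarith
    have t1 : 12 * H * K * (C₁ * (Y : ℝ) ^ (σ / 20) * (Y : ℝ) ^ 55) ≤ (Y : ℝ) ^ 60 / 40 := by
      have h1 : (Y : ℝ) ^ (5 - σ) * (Y : ℝ) ^ (σ / 20) =
          (Y : ℝ) ^ (-(19 * σ / 20)) * (Y : ℝ) ^ 5 := by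
        rw [← Real.rpow_add hy0, ← Real.rpow_natCast, ← Real.rpow_add hy0]
        congr 1
        push_cast
        ring
      calc 12 * H * K * (C₁ * (Y : ℝ) ^ (σ / 20) * (Y : ℝ) ^ 55) =
          12 * (H * K) * (C₁ * (Y : ℝ) ^ (σ / 20) * (Y : ℝ) ^ 55) := by ring
        _ ≤ 12 * (18 * (Y : ℝ) ^ (5 - σ)) * (C₁ * (Y : ℝ) ^ (σ / 20) * (Y : ℝ) ^ 55) := by gcongr
        _ = 216 * C₁ * ((Y : ℝ) ^ (5 - σ) * (Y : ℝ) ^ (σ / 20)) * (Y : ℝ) ^ 55 := by ring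
        _ = 216 * C₁ * (Y : ℝ) ^ (-(19 * σ / 20)) * (Y : ℝ) ^ 60 := by rw [h1]; ring
        _ ≤ 1 / 40 * (Y : ℝ) ^ 60 := by gcongr
        _ = _ := by ring
    have t2 : 6 * K * (C₂ * (Y : ℝ) ^ (σ / 20) * (Y : ℝ) ^ 57) ≤ (Y : ℝ) ^ 60 / 40 := by
      have h1 : (Y : ℝ) ^ (60 * θ) * (Y : ℝ) ^ (σ / 20) ≤
          (Y : ℝ) ^ (-(1 / 4) : ℝ) * (Y : ℝ) ^ 3 := by
        rw [← Real.rpow_add hy0, ← Real.rpow_natCast, ← Real.rpow_add hy0]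
        refine Real.rpow_le_rpow_of_exponent_le hy1 ?_
        push_cast
        linarith
      calc 6 * K * (C₂ * (Y : ℝ) ^ (σ / 20) * (Y : ℝ) ^ 57) ≤
          6 * (2 * (Y : ℝ) ^ (60 * θ)) * (C₂ * (Y : ℝ) ^ (σ / 20) * (Y : ℝ) ^ 57) := by gcongr
        _ = 12 * C₂ * ((Y : ℝ) ^ (60 * θ) * (Y : ℝ) ^ (σ / 20)) * (Y : ℝ) ^ 57 := by ring
        _ ≤ 12 * C₂ * ((Y : ℝ) ^ (-(1 / 4) : ℝ) * (Y : ℝ) ^ 3) * (Y : ℝ) ^ 57 := by gcongr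
        _ = 12 * C₂ * (Y : ℝ) ^ (-(1 / 4) : ℝ) * (Y : ℝ) ^ 60 := by ring
        _ ≤ 1 / 40 * (Y : ℝ) ^ 60 := by gcongr
        _ = _ := by ring
    have t3 : 8 * H * K * √((Y ^ 60 : ℕ) : ℝ) * Real.log ((Y ^ 60 : ℕ) : ℝ) ≤
        (Y : ℝ) ^ 60 / 40 := by
      have hHK' : (H : ℝ) * K ≤ 18 * (Y : ℝ) ^ 5 := hHK.trans (by gcongr)
      calc 8 * H * K * √((Y ^ 60 : ℕ) : ℝ) * Real.log ((Y ^ 60 : ℕ) : ℝ) =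
          8 * (H * K) * √((Y ^ 60 : ℕ) : ℝ) * Real.log ((Y ^ 60 : ℕ) : ℝ) := by ring
        _ ≤ 8 * (18 * (Y : ℝ) ^ 5) * (Y : ℝ) ^ 30 * (60 * Y) := by
          rw [hsqrt]
          gcongr
        _ = 8640 * (Y : ℝ) ^ 36 := by ring
        _ ≤ (Y : ℝ) ^ 24 / 40 * (Y : ℝ) ^ 36 := by
          gcongr
          have : (16 : ℝ) ^ 24 ≤ (Y : ℝ) ^ 24 := by gcongr
          linarith
        _ = _ := by ring
    have hpos : (0 : ℝ) < (Y : ℝ) ^ 60 := by positivity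
    rw [Nat.cast_pow] at t3 ⊢
    linarith

theorem dimitrov_thm (α : ℝ) (hα : Irrational α) (β c θ : ℝ)
    (hc1 : 1 < c) (hc2 : c < 12/11) (hθ1 : 0 < θ) (hθ2 : θ < (12/c - 11)/26) :
    {p : ℕ | p.Prime ∧ (∃ n : ℕ, 0 < n ∧ (p : ℤ) = ⌊(n:ℝ)^c⌋) ∧
      nint (α * p + β) < (p:ℝ)^(-θ)}.Infinite := by
  obtain ⟨Y₀, hY₀⟩ := Filter.eventually_atTop.1 (eventually_exists_prime (α := α) (β := β)
    hc1 hc2 hθ1 hθ2)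
  refine Set.infinite_of_forall_exists_gt fun M => ?_
  obtain ⟨q, hq, hqB⟩ := exists_rat_abs_sub_lt_den_gt hα ((max Y₀ (16 * M + 1) + 1) ^ 24)
  obtain ⟨Y, hY, hY'⟩ := exists_pow_le_lt_succ_pow (k := 24) (by norm_num) q.den
  have h1 : max Y₀ (16 * M + 1) + 1 < Y + 1 :=
    lt_of_pow_lt_pow_left₀ 24 (Nat.zero_le _) (hqB.trans hY')
  obtain ⟨p, hp, hp1, hp2, hp3⟩ := hY₀ Y (by omega) q hq hY hY'
  refine ⟨p, ⟨hp1, hp2, hp3⟩, ?_⟩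
  have h2 := Nat.le_self_pow (by norm_num : 60 ≠ 0) Y
  omega
end

section
/- Fix a real number c with 1 < c < 9/8 and set γ = 1/c. There exists X₀ > 0 such that for every integer X ≥ X₀, setting δ = γ·X^{γ−1}/10, every integer a with X/2 ≤ a < X satisfying ‖a^γ + 2δ‖ < δ can be written as a = ⌊n^c⌋ for some positive integer n. -/
open Finset

theorem Real.rpow_add_mul_rpow_sub_one_le {p x : ℝ} (hp0 : 0 ≤ p) (hp1 : p ≤ 1) (hx : 0 ≤ x) :
    x ^ p + p * (x + 1) ^ (p - 1) ≤ (x + 1) ^ p := by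
  have hy : 0 < x + 1 := by linarith
  have hs : -1 ≤ -(1 / (x + 1)) := by
    rw [neg_le_neg_iff, div_le_one hy]
    linarith
  have hB := rpow_one_add_le_one_add_mul_self hs hp0 hp1
  have hfac : 1 + -(1 / (x + 1)) = x / (x + 1) := by
    field_simp
    ring
  rw [hfac, Real.div_rpow hx hy.le, div_le_iff₀ (Real.rpow_pos_of_pos hy p)] at hB
  rw [Real.rpow_sub_one hy.ne']
  calc x ^ p + p * ((x + 1) ^ p / (x + 1))
      ≤ (1 + p * -(1 / (x + 1))) * (x + 1) ^ p + p * ((x + 1) ^ p / (x + 1)) := by gcongr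
    _ = (x + 1) ^ p := by ring

theorem ps_representation (c : ℝ) (hc1 : 1 < c) (hc2 : c < 9/8) :
    ∃ X₀ : ℝ, 0 < X₀ ∧ ∀ X : ℕ, X₀ ≤ (X:ℝ) →
    ∀ a : ℕ, (X:ℝ)/2 ≤ (a:ℝ) → (a:ℝ) < (X:ℝ) →
    nint ((a:ℝ)^(1/c) + 2 * ((1/c) * (X:ℝ)^(1/c - 1) / 10)) < (1/c) * (X:ℝ)^(1/c - 1) / 10 →
    ∃ n : ℕ, 0 < n ∧ (a : ℤ) = ⌊(n:ℝ)^c⌋ := by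
  refine ⟨1, one_pos, fun X hX a _ haX h => ?_⟩
  have hc0 : 0 < c := by linarith
  have hp0 : 0 < 1 / c := by positivity
  have hp1 : 1 / c ≤ 1 := by
    rw [div_le_one hc0]
    exact hc1.le
  have ha0 : (0 : ℝ) ≤ a := a.cast_nonneg
  have haX' : (a : ℝ) + 1 ≤ X := by exact_mod_cast haX
  have hgap := Real.rpow_add_mul_rpow_sub_one_le hp0.le hp1 ha0
  have hmono : (X : ℝ) ^ (1 / c - 1) ≤ ((a : ℝ) + 1) ^ (1 / c - 1) :=
    Real.rpow_le_rpow_of_nonpos (by positivity) haX' (by linarith)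
  have hd := mul_le_mul_of_nonneg_left hmono hp0.le
  have hdpos : 0 < 1 / c * (X : ℝ) ^ (1 / c - 1) := by positivity
  have hpow0 : (0 : ℝ) ≤ (a : ℝ) ^ (1 / c) := by positivity
  set d := 1 / c * (X : ℝ) ^ (1 / c - 1)
  rw [nint, abs_lt] at h
  obtain ⟨h1, h2⟩ := h
  generalize round ((a : ℝ) ^ (1 / c) + 2 * (d / 10)) = m at h1 h2
  have hm : 0 < m := by
    have : (0 : ℝ) < m := by linarith
    exact_mod_cast this
  lift m to ℕ using hm.le
  rw [Int.cast_natCast] at h1 h2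
  refine ⟨m, by exact_mod_cast hm, ?_⟩
  rw [eq_comm, Int.floor_eq_iff, Int.cast_natCast]
  have hinv : ∀ y : ℝ, 0 ≤ y → (y ^ (1 / c)) ^ c = y := fun y hy => by
    rw [one_div, Real.rpow_inv_rpow hy hc0.ne']
  constructor
  · calc (a : ℝ) = ((a : ℝ) ^ (1 / c)) ^ c := (hinv a ha0).symm
      _ ≤ (m : ℝ) ^ c := Real.rpow_le_rpow hpow0 (by linarith) hc0.le
  · calc (m : ℝ) ^ c < (((a : ℝ) + 1) ^ (1 / c)) ^ c :=
          Real.rpow_lt_rpow m.cast_nonneg (by linarith) hc0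
      _ = a + 1 := hinv _ (by positivity)
end

section
/- There is an absolute constant C > 0 with the following property. Let α be a real number, a an integer and q a positive integer with gcd(a, q) = 1 and |α − a/q| < q^{−2}. Then for all real K, N ≥ 1 and all complex numbers α_k (K < k ≤ 2K) and β_n (N < n ≤ 2N), one has |Σ_{K < k ≤ 2K} Σ_{N < n ≤ 2N} α_k·β_n·e(αkn)| ≤ C·(Σ_{K < k ≤ 2K} |α_k|² · Σ_{N < n ≤ 2N} |β_n|²)^{1/2}·(KN/q + K + N + q)^{1/2}·(log(2KNq))^{1/2}, where k and n run over integers in the indicated ranges. -/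
open Finset

noncomputable def IocN (Y : ℝ) : Finset ℕ :=
  (Finset.range (⌊2*Y⌋₊ + 1)).filter fun k => Y < (k:ℝ) ∧ (k:ℝ) ≤ 2*Y

theorem conj_e (x : ℝ) : (starRingEnd ℂ) (e x) = e (-x) := by
  rw [e, e, ← Complex.exp_conj]
  congr 1
  simp only [map_mul, Complex.conj_ofReal, Complex.conj_I, map_ofNat]
  push_cast
  ring

theorem e_mul_natCast (x : ℝ) (k : ℕ) : e (x * k) = e x ^ k := by
  rw [e, e, ← Complex.exp_nat_mul]
  congr 1
  push_cast
  ring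

theorem norm_e_sub_one (x : ℝ) : ‖e x - 1‖ = 2 * |Real.sin (Real.pi * x)| := by
  have h : (2 * Real.pi * Complex.I * x : ℂ) = Complex.I * ((2 * Real.pi * x : ℝ) : ℂ) := by
    push_cast
    ring
  rw [e, h, Complex.norm_exp_I_mul_ofReal_sub_one, Real.norm_eq_abs, abs_mul, abs_two]
  congr 3
  ring

theorem IocN_eq_Ioc {Y : ℝ} (hY : 0 ≤ Y) : IocN Y = Finset.Ioc ⌊Y⌋₊ ⌊2 * Y⌋₊ := by
  ext k
  simp only [IocN, Finset.mem_filter, Finset.mem_range, Finset.mem_Ioc, Nat.floor_lt hY,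
    Nat.le_floor_iff (show 0 ≤ 2 * Y by positivity), Nat.lt_succ_iff]
  tauto

theorem card_IocN_le {Y : ℝ} (hY : 1 ≤ Y) : ((IocN Y).card : ℝ) ≤ 2 * Y := by
  rw [IocN_eq_Ioc (by linarith), Nat.card_Ioc]
  calc ((⌊2 * Y⌋₊ - ⌊Y⌋₊ : ℕ) : ℝ) ≤ (⌊2 * Y⌋₊ : ℝ) := by exact_mod_cast Nat.sub_le _ _
    _ ≤ 2 * Y := Nat.floor_le (by linarith)

/-- The Jordan inequality on both halves of `[0, π]`. -/
theorem two_mul_min_le_sin {y : ℝ} (h0 : 0 ≤ y) (h1 : y ≤ 1) :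
    2 * min y (1 - y) ≤ Real.sin (Real.pi * y) := by
  have hpi := Real.pi_pos
  rcases le_total y (1 / 2) with h | h
  · rw [min_eq_left (by linarith)]
    convert Real.mul_le_sin (x := Real.pi * y) (by positivity) (by nlinarith) using 1
    field_simp
  · rw [min_eq_right (by linarith), ← Real.sin_pi_sub]
    convert Real.mul_le_sin (x := Real.pi - Real.pi * y) (by nlinarith) (by nlinarith) using 1
    field_simp

theorem norm_sum_e_le (x : ℝ) (m : ℤ) {d₁ d₂ : ℝ} (h₁ : 0 < d₁) (h₂ : 0 < d₂)
    (hx₁ : d₁ ≤ x - m) (hx₂ : x - m ≤ 1 - d₂) {K : ℝ} (hK : 0 ≤ K) :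
    ‖∑ k ∈ IocN K, e (x * k)‖ ≤ 1 / (2 * d₁) + 1 / (2 * d₂) := by
  set y := x - m with hy
  have hsin : |Real.sin (Real.pi * x)| = |Real.sin (Real.pi * y)| := by
    rw [hy, mul_sub, mul_comm Real.pi (m : ℝ), Real.sin_sub_int_mul_pi, abs_mul]
    simp
  have hlow : 4 * min d₁ d₂ ≤ ‖e x - 1‖ := by
    rw [norm_e_sub_one, hsin]
    have h3 := two_mul_min_le_sin (y := y) (by linarith) (by linarith)
    have h4 : min d₁ d₂ ≤ min y (1 - y) := min_le_min hx₁ (by linarith)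
    have h5 := le_abs_self (Real.sin (Real.pi * y))
    linarith
  have hpos : 0 < min d₁ d₂ := lt_min h₁ h₂
  have hgeom : ‖∑ k ∈ IocN K, e (x * k)‖ * ‖e x - 1‖ ≤ 2 := by
    have hI : IocN K = Finset.Ico (⌊K⌋₊ + 1) (⌊2 * K⌋₊ + 1) := by
      rw [IocN_eq_Ioc hK]
      ext k
      simp only [Finset.mem_Ioc, Finset.mem_Ico]
      omega
    have hle : ⌊K⌋₊ + 1 ≤ ⌊2 * K⌋₊ + 1 := by
      gcongr
      linarith
    rw [hI]
    simp only [e_mul_natCast]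
    rw [← norm_mul, Finset.sum_Ico_eq_sub _ hle, sub_mul, geom_sum_mul, geom_sum_mul]
    calc _ = ‖e x ^ (⌊2 * K⌋₊ + 1) - e x ^ (⌊K⌋₊ + 1)‖ := by
          congr 1
          ring
      _ ≤ ‖e x ^ (⌊2 * K⌋₊ + 1)‖ + ‖e x ^ (⌊K⌋₊ + 1)‖ := norm_sub_le _ _
      _ = 2 := by
          rw [norm_pow, norm_pow, norm_e]
          norm_num
  have hmain : ‖∑ k ∈ IocN K, e (x * k)‖ ≤ 1 / (2 * min d₁ d₂) := by
    rw [le_div_iff₀ (by positivity)]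
    have := mul_le_mul_of_nonneg_left hlow (norm_nonneg (∑ k ∈ IocN K, e (x * k)))
    linarith
  refine hmain.trans ?_
  have p₁ : 0 < 1 / (2 * d₁) := by positivity
  have p₂ : 0 < 1 / (2 * d₂) := by positivity
  rcases min_choice d₁ d₂ with h | h <;> rw [h] <;> linarith

theorem norm_sum_e_le_two_mul (x : ℝ) {K : ℝ} (hK : 1 ≤ K) :
    ‖∑ k ∈ IocN K, e (x * k)‖ ≤ 2 * K := by
  refine (norm_sum_le _ _).trans ?_
  simp only [norm_e, Finset.sum_const, nsmul_eq_mul, mul_one]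
  exact card_IocN_le hK

noncomputable def spacedBound (A : ℝ) (q v : ℕ) : ℝ :=
  (if v ≤ 1 then A else 0) + (q : ℝ) / v

theorem spacedBound_nonneg {A : ℝ} (hA : 0 ≤ A) (q v : ℕ) : 0 ≤ spacedBound A q v := by
  unfold spacedBound
  split_ifs <;> positivity

theorem sum_spacedBound_le {A : ℝ} (hA : 0 ≤ A) (q : ℕ) :
    ∑ v ∈ Finset.range q, spacedBound A q v ≤ 2 * A + q * (1 + Real.log q) := by
  unfold spacedBound
  rw [Finset.sum_add_distrib]
  gcongr
  · rw [← Finset.sum_filter, Finset.sum_const, nsmul_eq_mul]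
    gcongr
    have h : (Finset.range q).filter (fun v => v ≤ 1) ⊆ Finset.range 2 := by
      intro v
      simp only [Finset.mem_filter, Finset.mem_range]
      omega
    exact_mod_cast (Finset.card_le_card h).trans (Finset.card_range 2).le
  · simp only [div_eq_mul_inv]
    rw [← Finset.mul_sum]
    gcongr
    refine le_trans ?_ (harmonic_le_one_add_log q)
    calc ∑ v ∈ Finset.range q, (v : ℝ)⁻¹ ≤ ∑ v ∈ Finset.range (q + 1), (v : ℝ)⁻¹ :=
          Finset.sum_le_sum_of_subset_of_nonneg (Finset.range_subset_range.2 q.le_succ)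
            fun _ _ _ => by positivity
      _ = (harmonic q : ℝ) := by
          rw [Finset.sum_range_succ']
          simp [harmonic]

theorem norm_sum_e_le_spacedBound {K : ℝ} (hK : 1 ≤ K) {q u : ℕ} (hu : u < q) (x : ℝ) (m : ℤ)
    (h₁ : (u : ℝ) - 1 ≤ q * (x - m)) (h₂ : q * (x - m) ≤ u + 2) :
    ‖∑ k ∈ IocN K, e (x * k)‖ ≤
      spacedBound (2 * K) q u + spacedBound (2 * K) q (q - 1 - u) := by
  have hA : 0 ≤ 2 * K := by linarith
  have hq : (0 : ℝ) < q := by exact_mod_cast (Nat.zero_le u).trans_lt hu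
  by_cases hu1 : u ≤ 1
  · refine (norm_sum_e_le_two_mul x hK).trans ?_
    have h3 : 2 * K ≤ spacedBound (2 * K) q u := by
      rw [spacedBound, if_pos hu1]
      have : (0 : ℝ) ≤ q / u := by positivity
      linarith
    linarith [spacedBound_nonneg hA q (q - 1 - u)]
  by_cases hv1 : q - 1 - u ≤ 1
  · refine (norm_sum_e_le_two_mul x hK).trans ?_
    have h3 : 2 * K ≤ spacedBound (2 * K) q (q - 1 - u) := by
      rw [spacedBound, if_pos hv1]
      have : (0 : ℝ) ≤ q / ((q - 1 - u : ℕ) : ℝ) := by positivity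
      linarith
    linarith [spacedBound_nonneg hA q u]
  rw [spacedBound, spacedBound, if_neg hu1, if_neg hv1, zero_add, zero_add]
  obtain ⟨v, hv⟩ : ∃ v, v = q - 1 - u := ⟨_, rfl⟩
  rw [← hv] at hv1 ⊢
  have hquv : (q : ℝ) = u + v + 1 := by
    have : q = u + v + 1 := by omega
    exact_mod_cast this
  have hu2 : (2 : ℝ) ≤ u := by exact_mod_cast (by omega : 2 ≤ u)
  have hv2 : (2 : ℝ) ≤ v := by exact_mod_cast (by omega : 2 ≤ v)
  have key := norm_sum_e_le x m (d₁ := u / (2 * q)) (d₂ := v / (2 * q)) (by positivity)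
    (by positivity) (by rw [div_le_iff₀ (by positivity)]; linarith)
    (by
      rw [le_sub_iff_add_le, ← le_sub_iff_add_le', div_le_iff₀ (by positivity)]
      linarith) (K := K) (by linarith)
  refine key.trans (le_of_eq ?_)
  field_simp

theorem sum_block_le {α : ℝ} {a : ℤ} {q : ℕ} (hq : 0 < q) (hgcd : Int.gcd a (q : ℤ) = 1)
    (hα : |α - (a : ℝ) / (q : ℝ)| < 1 / (q : ℝ) ^ 2) {K : ℝ} (hK : 1 ≤ K) (h₀ : ℤ) :
    ∑ r ∈ Finset.range q, ‖∑ k ∈ IocN K, e (α * ((h₀ + r : ℤ) : ℝ) * k)‖ ≤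
      8 * K + 2 * (q * (1 + Real.log q)) := by
  have hqR : (0 : ℝ) < q := by exact_mod_cast hq
  have hqZ : (0 : ℤ) < q := by exact_mod_cast hq
  have hA : 0 ≤ 2 * K := by linarith
  set t : ℤ := ⌊q * (α * h₀)⌋ with ht
  set σ : ℕ → ℕ := fun r => ((t + a * r) % q).toNat with hσ
  set g : ℕ → ℝ := fun u => spacedBound (2 * K) q u + spacedBound (2 * K) q (q - 1 - u) with hg
  have hσc : ∀ r, ((σ r : ℕ) : ℤ) = (t + a * r) % q := fun r =>
    Int.toNat_of_nonneg (Int.emod_nonneg _ hqZ.ne')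
  have hσlt : ∀ r, σ r < q := fun r => by
    have := Int.emod_lt_of_pos (t + a * r) hqZ
    rw [← hσc] at this
    exact_mod_cast this
  have hinj : Set.InjOn σ (Finset.range q) := by
    intro r hr s hs hrs
    simp only [Finset.coe_range, Set.mem_Iio] at hr hs
    have h1 : (t + a * r) % (q : ℤ) = (t + a * s) % q := by rw [← hσc, ← hσc, hrs]
    have h2 : (q : ℤ) ∣ a * (s - r) := by
      have := Int.ModEq.dvd h1
      convert this using 1
      ring
    have h3 : (q : ℤ) ∣ s - r :=
      (Int.isCoprime_iff_gcd_eq_one.2 (by rw [Int.gcd_comm]; exact hgcd)).dvd_of_dvd_mul_left h2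
    have h4 : (s : ℤ) - r = 0 := Int.eq_zero_of_abs_lt_dvd h3 (by rw [abs_lt]; omega)
    omega
  have hterm : ∀ r ∈ Finset.range q,
      ‖∑ k ∈ IocN K, e (α * ((h₀ + r : ℤ) : ℝ) * k)‖ ≤ g (σ r) := by
    intro r hr
    rw [Finset.mem_range] at hr
    have hrR : (r : ℝ) < q := by exact_mod_cast hr
    have hdec : (t : ℝ) + a * r = q * (((t + a * r) / q : ℤ) : ℝ) + σ r := by
      have := Int.mul_ediv_add_emod (t + a * r) q
      rw [← hσc] at this
      exact_mod_cast this.symm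
    have herr : |q * (r * (α - a / q))| ≤ 1 := by
      rw [abs_mul, abs_mul, Nat.abs_cast, Nat.abs_cast]
      calc (q : ℝ) * (r * |α - a / q|) ≤ q * (q * (1 / (q : ℝ) ^ 2)) := by gcongr
        _ = 1 := by field_simp
    rw [abs_le] at herr
    have hfl := Int.floor_le ((q : ℝ) * (α * h₀))
    have hfl' := Int.lt_floor_add_one ((q : ℝ) * (α * h₀))
    rw [← ht] at hfl hfl'
    have hexp : (q : ℝ) * (α * ((h₀ + r : ℤ) : ℝ) - (((t + a * r) / q : ℤ) : ℝ)) =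
        σ r + (q * (α * h₀) - t) + q * (r * (α - a / q)) := by
      have : (q : ℝ) * (r * (α - a / q)) = q * (r * α) - a * r := by field_simp
      rw [this]
      push_cast at hdec ⊢
      linarith
    exact norm_sum_e_le_spacedBound hK (hσlt r) _ ((t + a * r) / q)
      (by rw [hexp]; linarith) (by rw [hexp]; linarith)
  calc _ ≤ ∑ r ∈ Finset.range q, g (σ r) := Finset.sum_le_sum hterm
    _ = ∑ u ∈ (Finset.range q).image σ, g u := (Finset.sum_image hinj).symm
    _ ≤ ∑ u ∈ Finset.range q, g u := by
        refine Finset.sum_le_sum_of_subset_of_nonneg ?_ fun u _ _ =>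
          add_nonneg (spacedBound_nonneg hA _ _) (spacedBound_nonneg hA _ _)
        intro u hu
        obtain ⟨r, -, rfl⟩ := Finset.mem_image.1 hu
        exact Finset.mem_range.2 (hσlt r)
    _ = 2 * ∑ u ∈ Finset.range q, spacedBound (2 * K) q u := by
        rw [Finset.sum_add_distrib, Finset.sum_range_reflect, ← two_mul]
    _ ≤ 2 * (2 * (2 * K) + q * (1 + Real.log q)) := by
        gcongr
        exact sum_spacedBound_le hA q
    _ = _ := by ring

theorem sum_range_le_of_sum_block_le {f : ℤ → ℝ} (hf : ∀ h, 0 ≤ f h) {q : ℕ} (hq : 0 < q)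
    {B : ℝ} (hB : ∀ h₀ : ℤ, ∑ r ∈ Finset.range q, f (h₀ + r) ≤ B) (h₀ : ℤ) (M : ℕ) :
    ∑ i ∈ Finset.range M, f (h₀ + i) ≤ ((M : ℝ) / q + 1) * B := by
  have hB0 : 0 ≤ B := (Finset.sum_nonneg fun _ _ => hf _).trans (hB 0)
  have hblocks : ∀ j : ℕ, ∑ i ∈ Finset.range (q * j), f (h₀ + i) ≤ j * B := by
    intro j
    induction j with
    | zero => simp
    | succ j ih =>
      rw [mul_add_one, Finset.sum_range_add]
      have := hB (h₀ + (q * j : ℕ))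
      push_cast at this ⊢
      simp only [← add_assoc]
      linarith
  calc _ ≤ ∑ i ∈ Finset.range (q * (M / q + 1)), f (h₀ + i) :=
        Finset.sum_le_sum_of_subset_of_nonneg
          (Finset.range_subset_range.2 (Nat.lt_mul_div_succ M hq).le) fun _ _ _ => hf _
    _ ≤ ((M / q + 1 : ℕ) : ℝ) * B := hblocks _
    _ ≤ _ := by
        push_cast
        gcongr
        exact Nat.cast_div_le

/-- Schur's test for the Gram matrix of the columns of `E`. -/
theorem sum_norm_sq_le_of_gram_row_sum_le {ι κ : Type*} (s : Finset κ) (t : Finset ι)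
    (E : κ → ι → ℂ) (b : ι → ℂ) {B : ℝ}
    (hB : ∀ m ∈ t, ∑ n ∈ t, ‖∑ k ∈ s, E k n * (starRingEnd ℂ) (E k m)‖ ≤ B) :
    ∑ k ∈ s, ‖∑ n ∈ t, b n * E k n‖ ^ 2 ≤ B * ∑ n ∈ t, ‖b n‖ ^ 2 := by
  set G : ι → ι → ℂ := fun n m => ∑ k ∈ s, E k n * (starRingEnd ℂ) (E k m) with hG
  have hsymm : ∀ n m, ‖G n m‖ = ‖G m n‖ := by
    intro n m
    rw [← RCLike.norm_conj (G m n)]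
    simp only [hG, map_sum, map_mul, Complex.conj_conj]
    simp only [mul_comm]
  have hexpand : ((∑ k ∈ s, ‖∑ n ∈ t, b n * E k n‖ ^ 2 : ℝ) : ℂ) =
      ∑ n ∈ t, ∑ m ∈ t, b n * (starRingEnd ℂ) (b m) * G n m := by
    push_cast
    simp only [← Complex.mul_conj', map_sum, map_mul, Finset.sum_mul_sum]
    rw [Finset.sum_comm]
    refine Finset.sum_congr rfl fun n _ => ?_
    rw [Finset.sum_comm]
    refine Finset.sum_congr rfl fun m _ => ?_
    rw [hG, Finset.mul_sum]
    refine Finset.sum_congr rfl fun k _ => ?_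
    ring
  have hnonneg : 0 ≤ ∑ k ∈ s, ‖∑ n ∈ t, b n * E k n‖ ^ 2 :=
    Finset.sum_nonneg fun _ _ => by positivity
  calc ∑ k ∈ s, ‖∑ n ∈ t, b n * E k n‖ ^ 2
      = ‖∑ n ∈ t, ∑ m ∈ t, b n * (starRingEnd ℂ) (b m) * G n m‖ := by
        rw [← hexpand, Complex.norm_real, Real.norm_of_nonneg hnonneg]
    _ ≤ ∑ n ∈ t, ∑ m ∈ t, (‖b n‖ ^ 2 / 2 * ‖G m n‖ + ‖b m‖ ^ 2 / 2 * ‖G n m‖) := by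
        refine (norm_sum_le _ _).trans (Finset.sum_le_sum fun n _ => ?_)
        refine (norm_sum_le _ _).trans (Finset.sum_le_sum fun m _ => ?_)
        rw [norm_mul, norm_mul, RCLike.norm_conj, hsymm m n, ← add_mul]
        gcongr
        linarith [two_mul_le_add_sq ‖b n‖ ‖b m‖]
    _ = ∑ n ∈ t, ‖b n‖ ^ 2 * ∑ m ∈ t, ‖G m n‖ := by
        simp only [Finset.sum_add_distrib]
        rw [Finset.sum_comm (f := fun n m => ‖b m‖ ^ 2 / 2 * ‖G n m‖), ← Finset.sum_add_distrib]
        refine Finset.sum_congr rfl fun n _ => ?_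
        rw [← Finset.mul_sum]
        ring
    _ ≤ ∑ n ∈ t, ‖b n‖ ^ 2 * B := by
        gcongr with n hn
        exact hB n hn
    _ = _ := by rw [← Finset.sum_mul, mul_comm]

theorem gram_row_sum_le {α : ℝ} {a : ℤ} {q : ℕ} (hq : 0 < q) (hgcd : Int.gcd a (q : ℤ) = 1)
    (hα : |α - (a : ℝ) / (q : ℝ)| < 1 / (q : ℝ) ^ 2) {K N : ℝ} (hK : 1 ≤ K) (hN : 1 ≤ N)
    (m : ℕ) :
    ∑ n ∈ IocN N, ‖∑ k ∈ IocN K,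
        e (α * (k : ℝ) * (n : ℝ)) * (starRingEnd ℂ) (e (α * (k : ℝ) * (m : ℝ)))‖ ≤
      (2 * N / q + 1) * (8 * K + 2 * (q * (1 + Real.log q))) := by
  set f : ℤ → ℝ := fun h => ‖∑ k ∈ IocN K, e (α * (h : ℝ) * k)‖ with hf
  have hrow : ∑ n ∈ IocN N, ‖∑ k ∈ IocN K,
        e (α * (k : ℝ) * (n : ℝ)) * (starRingEnd ℂ) (e (α * (k : ℝ) * (m : ℝ)))‖ =
      ∑ i ∈ Finset.range (IocN N).card, f ((⌊N⌋₊ + 1 - m : ℤ) + i) := by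
    have hI : IocN N = Finset.Ico (⌊N⌋₊ + 1) (⌊2 * N⌋₊ + 1) := by
      rw [IocN_eq_Ioc (by linarith)]
      ext k
      simp only [Finset.mem_Ioc, Finset.mem_Ico]
      omega
    rw [hI, Finset.sum_Ico_eq_sum_range, Nat.card_Ico]
    refine Finset.sum_congr rfl fun i _ => ?_
    simp only [hf]
    congr 1
    refine Finset.sum_congr rfl fun k _ => ?_
    rw [conj_e, ← e_add]
    congr 1
    push_cast
    ring
  have hlog : 0 ≤ Real.log q := Real.log_natCast_nonneg q
  rw [hrow]
  refine (sum_range_le_of_sum_block_le (f := f) (fun _ => norm_nonneg _) hq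
    (sum_block_le hq hgcd hα hK) _ _).trans ?_
  gcongr
  exact card_IocN_le hN

theorem row_bound_le_log {K N : ℝ} (hK : 1 ≤ K) (hN : 1 ≤ N) {q : ℕ} (hq : 0 < q) :
    (2 * N / q + 1) * (8 * K + 2 * (q * (1 + Real.log q))) ≤
      49 * ((K * N / q + K + N + q) * Real.log (2 * K * N * q)) := by
  have hqR : (1 : ℝ) ≤ q := by exact_mod_cast hq
  have hlog : 0 ≤ Real.log q := Real.log_natCast_nonneg q
  have hKN : 1 ≤ K * N := one_le_mul_of_one_le_of_one_le hK hN
  have hL : Real.log 2 + Real.log q ≤ Real.log (2 * K * N * q) := by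
    rw [← Real.log_mul (by norm_num) (by positivity)]
    apply Real.log_le_log (by positivity)
    nlinarith
  have h2 := Real.log_two_gt_d9
  have hL3 : 1 + Real.log q ≤ 3 * Real.log (2 * K * N * q) := by linarith
  have hX : 0 < K * N / q + K + N + q := by positivity
  have hKNq : 0 ≤ K * N / q := by positivity
  calc (2 * N / q + 1) * (8 * K + 2 * (q * (1 + Real.log q)))
      = (16 * (K * N / q) + 8 * K) * 1 + (4 * N + 2 * q) * (1 + Real.log q) := by
        field_simp
        ring
    _ ≤ (16 * (K * N / q) + 8 * K) * (1 + Real.log q) + (4 * N + 2 * q) * (1 + Real.log q) := by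
        gcongr
        linarith
    _ = (16 * (K * N / q) + 8 * K + 4 * N + 2 * q) * (1 + Real.log q) := by ring
    _ ≤ (16 * (K * N / q + K + N + q)) * (3 * Real.log (2 * K * N * q)) := by
        gcongr
        linarith
    _ ≤ _ := by
        have : 0 ≤ (K * N / q + K + N + q) * Real.log (2 * K * N * q) :=
          mul_nonneg hX.le (by linarith)
        linarith

theorem bilinear_bound :
    ∃ C : ℝ, 0 < C ∧
    ∀ α : ℝ, ∀ a : ℤ, ∀ q : ℕ, 0 < q → Int.gcd a (q:ℤ) = 1 →
    |α - (a:ℝ)/(q:ℝ)| < 1/(q:ℝ)^2 →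
    ∀ K N : ℝ, 1 ≤ K → 1 ≤ N →
    ∀ αk βn : ℕ → ℂ,
    ‖∑ k ∈ IocN K, ∑ n ∈ IocN N, αk k * βn n * e (α * (k:ℝ) * (n:ℝ))‖ ≤
      C * Real.sqrt ((∑ k ∈ IocN K, ‖αk k‖^2) * (∑ n ∈ IocN N, ‖βn n‖^2)) *
        Real.sqrt (K*N/(q:ℝ) + K + N + (q:ℝ)) * Real.sqrt (Real.log (2*K*N*(q:ℝ))) := by
  refine ⟨7, by norm_num, ?_⟩
  intro α a q hq hgcd hα K N hK hN αk βn
  set P := ∑ k ∈ IocN K, ‖αk k‖ ^ 2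
  set Q := ∑ n ∈ IocN N, ‖βn n‖ ^ 2
  set X := K * N / (q : ℝ) + K + N + (q : ℝ)
  set L := Real.log (2 * K * N * (q : ℝ))
  have hP : 0 ≤ P := Finset.sum_nonneg fun _ _ => by positivity
  have hQ : 0 ≤ Q := Finset.sum_nonneg fun _ _ => by positivity
  have hX : 0 ≤ X := by positivity
  have hdual : ∑ k ∈ IocN K, ‖∑ n ∈ IocN N, βn n * e (α * (k : ℝ) * (n : ℝ))‖ ^ 2 ≤
      49 * (X * L) * Q :=
    (sum_norm_sq_le_of_gram_row_sum_le (IocN K) (IocN N)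
      (fun k n => e (α * (k : ℝ) * (n : ℝ))) βn
      fun m _ => gram_row_sum_le hq hgcd hα hK hN m).trans
      (mul_le_mul_of_nonneg_right (row_bound_le_log hK hN hq) hQ)
  calc ‖∑ k ∈ IocN K, ∑ n ∈ IocN N, αk k * βn n * e (α * (k : ℝ) * (n : ℝ))‖
      ≤ ∑ k ∈ IocN K, ‖αk k‖ * ‖∑ n ∈ IocN N, βn n * e (α * (k : ℝ) * (n : ℝ))‖ := by
        refine (norm_sum_le _ _).trans (Finset.sum_le_sum fun k _ => ?_)
        simp only [mul_assoc (αk k)]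
        rw [← Finset.mul_sum, norm_mul]
    _ ≤ √P * √(∑ k ∈ IocN K, ‖∑ n ∈ IocN N, βn n * e (α * (k : ℝ) * (n : ℝ))‖ ^ 2) :=
        Real.sum_mul_le_sqrt_mul_sqrt _ _ _
    _ ≤ √P * √(7 ^ 2 * (X * L) * Q) := by
        gcongr
        norm_num
        exact hdual
    _ = 7 * √(P * Q) * √X * √L := by
        rw [Real.sqrt_mul' _ hQ, Real.sqrt_mul (by norm_num), Real.sqrt_sq (by norm_num),
          Real.sqrt_mul hX, Real.sqrt_mul hP]
        ring
end
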